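/- arXiv:1505.06057 — 2 statements merged into one kernel-verified Lean document; each statement's English description precedes it below -/
import Mathlib

section
/- Let n, m, p ∈ ℕ with either n = m = 1 or gcd(n,m) ≥ 2, and let ψ be a decreasing positive function. If ∑_{(a,b)∈ℕ²} ψ(h_{a,b})/h_{a,b}^{1−1/p} = ∞, where h_{a,b} = max(aⁿ, bᵐ), then the set of (x,y) ∈ [0,1)² such that |aⁿx + bᵐy − cᵖ| < ψ(h_{a,b}) holds for infinitely many (a,b,c) ∈ ℕ² × ℤ_{≥0} has full Lebesgue measure in [0,1)². -/
open MeasureTheory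

/-- The area of a parallelogram cut out by two strips. -/
lemma volume_real_strip_inter_strip {A B A' B' : ℝ} (hΔ : A * B' - A' * B ≠ 0) (C C' : ℝ)
    {δ δ' : ℝ} (hδ : 0 ≤ δ) (hδ' : 0 ≤ δ') :
    volume.real {z : ℝ × ℝ | |A * z.1 + B * z.2 - C| < δ ∧ |A' * z.1 + B' * z.2 - C'| < δ'} =
      4 * δ * δ' / |A * B' - A' * B| := by
  set f : ℝ × ℝ →ₗ[ℝ] ℝ × ℝ :=
    Matrix.toLin (Module.Basis.finTwoProd ℝ) (Module.Basis.finTwoProd ℝ) !![A, B; A', B'] with hf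
  have hdet : LinearMap.det f = A * B' - A' * B := by
    rw [hf, LinearMap.det_toLin, Matrix.det_fin_two_of]; ring
  have hset : {z : ℝ × ℝ | |A * z.1 + B * z.2 - C| < δ ∧ |A' * z.1 + B' * z.2 - C'| < δ'} =
      f ⁻¹' (Set.Ioo (C - δ) (C + δ) ×ˢ Set.Ioo (C' - δ') (C' + δ')) := by
    ext z
    simp only [Set.mem_ofPred_eq, Set.mem_preimage, hf, Matrix.toLin_finTwoProd_apply,
      Set.mem_prod, Set.mem_Ioo, abs_lt]
    constructor <;> rintro ⟨⟨_, _⟩, _, _⟩ <;> refine ⟨⟨?_, ?_⟩, ?_, ?_⟩ <;> linarith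
  rw [hset, measureReal_def, Measure.addHaar_preimage_linearMap volume (by rw [hdet]; exact hΔ),
    hdet, Measure.volume_eq_prod, Measure.prod_prod, Real.volume_Ioo, Real.volume_Ioo,
    ENNReal.toReal_mul, ENNReal.toReal_mul, ENNReal.toReal_ofReal (abs_nonneg _),
    ENNReal.toReal_ofReal (by linarith), ENNReal.toReal_ofReal (by linarith), abs_inv]
  field_simp
  ring

lemma measurableSet_strip (A B C δ : ℝ) :
    MeasurableSet {z : ℝ × ℝ | |A * z.1 + B * z.2 - C| < δ} :=
  (isOpen_lt (by fun_prop) (by fun_prop)).measurableSet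

/-- The Chung–Erdős inequality. -/
lemma sq_sum_measureReal_le {α ι : Type*} [MeasurableSpace α] (μ : Measure α) [IsFiniteMeasure μ]
    (s : Finset ι) (S : ι → Set α) (hS : ∀ i ∈ s, MeasurableSet (S i)) :
    (∑ i ∈ s, μ.real (S i)) ^ 2 ≤
      μ.real (⋃ i ∈ s, S i) * ∑ i ∈ s, ∑ j ∈ s, μ.real (S i ∩ S j) := by
  classical
  set V : Set α := ⋃ i ∈ s, S i with hV
  have hVm : MeasurableSet V := Finset.measurableSet_biUnion s hS
  have hI : ∀ t : Set α, MeasurableSet t → Integrable (t.indicator (fun _ => (1 : ℝ))) μ :=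
    fun t ht => (integrable_const 1).indicator ht
  have hinter : ∀ t : Set α, MeasurableSet t →
      ∫ x, t.indicator (fun _ => (1 : ℝ)) x ∂μ = μ.real t := by
    intro t ht
    rw [integral_indicator ht, setIntegral_const]; simp
  have hquad : ∀ r : ℝ, 0 ≤ (∑ i ∈ s, ∑ j ∈ s, μ.real (S i ∩ S j))
      - 2 * r * (∑ i ∈ s, μ.real (S i)) + r ^ 2 * μ.real V := by
    intro r
    have key : ∀ x, (∑ i ∈ s, (S i).indicator (fun _ => (1 : ℝ)) x -
        r * V.indicator (fun _ => (1 : ℝ)) x) ^ 2 =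
        (∑ i ∈ s, ∑ j ∈ s, (S i ∩ S j).indicator (fun _ => (1 : ℝ)) x)
        - 2 * r * (∑ i ∈ s, (S i).indicator (fun _ => (1 : ℝ)) x)
        + r ^ 2 * V.indicator (fun _ => (1 : ℝ)) x := by
      intro x
      have h1 : (∑ i ∈ s, (S i).indicator (fun _ => (1 : ℝ)) x) ^ 2 =
          ∑ i ∈ s, ∑ j ∈ s, (S i ∩ S j).indicator (fun _ => (1 : ℝ)) x := by
        rw [sq, Finset.sum_mul_sum]
        refine Finset.sum_congr rfl fun i _ => Finset.sum_congr rfl fun j _ => ?_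
        by_cases h1 : x ∈ S i <;> by_cases h2 : x ∈ S j <;> simp [h1, h2]
      have h2 : (∑ i ∈ s, (S i).indicator (fun _ => (1 : ℝ)) x) *
          V.indicator (fun _ => (1 : ℝ)) x = ∑ i ∈ s, (S i).indicator (fun _ => (1 : ℝ)) x := by
        by_cases hx : x ∈ V
        · simp [hx]
        · have : ∀ i ∈ s, (S i).indicator (fun _ => (1 : ℝ)) x = 0 := by
            intro i hi
            refine Set.indicator_of_notMem (fun h => hx ?_) _
            exact Set.mem_biUnion hi h
          rw [Finset.sum_eq_zero this, zero_mul]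
      have h3 : (V.indicator (fun _ => (1 : ℝ)) x) ^ 2 = V.indicator (fun _ => (1 : ℝ)) x := by
        by_cases hx : x ∈ V <;> simp [hx]
      rw [sub_sq, h1, mul_pow, h3]
      linear_combination (-2 * r) * h2
    have h0 : 0 ≤ ∫ x, (∑ i ∈ s, (S i).indicator (fun _ => (1 : ℝ)) x -
        r * V.indicator (fun _ => (1 : ℝ)) x) ^ 2 ∂μ := integral_nonneg fun x => sq_nonneg _
    simp_rw [key] at h0
    have i1 : Integrable (fun x => ∑ i ∈ s, ∑ j ∈ s,
        (S i ∩ S j).indicator (fun _ => (1 : ℝ)) x) μ :=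
      integrable_finsetSum _ fun i hi => integrable_finsetSum _ fun j hj =>
        hI _ ((hS i hi).inter (hS j hj))
    have i2 : Integrable (fun x => ∑ i ∈ s, (S i).indicator (fun _ => (1 : ℝ)) x) μ :=
      integrable_finsetSum _ fun i hi => hI _ (hS i hi)
    have i3 : Integrable (fun x => (∑ i ∈ s, ∑ j ∈ s, (S i ∩ S j).indicator (fun _ => (1 : ℝ)) x)
        - 2 * r * (∑ i ∈ s, (S i).indicator (fun _ => (1 : ℝ)) x)) μ := i1.sub (i2.const_mul _)
    rw [integral_add i3 ((hI _ hVm).const_mul _),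
      integral_sub i1 (i2.const_mul _), integral_const_mul, integral_const_mul,
      integral_finsetSum _ (fun i hi => integrable_finsetSum _ fun j hj =>
        hI _ ((hS i hi).inter (hS j hj))),
      integral_finsetSum _ (fun i hi => hI _ (hS i hi)), hinter V hVm] at h0
    convert h0 using 3
    · refine Finset.sum_congr rfl fun i hi => ?_
      rw [integral_finsetSum _ (fun j hj => hI _ ((hS i hi).inter (hS j hj)))]
      exact Finset.sum_congr rfl fun j hj => (hinter _ ((hS i hi).inter (hS j hj))).symm
    · congr 1
      exact Finset.sum_congr rfl fun i hi => (hinter _ (hS i hi)).symm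
  have h := discrim_le_zero (a := μ.real V) (b := -2 * ∑ i ∈ s, μ.real (S i))
    (c := ∑ i ∈ s, ∑ j ∈ s, μ.real (S i ∩ S j)) (fun r => by nlinarith [hquad r])
  rw [discrim] at h
  nlinarith [h]

lemma card_le_of_pairwise_abs_sub_le (s : Finset ℤ) {ℓ : ℝ} (hℓ : 0 ≤ ℓ)
    (h : ∀ i ∈ s, ∀ j ∈ s, |(i : ℝ) - j| ≤ ℓ) : (s.card : ℝ) ≤ ℓ + 1 := by
  rcases s.eq_empty_or_nonempty with rfl | hs
  · simp; linarith
  have hsub : s ⊆ Finset.Icc (s.min' hs) (s.min' hs + ⌊ℓ⌋) := by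
    intro i hi
    rw [Finset.mem_Icc]
    refine ⟨Finset.min'_le s i hi, ?_⟩
    have h1 := h i hi _ (s.min'_mem hs)
    have : i - s.min' hs ≤ ⌊ℓ⌋ := Int.le_floor.2 (by push_cast; exact (le_abs_self _).trans h1)
    linarith
  have h1 := Finset.card_le_card hsub
  rw [Int.card_Icc] at h1
  have h2 : (s.card : ℤ) ≤ ⌊ℓ⌋ + 1 := by
    have := Int.floor_nonneg.2 hℓ
    omega
  have h3 : (s.card : ℝ) ≤ (⌊ℓ⌋ : ℝ) + 1 := by exact_mod_cast h2
  linarith [Int.floor_le ℓ]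

lemma card_le_of_pairwise_abs_sub_le_nat (s : Finset ℕ) {ℓ : ℝ} (hℓ : 0 ≤ ℓ)
    (h : ∀ i ∈ s, ∀ j ∈ s, |(i : ℝ) - j| ≤ ℓ) : (s.card : ℝ) ≤ ℓ + 1 := by
  have := card_le_of_pairwise_abs_sub_le (s.map Nat.castEmbedding) hℓ (by simpa using h)
  simpa using this

lemma card_le_of_fiber_abs_sub_le (s : Finset (ℤ × ℤ)) {α β : ℝ} (hα : 0 ≤ α) (hβ : 0 ≤ β)
    (h₂ : ∀ i ∈ s, ∀ j ∈ s, |(i.2 : ℝ) - j.2| ≤ α)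
    (h₁ : ∀ i ∈ s, ∀ j ∈ s, i.2 = j.2 → |(i.1 : ℝ) - j.1| ≤ β) :
    (s.card : ℝ) ≤ (α + 1) * (β + 1) := by
  classical
  have hfib := Finset.card_eq_sum_card_image Prod.snd s
  have h1 : ((s.image Prod.snd).card : ℝ) ≤ α + 1 := by
    refine card_le_of_pairwise_abs_sub_le _ hα ?_
    intro i hi j hj
    obtain ⟨i', hi', rfl⟩ := Finset.mem_image.1 hi
    obtain ⟨j', hj', rfl⟩ := Finset.mem_image.1 hj
    exact h₂ i' hi' j' hj'
  have h2 : ∀ b ∈ s.image Prod.snd, ((s.filter (fun x => x.2 = b)).card : ℝ) ≤ β + 1 := by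
    intro b _
    have hinj : Set.InjOn Prod.fst (s.filter (fun x => x.2 = b) : Set (ℤ × ℤ)) := by
      intro x hx y hy hxy
      simp only [Finset.coe_filter, Set.mem_ofPred_eq] at hx hy
      exact Prod.ext hxy (hx.2.trans hy.2.symm)
    rw [← Finset.card_image_of_injOn hinj]
    refine card_le_of_pairwise_abs_sub_le _ hβ ?_
    intro i hi j hj
    obtain ⟨i', hi', rfl⟩ := Finset.mem_image.1 hi
    obtain ⟨j', hj', rfl⟩ := Finset.mem_image.1 hj
    rw [Finset.mem_filter] at hi' hj'
    exact h₁ i' hi'.1 j' hj'.1 (hi'.2.trans hj'.2.symm)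
  rw [hfib]
  push_cast
  calc ∑ b ∈ s.image Prod.snd, ((s.filter (fun x => x.2 = b)).card : ℝ)
      ≤ ∑ b ∈ s.image Prod.snd, (β + 1) := Finset.sum_le_sum h2
    _ = ((s.image Prod.snd).card : ℝ) * (β + 1) := by simp [mul_add]
    _ ≤ _ := by gcongr

lemma sum_Icc_inv_sq_le (D : ℕ) (hD : 2 ≤ D) :
    ∑ d ∈ Finset.Icc 2 D, ((d : ℝ) ^ 2)⁻¹ ≤ 3 / 4 - 1 / D := by
  induction D, hD using Nat.le_induction with
  | base => norm_num
  | succ D hD ih =>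
    rw [Finset.sum_Icc_succ_top (by omega)]
    have hD' : (2 : ℝ) ≤ D := by exact_mod_cast hD
    have : (((D + 1 : ℕ) : ℝ) ^ 2)⁻¹ ≤ 1 / D - 1 / ((D + 1 : ℕ) : ℝ) := by
      push_cast
      rw [div_sub_div _ _ (by positivity) (by positivity), inv_eq_one_div,
        div_le_div_iff₀ (by positivity) (by positivity)]
      nlinarith
    linarith

/-- A positive proportion of the pairs in a box are coprime and not too small. -/
lemma mul_le_card_coprime (U V : ℕ) :
    (U : ℝ) * V ≤ 8 * (((Finset.Ioc 0 U ×ˢ Finset.Ioc 0 V).filter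
      (fun q => Nat.Coprime q.1 q.2 ∧ U ≤ 16 * q.1 ∧ V ≤ 16 * q.2)).card : ℝ) := by
  classical
  set P := (Finset.Ioc 0 U ×ˢ Finset.Ioc 0 V).filter
      (fun q => Nat.Coprime q.1 q.2 ∧ U ≤ 16 * q.1 ∧ V ≤ 16 * q.2)
  have hsub : Finset.Ioc 0 U ×ˢ Finset.Ioc 0 V ⊆ P ∪
      ((Finset.Icc 2 (U + 2)).biUnion (fun d => (Finset.Ioc 0 U).filter (d ∣ ·) ×ˢ
        (Finset.Ioc 0 V).filter (d ∣ ·)) ∪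
      (Finset.Ioc 0 (U / 16) ×ˢ Finset.Ioc 0 V ∪ Finset.Ioc 0 U ×ˢ Finset.Ioc 0 (V / 16))) := by
    intro q hq
    simp only [Finset.mem_union, Finset.mem_product, Finset.mem_biUnion, Finset.mem_filter,
      Finset.mem_Ioc, Finset.mem_Icc, P] at hq ⊢
    by_cases h1 : U ≤ 16 * q.1
    swap
    · right; right; left; omega
    by_cases h2 : V ≤ 16 * q.2
    swap
    · right; right; right; omega
    by_cases h3 : Nat.Coprime q.1 q.2
    · left; exact ⟨hq, h3, h1, h2⟩
    · right; left
      have hpos : 0 < Nat.gcd q.1 q.2 := Nat.gcd_pos_of_pos_left _ hq.1.1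
      have hle : Nat.gcd q.1 q.2 ≤ q.1 := Nat.gcd_le_left _ hq.1.1
      rw [Nat.Coprime] at h3
      exact ⟨Nat.gcd q.1 q.2, by omega, ⟨hq.1, Nat.gcd_dvd_left _ _⟩, hq.2, Nat.gcd_dvd_right _ _⟩
  have hc := (Finset.card_le_card hsub).trans (Finset.card_union_le _ _)
  have hc2 := Finset.card_union_le ((Finset.Icc 2 (U + 2)).biUnion
    (fun d => (Finset.Ioc 0 U).filter (d ∣ ·) ×ˢ (Finset.Ioc 0 V).filter (d ∣ ·)))
    (Finset.Ioc 0 (U / 16) ×ˢ Finset.Ioc 0 V ∪ Finset.Ioc 0 U ×ˢ Finset.Ioc 0 (V / 16))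
  have hc3 := Finset.card_union_le (Finset.Ioc 0 (U / 16) ×ˢ Finset.Ioc 0 V)
    (Finset.Ioc 0 U ×ˢ Finset.Ioc 0 (V / 16))
  have hc4 := Finset.card_biUnion_le (s := Finset.Icc 2 (U + 2))
    (t := fun d => (Finset.Ioc 0 U).filter (d ∣ ·) ×ˢ (Finset.Ioc 0 V).filter (d ∣ ·))
  simp only [Finset.card_product, Nat.card_Ioc, Nat.Ioc_filter_dvd_card_eq_div] at hc hc2 hc3 hc4
  have h4 : ((∑ d ∈ Finset.Icc 2 (U + 2), U / d * (V / d) : ℕ) : ℝ) ≤ 3 / 4 * (U * V) := by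
    push_cast
    calc ∑ d ∈ Finset.Icc 2 (U + 2), ((U / d : ℕ) : ℝ) * ((V / d : ℕ) : ℝ)
        ≤ ∑ d ∈ Finset.Icc 2 (U + 2), (U * V : ℝ) * ((d : ℝ) ^ 2)⁻¹ := by
          refine Finset.sum_le_sum fun d _ => ?_
          calc ((U / d : ℕ) : ℝ) * ((V / d : ℕ) : ℝ) ≤ (U / d : ℝ) * (V / d : ℝ) :=
                mul_le_mul Nat.cast_div_le Nat.cast_div_le (by positivity) (by positivity)
            _ = _ := by ring
      _ = (U * V : ℝ) * ∑ d ∈ Finset.Icc 2 (U + 2), ((d : ℝ) ^ 2)⁻¹ := by rw [Finset.mul_sum]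
      _ ≤ (U * V : ℝ) * (3 / 4) := by
          gcongr
          have := sum_Icc_inv_sq_le (U + 2) (by omega)
          have : (0 : ℝ) ≤ 1 / ((U + 2 : ℕ) : ℝ) := by positivity
          linarith
      _ = _ := by ring
  have h5 : ((U / 16 : ℕ) : ℝ) * V ≤ U * V / 16 := by
    have : ((U / 16 : ℕ) : ℝ) ≤ U / 16 := by exact_mod_cast Nat.cast_div_le (α := ℝ) (n := 16)
    calc ((U / 16 : ℕ) : ℝ) * V ≤ U / 16 * V := by gcongr
      _ = _ := by ring
  have h6 : (U : ℝ) * ((V / 16 : ℕ) : ℝ) ≤ U * V / 16 := by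
    have : ((V / 16 : ℕ) : ℝ) ≤ V / 16 := by exact_mod_cast Nat.cast_div_le (α := ℝ) (n := 16)
    calc (U : ℝ) * ((V / 16 : ℕ) : ℝ) ≤ U * (V / 16) := by gcongr
      _ = _ := by ring
  have h7 : (U - 0) * (V - 0) ≤ P.card + (∑ d ∈ Finset.Icc 2 (U + 2), U / d * (V / d) +
      ((U / 16 - 0) * (V - 0) + (U - 0) * (V / 16 - 0))) := by
    refine hc.trans ?_
    gcongr
    exact hc2.trans (by gcongr)
  simp only [Nat.sub_zero] at h7
  have h8 : (U : ℝ) * V ≤ P.card + (((∑ d ∈ Finset.Icc 2 (U + 2), U / d * (V / d) : ℕ) : ℝ) +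
      (((U / 16 : ℕ) : ℝ) * V + U * ((V / 16 : ℕ) : ℝ))) := by exact_mod_cast h7
  linarith

lemma sum_range_inv_le (J : ℕ) :
    ∑ n ∈ Finset.range (2 ^ J + 1), (n : ℝ)⁻¹ ≤ 1 + J := by
  have h1 : ∑ n ∈ Finset.range (2 ^ J + 1), (n : ℝ)⁻¹ = ((harmonic (2 ^ J) : ℚ) : ℝ) := by
    rw [Finset.sum_range_succ', harmonic]
    push_cast
    simp
  rw [h1]
  refine (harmonic_le_one_add_log _).trans ?_
  push_cast
  rw [Real.log_pow]
  have : Real.log 2 ≤ 1 := by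
    have := Real.log_le_sub_one_of_pos (x := 2) (by norm_num)
    linarith
  have hJ : (0 : ℝ) ≤ J := by positivity
  nlinarith

/-- The number of points of a box on a line with coprime coefficients. -/
lemma card_line_le (U β β' : ℕ) (hβ : 0 < β) (hco : Nat.Coprime β β') (l : ℤ) :
    ((Finset.Ioc 0 U ×ˢ Finset.Ioc 0 U).filter
      (fun q => (q.1 : ℤ) * β' - q.2 * β = l)).card ≤ U / β + 1 := by
  classical
  rw [← Finset.card_range (U / β + 1)]
  refine Finset.card_le_card_of_injOn (fun q => q.1 / β) ?_ ?_
  · intro q hq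
    simp only [Finset.coe_filter, Finset.mem_product, Finset.mem_Ioc, Set.mem_ofPred_eq] at hq
    simp only [Finset.coe_range, Set.mem_Iio]
    exact Nat.lt_succ_of_le (Nat.div_le_div_right hq.1.1.2)
  · intro q hq r hr hqr
    simp only [Finset.coe_filter, Finset.mem_product, Finset.mem_Ioc, Set.mem_ofPred_eq] at hq hr
    have h1 : ((q.1 : ℤ) - r.1) * β' = (q.2 - r.2) * β := by linear_combination hq.2 - hr.2
    have hco' : IsCoprime (β : ℤ) (β' : ℤ) := Nat.isCoprime_iff_coprime.2 hco
    have h2 : (β : ℤ) ∣ q.1 - r.1 :=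
      hco'.dvd_of_dvd_mul_right (Dvd.intro_left _ h1.symm)
    have h3 : q.1 ≡ r.1 [MOD β] := ((Nat.modEq_iff_dvd).2 h2).symm
    have h4 : q.1 = r.1 := by
      rw [← Nat.div_add_mod q.1 β, ← Nat.div_add_mod r.1 β]
      simp only at hqr
      rw [hqr, h3]
    rw [h4, sub_self, zero_mul] at h1
    have h5 : (q.2 : ℤ) - r.2 = 0 := by
      rcases mul_eq_zero.1 h1.symm with h | h
      · exact h
      · omega
    exact Prod.ext h4 (by omega)

lemma sum_inv_abs_det_le (U b b' : ℕ) (μ : ℝ) (hb : 0 < b) (hμ : (U : ℝ) ≤ μ * b)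
    (hbU : b ≤ U) (hbU' : b' ≤ U) :
    ∑ u ∈ Finset.Ioc 0 U, ∑ u' ∈ Finset.Ioc 0 U, |(u : ℝ) * b' - u' * b|⁻¹ ≤
      2 * (μ + 1) * ∑ n ∈ Finset.range (U ^ 2 + 1), (n : ℝ)⁻¹ := by
  classical
  obtain ⟨g, β, β', hg, hco, rfl, rfl⟩ := Nat.exists_coprime' (Nat.gcd_pos_of_pos_left b' hb)
  have hβ : 0 < β := Nat.pos_of_mul_pos_right hb
  rw [← Finset.sum_product']
  have hmaps : ∀ q ∈ Finset.Ioc 0 U ×ˢ Finset.Ioc 0 U,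
      ((q.1 : ℤ) * β' - q.2 * β).natAbs ∈ Finset.range (U ^ 2 + 1) := by
    intro q hq
    simp only [Finset.mem_product, Finset.mem_Ioc] at hq
    rw [Finset.mem_range, Nat.lt_succ_iff]
    have e1 : q.1 * β' ≤ U ^ 2 := by
      rw [sq]; exact Nat.mul_le_mul hq.1.2 ((Nat.le_mul_of_pos_right _ hg).trans hbU')
    have e2 : q.2 * β ≤ U ^ 2 := by
      rw [sq]; exact Nat.mul_le_mul hq.2.2 ((Nat.le_mul_of_pos_right _ hg).trans hbU)
    zify at e1 e2 ⊢
    rw [abs_le]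
    constructor <;> nlinarith [Int.natCast_nonneg (q.1 * β'), Int.natCast_nonneg (q.2 * β)]
  rw [← Finset.sum_fiberwise_of_maps_to hmaps, Finset.mul_sum]
  refine Finset.sum_le_sum fun n _ => ?_
  have hg' : (0 : ℝ) < g := by exact_mod_cast hg
  have hβ' : (0 : ℝ) < β := by exact_mod_cast hβ
  have hval : ∀ q ∈ (Finset.Ioc 0 U ×ˢ Finset.Ioc 0 U).filter
      (fun q => ((q.1 : ℤ) * β' - q.2 * β).natAbs = n),
      |(q.1 : ℝ) * ((β' * g : ℕ) : ℝ) - q.2 * ((β * g : ℕ) : ℝ)|⁻¹ = (g : ℝ)⁻¹ * (n : ℝ)⁻¹ := by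
    intro q hq
    rw [Finset.mem_filter] at hq
    have h1 : |(q.1 : ℝ) * β' - q.2 * β| = n := by
      have : (((q.1 : ℤ) * β' - q.2 * β).natAbs : ℤ) = n := by rw [hq.2]
      rw [Int.natCast_natAbs] at this
      exact_mod_cast this
    have h2 : (q.1 : ℝ) * ((β' * g : ℕ) : ℝ) - q.2 * ((β * g : ℕ) : ℝ) =
        g * ((q.1 : ℝ) * β' - q.2 * β) := by push_cast; ring
    rw [h2, abs_mul, h1, abs_of_pos hg', mul_inv]
  rw [Finset.sum_congr rfl hval, Finset.sum_const, nsmul_eq_mul, ← mul_assoc]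
  refine mul_le_mul_of_nonneg_right ?_ (by positivity)
  have hcard : ((Finset.Ioc 0 U ×ˢ Finset.Ioc 0 U).filter
      (fun q => ((q.1 : ℤ) * β' - q.2 * β).natAbs = n)).card ≤ 2 * (U / β + 1) := by
    have hsub : (Finset.Ioc 0 U ×ˢ Finset.Ioc 0 U).filter
        (fun q => ((q.1 : ℤ) * β' - q.2 * β).natAbs = n) ⊆
        (Finset.Ioc 0 U ×ˢ Finset.Ioc 0 U).filter (fun q => (q.1 : ℤ) * β' - q.2 * β = n) ∪
        (Finset.Ioc 0 U ×ˢ Finset.Ioc 0 U).filter (fun q => (q.1 : ℤ) * β' - q.2 * β = -n) := by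
      intro q hq
      rw [Finset.mem_filter] at hq
      rw [Finset.mem_union, Finset.mem_filter, Finset.mem_filter]
      rcases Int.natAbs_eq ((q.1 : ℤ) * β' - q.2 * β) with h | h
      · left; exact ⟨hq.1, by rw [h, hq.2]⟩
      · right; exact ⟨hq.1, by rw [h, hq.2]⟩
    have := (Finset.card_le_card hsub).trans (Finset.card_union_le _ _)
    have h1 := card_line_le U β β' hβ hco n
    have h2 := card_line_le U β β' hβ hco (-n)
    omega
  have hcard' : (((Finset.Ioc 0 U ×ˢ Finset.Ioc 0 U).filter
      (fun q => ((q.1 : ℤ) * β' - q.2 * β).natAbs = n)).card : ℝ) ≤ 2 * ((U : ℝ) / β + 1) := by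
    have h1 : (((Finset.Ioc 0 U ×ˢ Finset.Ioc 0 U).filter
      (fun q => ((q.1 : ℤ) * β' - q.2 * β).natAbs = n)).card : ℝ) ≤
        2 * (((U / β : ℕ) : ℝ) + 1) := by exact_mod_cast hcard
    have h2 : ((U / β : ℕ) : ℝ) ≤ (U : ℝ) / β := Nat.cast_div_le
    linarith
  have h3 : (U : ℝ) / β ≤ μ * g := by
    rw [div_le_iff₀ hβ']
    push_cast at hμ
    linarith
  have h4 : (1 : ℝ) ≤ g := by exact_mod_cast hg
  rw [← div_eq_mul_inv, div_le_iff₀ hg']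
  nlinarith

/-- Summing pairwise overlaps over a box of triples. -/
lemma sum_overlap_le {U V W e : ℕ} (T : Finset (ℕ × ℕ × ℕ)) (E : ℕ × ℕ × ℕ → ℕ × ℕ × ℕ → ℝ)
    {K : ℝ} (hK : 0 ≤ K) (hU : 1 ≤ U) (hW : 1 ≤ W) (hVU : V ^ e = U) (he : e ≠ 0)
    (hT : ∀ t ∈ T, (1 ≤ t.1 ∧ t.1 ≤ U) ∧ (1 ≤ t.2.1 ∧ t.2.1 ≤ V ∧ V ≤ 16 * t.2.1) ∧
      (1 ≤ t.2.2 ∧ t.2.2 ≤ W) ∧ Nat.Coprime t.1 t.2.1)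
    (hharm : ∑ n ∈ Finset.range (U ^ 2 + 1), (n : ℝ)⁻¹ ≤ K * W)
    (hdiag : ∀ t ∈ T, E t t ≤ K / (U * V * W))
    (hpar : ∀ t ∈ T, ∀ t' ∈ T, t.1 = t'.1 → t.2.1 = t'.2.1 → t ≠ t' → E t t' = 0)
    (hoff : ∀ t ∈ T, ∀ t' ∈ T, (t.1 : ℝ) * (t'.2.1 : ℝ) ^ e - t'.1 * (t.2.1 : ℝ) ^ e ≠ 0 →
      E t t' ≤ K * U ^ 2 * |(t.1 : ℝ) * (t'.2.1 : ℝ) ^ e - t'.1 * (t.2.1 : ℝ) ^ e|⁻¹ /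
        (U * V * W) ^ 2)
    (hcount : ∀ t ∈ T, ∀ q : ℕ × ℕ, (t.1 : ℝ) * (q.2 : ℝ) ^ e - q.1 * (t.2.1 : ℝ) ^ e ≠ 0 →
      ((T.filter (fun t' => (t'.1, t'.2.1) = q ∧ E t t' ≠ 0)).card : ℝ) ≤
        K * (1 + W * |(t.1 : ℝ) * (q.2 : ℝ) ^ e - q.1 * (t.2.1 : ℝ) ^ e| / U ^ 2)) :
    ∑ t ∈ T, ∑ t' ∈ T, E t t' ≤ K + K ^ 2 + 2 * (16 ^ e + 1) * K ^ 3 := by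
  classical
  set N : ℝ := U * V * W with hN
  have hV : 1 ≤ V := by
    rcases Nat.eq_zero_or_pos V with h | h
    · rw [h, zero_pow he] at hVU; omega
    · exact h
  have hU' : (1 : ℝ) ≤ U := by exact_mod_cast hU
  have hV' : (1 : ℝ) ≤ V := by exact_mod_cast hV
  have hW' : (1 : ℝ) ≤ W := by exact_mod_cast hW
  have hNpos : 0 < N := by positivity
  set S : Finset ℕ := (Finset.Ioc 0 V).filter (fun v => V ≤ 16 * v) with hS
  have hScard : (S.card : ℝ) ≤ V := by
    have := Finset.card_filter_le (Finset.Ioc 0 V) (fun v => V ≤ 16 * v)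
    rw [Nat.card_Ioc] at this
    exact_mod_cast this
  set d : ℕ × ℕ → ℕ × ℕ → ℝ := fun r q => |(r.1 : ℝ) * (q.2 : ℝ) ^ e - q.1 * (r.2 : ℝ) ^ e|⁻¹
    with hd
  have step1 : ∀ t ∈ T, ∑ t' ∈ T, E t t' ≤ K / N +
      K ^ 2 / N ^ 2 * ∑ q ∈ Finset.Ioc 0 U ×ˢ S, (U ^ 2 * d (t.1, t.2.1) q + W) := by
    intro t ht
    have hmaps : ∀ t' ∈ T, (t'.1, t'.2.1) ∈ Finset.Ioc 0 U ×ˢ S := by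
      intro t' ht'
      have := hT t' ht'
      simp only [Finset.mem_product, Finset.mem_Ioc, hS, Finset.mem_filter]
      omega
    rw [← Finset.sum_fiberwise_of_maps_to hmaps]
    have hq : ∀ q ∈ Finset.Ioc 0 U ×ˢ S, ∑ t' ∈ T.filter (fun t' => (t'.1, t'.2.1) = q), E t t' ≤
        (if (t.1, t.2.1) = q then K / N else 0) +
        K ^ 2 / N ^ 2 * (U ^ 2 * d (t.1, t.2.1) q + W) := by
      intro q hq
      have hpos2 : 0 ≤ K ^ 2 / N ^ 2 * (U ^ 2 * d (t.1, t.2.1) q + W) := by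
        simp only [hd]; positivity
      by_cases hl : (t.1 : ℝ) * (q.2 : ℝ) ^ e - q.1 * (t.2.1 : ℝ) ^ e = 0
      · have hdiagsum : ∀ t' ∈ T.filter (fun t' => (t'.1, t'.2.1) = q), (t.1, t.2.1) = q := by
          intro t' ht'
          rw [Finset.mem_filter] at ht'
          obtain ⟨ht'T, rfl⟩ := ht'
          have c1 := (hT t ht).2.2.2
          have c2 := (hT t' ht'T).2.2.2
          have h0 : t.1 * t'.2.1 ^ e = t'.1 * t.2.1 ^ e := by
            have : (t.1 : ℝ) * (t'.2.1 : ℝ) ^ e = t'.1 * (t.2.1 : ℝ) ^ e := by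
              simpa [sub_eq_zero] using hl
            exact_mod_cast this
          have d1 : t.1 ∣ t'.1 :=
            (Nat.Coprime.pow_right e c1).dvd_of_dvd_mul_right (Dvd.intro _ h0)
          have d2 : t'.1 ∣ t.1 :=
            (Nat.Coprime.pow_right e c2).dvd_of_dvd_mul_right (Dvd.intro _ h0.symm)
          have e1 : t.1 = t'.1 := Nat.dvd_antisymm d1 d2
          have e2 : t.2.1 = t'.2.1 := by
            rw [e1] at h0
            have := Nat.eq_of_mul_eq_mul_left (by have := (hT t' ht'T).1.1; omega) h0
            exact (Nat.pow_left_injective he this).symm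
          rw [e1, e2]
        by_cases htq : (t.1, t.2.1) = q
        · rw [if_pos htq]
          have : ∑ t' ∈ T.filter (fun t' => (t'.1, t'.2.1) = q), E t t' = E t t := by
            refine Finset.sum_eq_single_of_mem t (Finset.mem_filter.2 ⟨ht, htq⟩) ?_
            intro t' ht' hne
            rw [Finset.mem_filter] at ht'
            have h := htq.trans ht'.2.symm
            rw [Prod.mk.injEq] at h
            exact hpar t ht t' ht'.1 h.1 h.2 (Ne.symm hne)
          rw [this]
          linarith [hdiag t ht]
        · rw [if_neg htq, Finset.sum_eq_zero fun t' ht' => absurd (hdiagsum t' ht') htq]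
          linarith
      · have hnn : (0 : ℝ) ≤ (if (t.1, t.2.1) = q then K / N else 0) := by
          split_ifs <;> positivity
        refine le_trans ?_ (le_add_of_nonneg_left hnn)
        have hdpos : 0 < |(t.1 : ℝ) * (q.2 : ℝ) ^ e - q.1 * (t.2.1 : ℝ) ^ e| := abs_pos.2 hl
        rw [← Finset.sum_filter_ne_zero]
        rw [Finset.filter_filter]
        have hb : ∀ t' ∈ T.filter (fun t' => (t'.1, t'.2.1) = q ∧ E t t' ≠ 0),
            E t t' ≤ K * U ^ 2 * d (t.1, t.2.1) q / N ^ 2 := by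
          intro t' ht'
          rw [Finset.mem_filter] at ht'
          obtain ⟨ht'T, rfl, _⟩ := ht'
          exact hoff t ht t' ht'T hl
        refine (Finset.sum_le_card_nsmul _ _ _ hb).trans ?_
        rw [nsmul_eq_mul]
        refine (mul_le_mul_of_nonneg_right (hcount t ht q hl) (by simp only [hd]; positivity)).trans
          (le_of_eq ?_)
        simp only [hd]
        field_simp
    refine (Finset.sum_le_sum hq).trans ?_
    rw [Finset.sum_add_distrib, ← Finset.mul_sum, Finset.sum_ite_eq]
    gcongr
    split_ifs
    · exact le_rfl
    · positivity
  have hTsub : T ⊆ ((Finset.Ioc 0 U ×ˢ S) ×ˢ Finset.Ioc 0 W).map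
      (Equiv.prodAssoc ℕ ℕ ℕ).toEmbedding := by
    intro t ht
    have := hT t ht
    rw [Finset.mem_map]
    refine ⟨((t.1, t.2.1), t.2.2), ?_, rfl⟩
    simp only [Finset.mem_product, Finset.mem_Ioc, hS, Finset.mem_filter]
    omega
  have hdsum : ∑ r ∈ Finset.Ioc 0 U ×ˢ S, ∑ q ∈ Finset.Ioc 0 U ×ˢ S, d r q ≤
      V ^ 2 * (2 * (16 ^ e + 1) * (K * W)) := by
    have e1 : ∑ r ∈ Finset.Ioc 0 U ×ˢ S, ∑ q ∈ Finset.Ioc 0 U ×ˢ S, d r q =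
        ∑ v ∈ S, ∑ v' ∈ S, ∑ u ∈ Finset.Ioc 0 U, ∑ u' ∈ Finset.Ioc 0 U, d (u, v) (u', v') := by
      rw [Finset.sum_product_right]
      refine Finset.sum_congr rfl fun v _ => ?_
      simp_rw [Finset.sum_product_right]
      rw [Finset.sum_comm]
    rw [e1]
    have e2 : ∀ v ∈ S, ∀ v' ∈ S, ∑ u ∈ Finset.Ioc 0 U, ∑ u' ∈ Finset.Ioc 0 U, d (u, v) (u', v') ≤
        2 * (16 ^ e + 1) * (K * W) := by
      intro v hv v' hv'
      simp only [hS, Finset.mem_filter, Finset.mem_Ioc] at hv hv'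
      have h := sum_inv_abs_det_le U (v ^ e) (v' ^ e) (16 ^ e) (pow_pos hv.1.1 e)
        (by rw [← hVU]; push_cast; rw [← mul_pow]; gcongr; exact_mod_cast hv.2)
        (by rw [← hVU]; exact Nat.pow_le_pow_left hv.1.2 e)
        (by rw [← hVU]; exact Nat.pow_le_pow_left hv'.1.2 e)
      simp only [hd]
      push_cast at h
      exact h.trans (by gcongr)
    have e3 : (0 : ℝ) ≤ 2 * (16 ^ e + 1) * (K * W) := by positivity
    calc _ ≤ ∑ v ∈ S, ∑ v' ∈ S, (2 * (16 ^ e + 1) * (K * W) : ℝ) :=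
          Finset.sum_le_sum fun v hv => Finset.sum_le_sum fun v' hv' => e2 v hv v' hv'
      _ = (S.card : ℝ) ^ 2 * (2 * (16 ^ e + 1) * (K * W)) := by
          simp only [Finset.sum_const, nsmul_eq_mul]; ring
      _ ≤ _ := by gcongr
  set F : ℕ × ℕ → ℝ := fun r => K / N +
      K ^ 2 / N ^ 2 * ∑ q ∈ Finset.Ioc 0 U ×ˢ S, (U ^ 2 * d r q + W) with hF
  have hFnn : ∀ r, 0 ≤ F r := by
    intro r
    simp only [hF, hd]
    positivity
  have hcardP : ((Finset.Ioc 0 U ×ˢ S).card : ℝ) ≤ U * V := by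
    rw [Finset.card_product, Nat.card_Ioc, Nat.sub_zero]
    push_cast
    gcongr
  calc ∑ t ∈ T, ∑ t' ∈ T, E t t' ≤ ∑ t ∈ T, F (t.1, t.2.1) := Finset.sum_le_sum step1
    _ ≤ ∑ t ∈ ((Finset.Ioc 0 U ×ˢ S) ×ˢ Finset.Ioc 0 W).map
        (Equiv.prodAssoc ℕ ℕ ℕ).toEmbedding, F (t.1, t.2.1) :=
        Finset.sum_le_sum_of_subset_of_nonneg hTsub fun _ _ _ => hFnn _
    _ = W * ∑ r ∈ Finset.Ioc 0 U ×ˢ S, F r := by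
        rw [Finset.sum_map, Finset.sum_product, Finset.mul_sum]
        refine Finset.sum_congr rfl fun r _ => ?_
        simp
    _ = W * ((Finset.Ioc 0 U ×ˢ S).card * (K / N) + K ^ 2 / N ^ 2 *
        (U ^ 2 * (∑ r ∈ Finset.Ioc 0 U ×ˢ S, ∑ q ∈ Finset.Ioc 0 U ×ˢ S, d r q) +
          (Finset.Ioc 0 U ×ˢ S).card ^ 2 * W)) := by
        simp only [hF, Finset.sum_add_distrib, ← Finset.mul_sum, Finset.sum_const, nsmul_eq_mul]
        ring
    _ ≤ W * ((U * V) * (K / N) + K ^ 2 / N ^ 2 *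
        (U ^ 2 * (V ^ 2 * (2 * (16 ^ e + 1) * (K * W))) + (U * V) ^ 2 * W)) := by gcongr
    _ = _ := by
        rw [hN]
        field_simp
        ring

/-- The strip of half-width `s` (vertically) around the line `A x + B y = C`. -/
def strip (ℓ : ℝ × ℝ × ℝ) (s : ℝ) : Set (ℝ × ℝ) := {z | |ℓ.1 * z.1 + ℓ.2.1 * z.2 - ℓ.2.2| < s}

/-- A square in the open positive quadrant. -/
def square (L : ℝ) : Set (ℝ × ℝ) := Set.Icc (1 / (4 * L)) (2 * L) ×ˢ Set.Icc (1 / (4 * L)) (2 * L)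

/-- Lines whose coefficients lie in `[1 / L, 1]`. -/
def Bdd (L : ℝ) (ℓ : ℝ × ℝ × ℝ) : Prop :=
  (1 / L ≤ ℓ.1 ∧ ℓ.1 ≤ 1) ∧ (1 / L ≤ ℓ.2.1 ∧ ℓ.2.1 ≤ 1) ∧ (1 / L ≤ ℓ.2.2 ∧ ℓ.2.2 ≤ 1)

lemma measurableSet_strip' (ℓ : ℝ × ℝ × ℝ) (s : ℝ) : MeasurableSet (strip ℓ s) :=
  measurableSet_strip _ _ _ _

lemma volume_square_ne_top (L : ℝ) : volume (square L) ≠ ⊤ :=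
  (isCompact_Icc.prod isCompact_Icc).measure_ne_top

lemma volume_strip_inter_square_ne_top (L : ℝ) (S : Set (ℝ × ℝ)) :
    volume (S ∩ square L) ≠ ⊤ :=
  measure_ne_top_of_subset Set.inter_subset_right (volume_square_ne_top L)

section overlap

variable {L s : ℝ} {ℓ ℓ' : ℝ × ℝ × ℝ}

lemma volume_strip_inter_square_le (hL : 1 ≤ L) (hs : 0 ≤ s) (h : Bdd L ℓ) :
    volume.real (strip ℓ s ∩ square L) ≤ 8 * L ^ 2 * s := by
  obtain ⟨⟨h1, h1'⟩, -, -⟩ := h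
  have hA : 0 < ℓ.1 := lt_of_lt_of_le (by positivity) h1
  have hv := volume_real_strip_inter_strip (A := ℓ.1) (B := ℓ.2.1) (A' := 0) (B' := 1)
    (by simpa using hA.ne') ℓ.2.2 L hs (δ' := 2 * L) (by linarith)
  have hsub : strip ℓ s ∩ square L ⊆ {z : ℝ × ℝ | |ℓ.1 * z.1 + ℓ.2.1 * z.2 - ℓ.2.2| < s ∧
      |0 * z.1 + 1 * z.2 - L| < 2 * L} := by
    rintro z ⟨hz, -, hz2⟩
    refine ⟨hz, ?_⟩
    rw [Set.mem_Icc] at hz2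
    have : 0 < 1 / (4 * L) := by positivity
    rw [abs_lt]
    constructor <;> linarith
  have hfin : volume {z : ℝ × ℝ | |ℓ.1 * z.1 + ℓ.2.1 * z.2 - ℓ.2.2| < s ∧
      |0 * z.1 + 1 * z.2 - L| < 2 * L} ≠ ⊤ := by
    rcases hs.eq_or_lt with rfl | hs'
    · have : {z : ℝ × ℝ | |ℓ.1 * z.1 + ℓ.2.1 * z.2 - ℓ.2.2| < 0 ∧
        |0 * z.1 + 1 * z.2 - L| < 2 * L} = ∅ := by
        ext z
        simp only [Set.mem_ofPred_eq, Set.mem_empty_iff_false, iff_false, not_and]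
        intro h; exact absurd h (abs_nonneg _).not_gt
      rw [this]; simp
    · intro htop
      rw [measureReal_def, htop, ENNReal.toReal_top] at hv
      have : 0 < 4 * s * (2 * L) / |ℓ.1 * 1 - 0 * ℓ.2.1| := by
        have : ℓ.1 * 1 - 0 * ℓ.2.1 = ℓ.1 := by ring
        rw [this, abs_of_pos hA]
        positivity
      linarith
  refine (measureReal_mono hsub hfin).trans ?_
  rw [hv]
  have : ℓ.1 * 1 - 0 * ℓ.2.1 = ℓ.1 := by ring
  rw [this, abs_of_pos hA, div_le_iff₀ hA]
  have : 1 ≤ L * ℓ.1 := by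
    rw [div_le_iff₀ (by linarith)] at h1; linarith
  nlinarith [mul_nonneg (mul_nonneg hs (by linarith : 0 ≤ L)) (by linarith : 0 ≤ L * ℓ.1 - 1)]

lemma le_volume_strip_inter_square (hL : 1 ≤ L) (hs : 0 ≤ s) (hs' : s ≤ 1 / (8 * L ^ 2))
    (h : Bdd L ℓ) : s / (2 * L) ≤ volume.real (strip ℓ s ∩ square L) := by
  obtain ⟨A, B, C⟩ := ℓ
  obtain ⟨⟨h1, h1'⟩, ⟨h2, h2'⟩, h3, h3'⟩ := h
  simp only at h1 h1' h2 h2' h3 h3'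
  have hL0 : 0 < L := by linarith
  have hL1 : 0 < 1 / L := by positivity
  have hA : 0 < A := hL1.trans_le h1
  have hB : 0 < B := hL1.trans_le h2
  have hC : 0 < C := hL1.trans_le h3
  set τ := C / (A + B) with hτ
  have hτpos : 0 < τ := by positivity
  have hτC : (A + B) * τ = C := by rw [hτ]; field_simp
  have hτ1 : 1 / (2 * L) ≤ τ := by
    rw [hτ, le_div_iff₀ (by positivity)]
    calc 1 / (2 * L) * (A + B) ≤ 1 / (2 * L) * 2 := by gcongr; linarith
      _ = 1 / L := by field_simp
      _ ≤ C := h3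
  have hLA : 1 ≤ L * A := by rw [div_le_iff₀ hL0] at h1; linarith
  have hLB : 1 ≤ L * B := by rw [div_le_iff₀ hL0] at h2; linarith
  have hτ2 : τ ≤ L := by
    rw [hτ, div_le_iff₀ (by positivity)]
    nlinarith
  have hv := volume_real_strip_inter_strip (A := A) (B := B) (A' := 0) (B' := 1)
    (by simpa using hA.ne') C (3 * τ / 4) hs (δ' := τ / 4) (by linarith)
  have hsub : {z : ℝ × ℝ | |A * z.1 + B * z.2 - C| < s ∧
      |0 * z.1 + 1 * z.2 - 3 * τ / 4| < τ / 4} ⊆ strip (A, B, C) s ∩ square L := by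
    rintro z ⟨hz1, hz2⟩
    refine ⟨hz1, ?_⟩
    rw [abs_lt] at hz1 hz2
    have hy1 : τ / 2 < z.2 := by linarith
    have hy2 : z.2 < τ := by linarith
    have e1 : 1 / (4 * L) = 1 / (2 * L) / 2 := by field_simp; norm_num
    have hsL : L * s ≤ 1 / (4 * L) := by
      calc L * s ≤ L * (1 / (8 * L ^ 2)) := by gcongr
        _ = 1 / (4 * L) / 2 := by field_simp; norm_num
        _ ≤ _ := by have : 0 < 1 / (4 * L) := by positivity
                    linarith
    have hx1 : A * τ - s < A * z.1 := by nlinarith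
    have hx2 : A * z.1 < C + s := by nlinarith
    have hs1 : s ≤ 1 := by
      refine hs'.trans ?_
      rw [div_le_one (by positivity)]
      nlinarith
    refine ⟨⟨?_, ?_⟩, ?_, ?_⟩
    · by_contra hcon
      push Not at hcon
      have : τ - z.1 < L * s := by
        have h5 : A * (τ - z.1) < s := by linarith
        have h6 : 0 ≤ τ - z.1 := by linarith [show 0 < 1 / (4 * L) by positivity]
        nlinarith
      linarith
    · by_contra hcon
      push Not at hcon
      nlinarith
    · linarith
    · linarith
  refine le_trans ?_ (measureReal_mono hsub (volume_strip_inter_square_ne_top L _))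
  rw [hv]
  have : A * 1 - 0 * B = A := by ring
  rw [this, abs_of_pos hA, le_div_iff₀ hA]
  calc s / (2 * L) * A ≤ s / (2 * L) * 1 := by gcongr
    _ = s * (1 / (2 * L)) := by ring
    _ ≤ s * τ := by gcongr
    _ = _ := by ring

lemma volume_overlap_le (hs : 0 < s) (hΔ : ℓ.1 * ℓ'.2.1 - ℓ'.1 * ℓ.2.1 ≠ 0) :
    volume.real (strip ℓ s ∩ strip ℓ' s ∩ square L) ≤
      4 * s ^ 2 / |ℓ.1 * ℓ'.2.1 - ℓ'.1 * ℓ.2.1| := by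
  have hv := volume_real_strip_inter_strip hΔ ℓ.2.2 ℓ'.2.2 hs.le hs.le
  have hfin : volume {z : ℝ × ℝ | |ℓ.1 * z.1 + ℓ.2.1 * z.2 - ℓ.2.2| < s ∧
      |ℓ'.1 * z.1 + ℓ'.2.1 * z.2 - ℓ'.2.2| < s} ≠ ⊤ := by
    intro htop
    rw [measureReal_def, htop, ENNReal.toReal_top] at hv
    have : 0 < 4 * s * s / |ℓ.1 * ℓ'.2.1 - ℓ'.1 * ℓ.2.1| := by
      have := abs_pos.2 hΔ
      positivity
    linarith
  have hsub : strip ℓ s ∩ strip ℓ' s ∩ square L ⊆ {z : ℝ × ℝ |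
      |ℓ.1 * z.1 + ℓ.2.1 * z.2 - ℓ.2.2| < s ∧ |ℓ'.1 * z.1 + ℓ'.2.1 * z.2 - ℓ'.2.2| < s} :=
    fun z hz => hz.1
  refine (measureReal_mono hsub hfin).trans ?_
  rw [hv]
  exact le_of_eq (by ring)

lemma abs_minor_le {z : ℝ × ℝ} (h : Bdd L ℓ) (h' : Bdd L ℓ') (hL : 1 ≤ L)
    (hz : z ∈ strip ℓ s ∩ strip ℓ' s ∩ square L) :
    |ℓ.2.2 * ℓ'.2.1 - ℓ'.2.2 * ℓ.2.1| ≤ 2 * L * |ℓ.1 * ℓ'.2.1 - ℓ'.1 * ℓ.2.1| + 2 * s ∧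
    |ℓ.1 * ℓ'.2.1 - ℓ'.1 * ℓ.2.1| ≤ 4 * L * (|ℓ.2.2 * ℓ'.2.1 - ℓ'.2.2 * ℓ.2.1| + 2 * s) := by
  obtain ⟨A, B, C⟩ := ℓ
  obtain ⟨A', B', C'⟩ := ℓ'
  obtain ⟨-, ⟨h2, h2'⟩, -⟩ := h
  obtain ⟨-, ⟨h3, h3'⟩, -⟩ := h'
  obtain ⟨⟨hz1, hz2⟩, ⟨hx1, hx2⟩, -⟩ := hz
  simp only [strip, Set.mem_ofPred_eq] at *
  have hL1 : 0 < 1 / L := by positivity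
  set e := A * z.1 + B * z.2 - C with he
  set e' := A' * z.1 + B' * z.2 - C' with he'
  have hid : (A * B' - A' * B) * z.1 = (C * B' - C' * B) + (e * B' - e' * B) := by
    rw [he, he']; ring
  have herr : |e * B' - e' * B| ≤ 2 * s := by
    calc |e * B' - e' * B| ≤ |e * B'| + |e' * B| := abs_sub _ _
      _ = |e| * B' + |e'| * B := by
          rw [abs_mul, abs_mul, abs_of_pos (hL1.trans_le h3), abs_of_pos (hL1.trans_le h2)]
      _ ≤ s * 1 + s * 1 := by gcongr <;> first | linarith | exact (abs_nonneg _).trans hz1.le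
      _ = _ := by ring
  have hx0 : 0 < z.1 := lt_of_lt_of_le (by positivity) hx1
  have habs : |A * B' - A' * B| * z.1 = |(C * B' - C' * B) + (e * B' - e' * B)| := by
    rw [← hid, abs_mul, abs_of_pos hx0]
  constructor
  · have h5 : |C * B' - C' * B| ≤ |A * B' - A' * B| * z.1 + 2 * s := by
      rw [habs]
      have := abs_sub ((C * B' - C' * B) + (e * B' - e' * B)) (e * B' - e' * B)
      rw [add_sub_cancel_right] at this
      linarith
    nlinarith [abs_nonneg (A * B' - A' * B)]
  · have h5 : |A * B' - A' * B| * z.1 ≤ |C * B' - C' * B| + 2 * s := by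
      rw [habs]
      exact (abs_add_le _ _).trans (by linarith)
    have h6 : |A * B' - A' * B| * (1 / (4 * L)) ≤ |C * B' - C' * B| + 2 * s :=
      le_trans (by gcongr) h5
    calc |A * B' - A' * B| = 4 * L * (|A * B' - A' * B| * (1 / (4 * L))) := by field_simp
      _ ≤ _ := by gcongr

lemma volume_overlap_le_of_minor (hL : 1 ≤ L) (hs : 0 < s) (h : Bdd L ℓ) (h' : Bdd L ℓ')
    (hD : ℓ.2.2 * ℓ'.2.1 - ℓ'.2.2 * ℓ.2.1 ≠ 0) :
    volume.real (strip ℓ s ∩ strip ℓ' s ∩ square L) ≤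
      32 * L ^ 2 * s ^ 2 / |ℓ.2.2 * ℓ'.2.1 - ℓ'.2.2 * ℓ.2.1| := by
  have hDpos := abs_pos.2 hD
  set D := |ℓ.2.2 * ℓ'.2.1 - ℓ'.2.2 * ℓ.2.1| with hDdef
  rcases (strip ℓ s ∩ strip ℓ' s ∩ square L).eq_empty_or_nonempty with hemp | ⟨z, hz⟩
  · rw [hemp]; simp only [measureReal_empty]; positivity
  have hm := (abs_minor_le h h' hL hz).1
  rw [← hDdef] at hm
  by_cases hc : D ≤ 4 * L * |ℓ.1 * ℓ'.2.1 - ℓ'.1 * ℓ.2.1|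
  · have hΔ : 0 < |ℓ.1 * ℓ'.2.1 - ℓ'.1 * ℓ.2.1| := by
      by_contra hcon
      have : |ℓ.1 * ℓ'.2.1 - ℓ'.1 * ℓ.2.1| = 0 := le_antisymm (not_lt.1 hcon) (abs_nonneg _)
      rw [this] at hc; linarith
    refine (volume_overlap_le hs (abs_pos.1 hΔ)).trans ?_
    rw [div_le_div_iff₀ hΔ hDpos]
    have hs2 : 0 < s ^ 2 := by positivity
    calc 4 * s ^ 2 * D ≤ 4 * s ^ 2 * (4 * L * |ℓ.1 * ℓ'.2.1 - ℓ'.1 * ℓ.2.1|) := by gcongr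
      _ = (16 * L) * (s ^ 2 * |ℓ.1 * ℓ'.2.1 - ℓ'.1 * ℓ.2.1|) := by ring
      _ ≤ (32 * L ^ 2) * (s ^ 2 * |ℓ.1 * ℓ'.2.1 - ℓ'.1 * ℓ.2.1|) := by
          gcongr <;> nlinarith
      _ = _ := by ring
  · have hD4 : D ≤ 4 * s := by linarith
    have : strip ℓ s ∩ strip ℓ' s ∩ square L ⊆ strip ℓ s ∩ square L :=
      fun z hz => ⟨hz.1.1, hz.2⟩
    refine (measureReal_mono this (volume_strip_inter_square_ne_top L _)).trans
      ((volume_strip_inter_square_le hL hs.le h).trans ?_)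
    rw [le_div_iff₀ hDpos]
    calc 8 * L ^ 2 * s * D ≤ 8 * L ^ 2 * s * (4 * s) := by gcongr
      _ = _ := by ring

end overlap

lemma mul_abs_sub_le_abs_pow_sub_pow {x y μ : ℝ} (hμ : 0 ≤ μ) (hx : μ ≤ x) (hy : μ ≤ y) (f : ℕ) :
    μ ^ f * |x - y| ≤ |x ^ (f + 1) - y ^ (f + 1)| := by
  wlog h : y ≤ x generalizing x y
  · rw [abs_sub_comm x, abs_sub_comm (x ^ _)]
    exact this hy hx (le_of_not_ge h)
  have h1 : y ^ f ≤ x ^ f := pow_le_pow_left₀ (hμ.trans hy) h f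
  have h2 : μ ^ f ≤ y ^ f := pow_le_pow_left₀ hμ hy f
  have h3 : x ^ (f + 1) - y ^ (f + 1) = x * (x ^ f - y ^ f) + (x - y) * y ^ f := by ring
  refine le_trans ?_ (le_abs_self _)
  rw [abs_of_nonneg (by linarith), h3]
  nlinarith [mul_nonneg (hμ.trans hx) (sub_nonneg.2 h1), mul_nonneg (sub_nonneg.2 h)
    (sub_nonneg.2 h2)]

lemma card_pow_near_le (F : Finset ℕ) {W f : ℕ} (hW : 1 ≤ W) (hf : 1 ≤ f) {ξ η : ℝ} (hη : 0 ≤ η)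
    (hF : ∀ w ∈ F, W ≤ 16 * w ∧ |((w : ℝ) / W) ^ f - ξ| ≤ η) :
    (F.card : ℝ) ≤ 2 * 16 ^ f * W * η + 1 := by
  have hW' : (0 : ℝ) < W := by exact_mod_cast hW
  obtain ⟨f, rfl⟩ : ∃ g, f = g + 1 := ⟨f - 1, by omega⟩
  refine card_le_of_pairwise_abs_sub_le_nat F (by positivity) ?_
  intro i hi j hj
  obtain ⟨hi1, hi2⟩ := hF i hi
  obtain ⟨hj1, hj2⟩ := hF j hj
  have hlow : ∀ w : ℕ, W ≤ 16 * w → (1 / 16 : ℝ) ≤ (w : ℝ) / W := by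
    intro w hw
    rw [div_le_div_iff₀ (by norm_num) hW']
    have : (W : ℝ) ≤ 16 * w := by exact_mod_cast hw
    linarith
  have h1 := mul_abs_sub_le_abs_pow_sub_pow (by norm_num) (hlow i hi1) (hlow j hj1) f
  have h2 : |((i : ℝ) / W) ^ (f + 1) - ((j : ℝ) / W) ^ (f + 1)| ≤ 2 * η := by
    have := abs_sub_le (((i : ℝ) / W) ^ (f + 1)) ξ (((j : ℝ) / W) ^ (f + 1))
    rw [abs_sub_comm ξ] at this
    linarith
  have h3 : |(i : ℝ) / W - j / W| = |(i : ℝ) - j| / W := by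
    rw [← sub_div, abs_div, abs_of_pos hW']
  rw [h3, one_div, inv_pow] at h1
  have h4 : (16 ^ f : ℝ)⁻¹ * (|(i : ℝ) - j| / W) ≤ 2 * η := h1.trans h2
  have h5 : |(i : ℝ) - j| = 16 ^ f * W * ((16 ^ f : ℝ)⁻¹ * (|(i : ℝ) - j| / W)) := by field_simp
  rw [h5]
  calc (16 ^ f : ℝ) * W * ((16 ^ f : ℝ)⁻¹ * (|(i : ℝ) - j| / W)) ≤ 16 ^ f * W * (2 * η) := by
        gcongr
    _ ≤ 16 ^ (f + 1) * W * (2 * η) := by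
        gcongr
        · norm_num
        · omega
    _ = _ := by ring

lemma exists_mem_of_measureReal_ne_zero {α : Type*} [MeasurableSpace α] {μ : Measure α}
    {S : Set α} (h : μ.real S ≠ 0) : ∃ z, z ∈ S := by
  by_contra hcon
  exact h (by rw [Set.eq_empty_of_forall_notMem fun z hz => hcon ⟨z, hz⟩, measureReal_empty])

lemma inv_pow_le_abs_div_pow_sub {w w' W f : ℕ} (hW : 1 ≤ W) (hf : f ≠ 0) (h : w ≠ w') :
    1 / (W : ℝ) ^ f ≤ |((w : ℝ) / W) ^ f - ((w' : ℝ) / W) ^ f| := by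
  have hW' : (0 : ℝ) < (W : ℝ) ^ f := by positivity
  rw [div_pow, div_pow, ← sub_div, abs_div, abs_of_pos hW']
  gcongr
  have h1 : (w : ℤ) ^ f - (w' : ℤ) ^ f ≠ 0 := by
    rw [sub_ne_zero]
    intro h2
    have h3 : w ^ f = w' ^ f := by exact_mod_cast h2
    exact h (Nat.pow_left_injective hf h3)
  exact_mod_cast Int.one_le_abs h1

lemma div_mul_div_pow_sub {U V e : ℕ} (hVU : V ^ e = U) (u v u' v' : ℝ) :
    u / U * (v' / V) ^ e - u' / U * (v / V) ^ e = (u * v' ^ e - u' * v ^ e) / (U : ℝ) ^ 2 := by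
  have : (V : ℝ) ^ e = U := by exact_mod_cast hVU
  rw [div_pow, div_pow, this]
  ring

lemma inv_pow_le_div_pow {w W : ℕ} (hW : 1 ≤ W) (h : W ≤ 16 * w) (f : ℕ) :
    ((16 : ℝ) ^ f)⁻¹ ≤ ((w : ℝ) / W) ^ f := by
  rw [← inv_pow]
  have hW' : (0 : ℝ) < W := by exact_mod_cast hW
  have : (W : ℝ) ≤ 16 * w := by exact_mod_cast h
  gcongr
  rw [le_div_iff₀ hW']
  linarith

lemma div_pow_le_one {w W : ℕ} (h : w ≤ W) (f : ℕ) : ((w : ℝ) / W) ^ f ≤ 1 :=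
  pow_le_one₀ (by positivity) (div_le_one_of_le₀ (by exact_mod_cast h) (by positivity))

lemma abs_sub_div_mul_le {a b c d L t : ℝ} (hb : 1 / L ≤ b) (hL : 0 < L)
    (h : |a * d - c * b| ≤ t) : |c - a * d / b| ≤ L * t := by
  have hb' : 0 < b := lt_of_lt_of_le (by positivity) hb
  have : c - a * d / b = -((a * d - c * b) / b) := by field_simp; ring
  rw [this, abs_neg, abs_div, abs_of_pos hb', div_le_iff₀ hb']
  have h1 : 1 ≤ L * b := by rw [div_le_iff₀ hL] at hb; linarith
  have h2 : 0 ≤ t := (abs_nonneg _).trans h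
  nlinarith

lemma volume_strip_inter_self_le {L s N : ℝ} {ℓ : ℝ × ℝ × ℝ} (hL : 1 ≤ L) (hN : 0 < N)
    (hs : s = 1 / (32 * L ^ 2 * N)) (h : Bdd L ℓ) :
    volume.real (strip ℓ s ∩ strip ℓ s ∩ square L) ≤ 1 / N := by
  rw [Set.inter_self]
  have hs0 : 0 ≤ s := by rw [hs]; positivity
  refine (volume_strip_inter_square_le hL hs0 h).trans ?_
  rw [hs]
  have : 8 * L ^ 2 * (1 / (32 * L ^ 2 * N)) = 1 / N / 4 := by
    have : 0 < L := by linarith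
    field_simp; norm_num
  rw [this]
  have : 0 < 1 / N := by positivity
  linarith

section overlapSum

variable {U V W e n m p : ℕ} {K L s : ℝ} (T : Finset (ℕ × ℕ × ℕ))

lemma sum_volume_overlap_le_of_dvd (hU : 1 ≤ U) (hW : 1 ≤ W) (hVU : V ^ e = U) (he : e ≠ 0)
    (hn : n ≠ 0) (hp : p ≠ 0) (hL : 1 ≤ L) (hs : s = 1 / (32 * L ^ 2 * ((U : ℝ) * V * W)))
    (hT : ∀ t ∈ T, (1 ≤ t.1 ∧ t.1 ≤ U ∧ U ≤ 16 * t.1) ∧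
      (1 ≤ t.2.1 ∧ t.2.1 ≤ V ∧ V ≤ 16 * t.2.1) ∧
      (1 ≤ t.2.2 ∧ t.2.2 ≤ W ∧ W ≤ 16 * t.2.2) ∧ Nat.Coprime t.1 t.2.1)
    (hbdd : ∀ t ∈ T, Bdd L (((t.1 : ℝ) / U) ^ n, ((t.2.1 : ℝ) / V) ^ (e * n),
      ((t.2.2 : ℝ) / W) ^ p))
    (hN : W ^ p ≤ U * V * W)
    (hharm : ∑ n ∈ Finset.range (U ^ 2 + 1), (n : ℝ)⁻¹ ≤ K * W)
    (hK1 : 1 ≤ K) (hK2 : 16 ^ ((e + 1) * n) ≤ K) (hK3 : 4 * 16 ^ p * L ^ 2 * n + 16 ^ p + 1 ≤ K) :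
    ∑ t ∈ T, ∑ t' ∈ T,
      volume.real (strip (((t.1 : ℝ) / U) ^ n, ((t.2.1 : ℝ) / V) ^ (e * n),
          ((t.2.2 : ℝ) / W) ^ p) s ∩
        strip (((t'.1 : ℝ) / U) ^ n, ((t'.2.1 : ℝ) / V) ^ (e * n),
          ((t'.2.2 : ℝ) / W) ^ p) s ∩ square L) ≤
      K + K ^ 2 + 2 * (16 ^ e + 1) * K ^ 3 := by
  have hV : 1 ≤ V := by
    rcases Nat.eq_zero_or_pos V with h | h
    · rw [h, zero_pow he] at hVU; omega
    · exact h
  have hU' : (1 : ℝ) ≤ U := by exact_mod_cast hU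
  have hV' : (1 : ℝ) ≤ V := by exact_mod_cast hV
  have hW' : (1 : ℝ) ≤ W := by exact_mod_cast hW
  have hL0 : 0 < L := by linarith
  set N : ℝ := (U : ℝ) * V * W with hNdef
  have hNpos : 0 < N := by positivity
  have hspos : 0 < s := by rw [hs]; positivity
  have hP : ∀ t ∈ T, ∀ t' ∈ T, ((16 : ℝ) ^ (e + 1))⁻¹ ≤ (t.1 : ℝ) / U * ((t'.2.1 : ℝ) / V) ^ e ∧
      (t.1 : ℝ) / U * ((t'.2.1 : ℝ) / V) ^ e ≤ 1 := by
    intro t ht t' ht'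
    obtain ⟨⟨-, h1, h2⟩, -⟩ := hT t ht
    obtain ⟨-, ⟨-, h3, h4⟩, -⟩ := hT t' ht'
    have a1 := inv_pow_le_div_pow hU h2 1
    have a2 := inv_pow_le_div_pow hV h4 e
    have b1 := div_pow_le_one h1 1
    have b2 := div_pow_le_one h3 e
    rw [pow_one] at a1 b1
    rw [pow_one] at a1
    constructor
    · rw [pow_succ, mul_inv, mul_comm]
      gcongr
    · exact mul_le_one₀ b1 (by positivity) b2
  have hΔ : ∀ t t' : ℕ × ℕ × ℕ, ((t.1 : ℝ) / U) ^ n * ((t'.2.1 : ℝ) / V) ^ (e * n) -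
      ((t'.1 : ℝ) / U) ^ n * ((t.2.1 : ℝ) / V) ^ (e * n) =
      ((t.1 : ℝ) / U * ((t'.2.1 : ℝ) / V) ^ e) ^ n -
        ((t'.1 : ℝ) / U * ((t.2.1 : ℝ) / V) ^ e) ^ n := by
    intro t t'
    rw [mul_pow, mul_pow, ← pow_mul, ← pow_mul]
  have hΔlow : ∀ t ∈ T, ∀ t' ∈ T,
      (16 ^ ((e + 1) * n) : ℝ)⁻¹ *
        (|(t.1 : ℝ) * (t'.2.1 : ℝ) ^ e - t'.1 * (t.2.1 : ℝ) ^ e| / (U : ℝ) ^ 2) ≤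
      |((t.1 : ℝ) / U) ^ n * ((t'.2.1 : ℝ) / V) ^ (e * n) -
      ((t'.1 : ℝ) / U) ^ n * ((t.2.1 : ℝ) / V) ^ (e * n)| := by
    intro t ht t' ht'
    rw [hΔ]
    obtain ⟨f, rfl⟩ : ∃ f, n = f + 1 := ⟨n - 1, by omega⟩
    have h1 := mul_abs_sub_le_abs_pow_sub_pow (by positivity) (hP t ht t' ht').1
      (hP t' ht' t ht).1 f
    rw [div_mul_div_pow_sub hVU, abs_div, abs_of_pos (by positivity : (0 : ℝ) < (U : ℝ) ^ 2)] at h1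
    refine le_trans ?_ h1
    rw [inv_pow, ← pow_mul]
    gcongr
    · norm_num
    · omega
  have hΔup : ∀ t ∈ T, ∀ t' ∈ T,
      |((t.1 : ℝ) / U) ^ n * ((t'.2.1 : ℝ) / V) ^ (e * n) -
      ((t'.1 : ℝ) / U) ^ n * ((t.2.1 : ℝ) / V) ^ (e * n)| ≤
      n * (|(t.1 : ℝ) * (t'.2.1 : ℝ) ^ e - t'.1 * (t.2.1 : ℝ) ^ e| / (U : ℝ) ^ 2) := by
    intro t ht t' ht'
    rw [hΔ]
    refine (abs_pow_sub_pow_le _ _ _).trans ?_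
    rw [div_mul_div_pow_sub hVU, abs_div, abs_of_pos (by positivity : (0 : ℝ) < (U : ℝ) ^ 2)]
    have h1 := hP t ht t' ht'
    have h2 := hP t' ht' t ht
    have h0 : (0 : ℝ) ≤ ((16 : ℝ) ^ (e + 1))⁻¹ := by positivity
    have h3 : max |(t.1 : ℝ) / U * ((t'.2.1 : ℝ) / V) ^ e|
        |(t'.1 : ℝ) / U * ((t.2.1 : ℝ) / V) ^ e| ^ (n - 1) ≤ 1 := by
      refine pow_le_one₀ (by positivity) (max_le ?_ ?_)
      · rw [abs_of_nonneg (h0.trans h1.1)]; exact h1.2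
      · rw [abs_of_nonneg (h0.trans h2.1)]; exact h2.2
    calc _ ≤ |(t.1 : ℝ) * (t'.2.1 : ℝ) ^ e - t'.1 * (t.2.1 : ℝ) ^ e| / (U : ℝ) ^ 2 * n * 1 := by
          gcongr
      _ = _ := by ring
  refine sum_overlap_le T _ (by linarith) hU hW hVU he
    (fun t ht => ⟨⟨(hT t ht).1.1, (hT t ht).1.2.1⟩, (hT t ht).2.1,
      ⟨(hT t ht).2.2.1.1, (hT t ht).2.2.1.2.1⟩, (hT t ht).2.2.2⟩) hharm ?_ ?_ ?_ ?_
  · intro t ht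
    refine (volume_strip_inter_self_le hL hNpos hs (hbdd t ht)).trans ?_
    gcongr
  · intro t ht t' ht' h1 h2 hne
    by_contra hE
    obtain ⟨z, ⟨hz1, hz2⟩, -⟩ := exists_mem_of_measureReal_ne_zero hE
    simp only [strip, Set.mem_ofPred_eq] at hz1 hz2
    rw [← h1, ← h2] at hz2
    have hw : t.2.2 ≠ t'.2.2 := fun h => hne (Prod.ext h1 (Prod.ext h2 h))
    have h3 := inv_pow_le_abs_div_pow_sub hW hp hw
    have h4 : |((t.2.2 : ℝ) / W) ^ p - ((t'.2.2 : ℝ) / W) ^ p| < 2 * s := by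
      rw [abs_lt] at *
      constructor <;> linarith
    have h5 : (W : ℝ) ^ p ≤ N := by rw [hNdef]; exact_mod_cast hN
    have h6 : 1 / N ≤ 1 / (W : ℝ) ^ p := by gcongr
    have h7 : 2 * s ≤ 1 / N := by
      rw [hs, mul_one_div, div_le_div_iff₀ (by positivity) hNpos]
      nlinarith [one_le_pow₀ hL (n := 2)]
    linarith
  · intro t ht t' ht' hl
    have hlpos := abs_pos.2 hl
    have h1 := hΔlow t ht t' ht'
    have h2 : 0 < (16 ^ ((e + 1) * n) : ℝ)⁻¹ *
        (|(t.1 : ℝ) * (t'.2.1 : ℝ) ^ e - t'.1 * (t.2.1 : ℝ) ^ e| / (U : ℝ) ^ 2) := by positivity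
    refine (volume_overlap_le hspos (abs_pos.1 (h2.trans_le h1))).trans ?_
    have h3 : 4 * s ^ 2 ≤ 1 / N ^ 2 := by
      rw [hs, div_pow, one_pow, mul_one_div, div_le_div_iff₀ (by positivity) (by positivity)]
      have : 1 ≤ L ^ 4 := one_le_pow₀ hL
      have : 0 ≤ N ^ 2 := by positivity
      nlinarith
    calc 4 * s ^ 2 / |((t.1 : ℝ) / U) ^ n * ((t'.2.1 : ℝ) / V) ^ (e * n) -
          ((t'.1 : ℝ) / U) ^ n * ((t.2.1 : ℝ) / V) ^ (e * n)|
        ≤ 1 / N ^ 2 / ((16 ^ ((e + 1) * n) : ℝ)⁻¹ *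
        (|(t.1 : ℝ) * (t'.2.1 : ℝ) ^ e - t'.1 * (t.2.1 : ℝ) ^ e| / (U : ℝ) ^ 2)) := by gcongr
      _ = 16 ^ ((e + 1) * n) * (U : ℝ) ^ 2 *
        |(t.1 : ℝ) * (t'.2.1 : ℝ) ^ e - t'.1 * (t.2.1 : ℝ) ^ e|⁻¹ / N ^ 2 := by
          field_simp
      _ ≤ _ := by gcongr
  · intro t ht q hq
    set F := T.filter (fun t' => (t'.1, t'.2.1) = q ∧ volume.real
      (strip (((t.1 : ℝ) / U) ^ n, ((t.2.1 : ℝ) / V) ^ (e * n), ((t.2.2 : ℝ) / W) ^ p) s ∩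
        strip (((t'.1 : ℝ) / U) ^ n, ((t'.2.1 : ℝ) / V) ^ (e * n),
          ((t'.2.2 : ℝ) / W) ^ p) s ∩ square L) ≠ 0) with hF
    have hinj : Set.InjOn (fun t : ℕ × ℕ × ℕ => t.2.2) (F : Set (ℕ × ℕ × ℕ)) := by
      intro x hx y hy hxy
      rw [hF, Finset.mem_coe, Finset.mem_filter] at hx hy
      have := hx.2.1.trans hy.2.1.symm
      rw [Prod.mk.injEq] at this
      exact Prod.ext this.1 (Prod.ext this.2 hxy)
    rw [← Finset.card_image_of_injOn hinj]
    set l := |(t.1 : ℝ) * (q.2 : ℝ) ^ e - q.1 * (t.2.1 : ℝ) ^ e| with hl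
    have hnear := card_pow_near_le (F.image fun t : ℕ × ℕ × ℕ => t.2.2) hW
      (Nat.one_le_iff_ne_zero.2 hp) (ξ := ((t.2.2 : ℝ) / W) ^ p * ((q.2 : ℝ) / V) ^ (e * n) /
        ((t.2.1 : ℝ) / V) ^ (e * n)) (η := L * (2 * L * (n * (l / (U : ℝ) ^ 2)) + 2 * s))
      (by positivity) (by
        intro w hw
        obtain ⟨t', ht', rfl⟩ := Finset.mem_image.1 hw
        rw [hF, Finset.mem_filter] at ht'
        obtain ⟨ht'T, rfl, hE⟩ := ht'
        refine ⟨(hT t' ht'T).2.2.1.2.2, ?_⟩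
        obtain ⟨z, hz⟩ := exists_mem_of_measureReal_ne_zero hE
        have h1 := (abs_minor_le (hbdd t ht) (hbdd t' ht'T) hL hz).1
        refine abs_sub_div_mul_le (hbdd t ht).2.1.1 hL0 (h1.trans ?_)
        have := hΔup t ht t' ht'T
        simp only
        gcongr)
    refine hnear.trans ?_
    have hsW : L * W * s ≤ 1 / 32 := by
      rw [hs, mul_one_div, div_le_div_iff₀ (by positivity) (by norm_num), hNdef]
      have h1 : (1 : ℝ) ≤ U * V := one_le_mul_of_one_le_of_one_le hU' hV'
      have h2 : L ≤ L ^ 2 := by nlinarith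
      calc L * W * 32 = 32 * (L * (1 * W)) := by ring
        _ ≤ 32 * (L ^ 2 * (U * V * W)) := by gcongr
        _ = _ := by ring
    have hx : 0 ≤ W * l / (U : ℝ) ^ 2 := by positivity
    calc 2 * 16 ^ p * W * (L * (2 * L * (n * (l / (U : ℝ) ^ 2)) + 2 * s)) + 1
        = (4 * 16 ^ p * L ^ 2 * n) * (W * l / (U : ℝ) ^ 2) + 4 * 16 ^ p * (L * W * s) + 1 := by
          ring
      _ ≤ K * (W * l / (U : ℝ) ^ 2) + 4 * 16 ^ p * (1 / 32) + 1 := by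
          gcongr
          have : (0 : ℝ) < 16 ^ p := by positivity
          linarith
      _ ≤ _ := by
          have h16 : (0 : ℝ) < 16 ^ p := by positivity
          have : (0 : ℝ) ≤ 4 * 16 ^ p * L ^ 2 * n := by positivity
          linarith

lemma sum_volume_overlap_le_of_linear (hU : 1 ≤ U) (hW : 1 ≤ W) (hVU : V ^ m = U) (hm : m ≠ 0)
    (hn : n ≠ 0) (hL : 1 ≤ L) (hs : s = 1 / (32 * L ^ 2 * ((U : ℝ) * V * W)))
    (hT : ∀ t ∈ T, (1 ≤ t.1 ∧ t.1 ≤ U ∧ U ≤ 16 * t.1) ∧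
      (1 ≤ t.2.1 ∧ t.2.1 ≤ V ∧ V ≤ 16 * t.2.1) ∧
      (1 ≤ t.2.2 ∧ t.2.2 ≤ W ∧ W ≤ 16 * t.2.2) ∧ Nat.Coprime t.1 t.2.1)
    (hbdd : ∀ t ∈ T, Bdd L (((t.2.2 : ℝ) / W) ^ n, ((t.2.1 : ℝ) / V) ^ m, (t.1 : ℝ) / U))
    (hWU : W ^ n = U)
    (hharm : ∑ n ∈ Finset.range (U ^ 2 + 1), (n : ℝ)⁻¹ ≤ K * W)
    (hK1 : 1 ≤ K) (hK3 : 8 * 16 ^ n * L ^ 2 + 16 ^ n + 1 ≤ K) :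
    ∑ t ∈ T, ∑ t' ∈ T,
      volume.real (strip (((t.2.2 : ℝ) / W) ^ n, ((t.2.1 : ℝ) / V) ^ m, (t.1 : ℝ) / U) s ∩
        strip (((t'.2.2 : ℝ) / W) ^ n, ((t'.2.1 : ℝ) / V) ^ m, (t'.1 : ℝ) / U) s ∩ square L) ≤
      K + K ^ 2 + 2 * (16 ^ m + 1) * K ^ 3 := by
  have hV : 1 ≤ V := by
    rcases Nat.eq_zero_or_pos V with h | h
    · rw [h, zero_pow hm] at hVU; omega
    · exact h
  have hU' : (1 : ℝ) ≤ U := by exact_mod_cast hU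
  have hV' : (1 : ℝ) ≤ V := by exact_mod_cast hV
  have hW' : (1 : ℝ) ≤ W := by exact_mod_cast hW
  have hL0 : 0 < L := by linarith
  set N : ℝ := (U : ℝ) * V * W with hNdef
  have hNpos : 0 < N := by positivity
  have hspos : 0 < s := by rw [hs]; positivity
  have hU2 : (0 : ℝ) < (U : ℝ) ^ 2 := by positivity
  refine sum_overlap_le T _ (by linarith) hU hW hVU hm
    (fun t ht => ⟨⟨(hT t ht).1.1, (hT t ht).1.2.1⟩, (hT t ht).2.1,
      ⟨(hT t ht).2.2.1.1, (hT t ht).2.2.1.2.1⟩, (hT t ht).2.2.2⟩) hharm ?_ ?_ ?_ ?_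
  · intro t ht
    refine (volume_strip_inter_self_le hL hNpos hs (hbdd t ht)).trans ?_
    gcongr
  · intro t ht t' ht' h1 h2 hne
    by_contra hE
    obtain ⟨z, ⟨hz1, hz2⟩, ⟨hx, -⟩, -⟩ := exists_mem_of_measureReal_ne_zero hE
    simp only [strip, Set.mem_ofPred_eq] at hz1 hz2
    rw [← h1, ← h2] at hz2
    have hw : t.2.2 ≠ t'.2.2 := fun h => hne (Prod.ext h1 (Prod.ext h2 h))
    have h3 := inv_pow_le_abs_div_pow_sub hW hn hw
    have h4 : |((t.2.2 : ℝ) / W) ^ n - ((t'.2.2 : ℝ) / W) ^ n| * z.1 < 2 * s := by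
      have hz0 : 0 < z.1 := lt_of_lt_of_le (by positivity) hx
      rw [← abs_of_pos hz0, ← abs_mul]
      rw [abs_lt] at *
      constructor <;> linarith
    have h5 : (W : ℝ) ^ n ≤ N := by
      have : (W : ℝ) ^ n = U := by exact_mod_cast hWU
      rw [this, hNdef, mul_assoc]
      exact le_mul_of_one_le_right (by linarith) (one_le_mul_of_one_le_of_one_le hV' hW')
    have h6 : 1 / N ≤ 1 / (W : ℝ) ^ n := by gcongr
    have h7 : 2 * s ≤ 1 / N * (1 / (4 * L)) := by
      rw [hs, mul_one_div, div_mul_div_comm, div_le_div_iff₀ (by positivity) (by positivity)]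
      have : 0 ≤ N * L * (L - 1) := by
        have : 0 ≤ L - 1 := by linarith
        positivity
      nlinarith [mul_pos hNpos hL0]
    have h8 : 1 / N * (1 / (4 * L)) ≤ |((t.2.2 : ℝ) / W) ^ n - ((t'.2.2 : ℝ) / W) ^ n| * z.1 := by
      gcongr
      exact h6.trans h3
    linarith
  · intro t ht t' ht' hl
    have hlpos := abs_pos.2 hl
    have hD : |(t.1 : ℝ) / U * ((t'.2.1 : ℝ) / V) ^ m - (t'.1 : ℝ) / U * ((t.2.1 : ℝ) / V) ^ m| =
        |(t.1 : ℝ) * (t'.2.1 : ℝ) ^ m - t'.1 * (t.2.1 : ℝ) ^ m| / (U : ℝ) ^ 2 := by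
      rw [div_mul_div_pow_sub hVU, abs_div, abs_of_pos hU2]
    refine (volume_overlap_le_of_minor hL hspos (hbdd t ht) (hbdd t' ht') ?_).trans ?_
    · simp only
      rw [← abs_pos, hD]
      positivity
    simp only
    rw [hD]
    have h3 : 32 * L ^ 2 * s ^ 2 ≤ 1 / N ^ 2 := by
      have : 32 * L ^ 2 * s ^ 2 = 1 / (32 * L ^ 2) * (1 / N ^ 2) := by rw [hs]; field_simp
      rw [this]
      refine mul_le_of_le_one_left (by positivity) ?_
      rw [div_le_one (by positivity)]
      nlinarith
    calc 32 * L ^ 2 * s ^ 2 /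
        (|(t.1 : ℝ) * (t'.2.1 : ℝ) ^ m - t'.1 * (t.2.1 : ℝ) ^ m| / (U : ℝ) ^ 2)
        ≤ 1 / N ^ 2 /
        (|(t.1 : ℝ) * (t'.2.1 : ℝ) ^ m - t'.1 * (t.2.1 : ℝ) ^ m| / (U : ℝ) ^ 2) := by gcongr
      _ = 1 * (U : ℝ) ^ 2 *
        |(t.1 : ℝ) * (t'.2.1 : ℝ) ^ m - t'.1 * (t.2.1 : ℝ) ^ m|⁻¹ / N ^ 2 := by
          field_simp
      _ ≤ _ := by gcongr
  · intro t ht q hq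
    set F := T.filter (fun t' => (t'.1, t'.2.1) = q ∧ volume.real
      (strip (((t.2.2 : ℝ) / W) ^ n, ((t.2.1 : ℝ) / V) ^ m, (t.1 : ℝ) / U) s ∩
        strip (((t'.2.2 : ℝ) / W) ^ n, ((t'.2.1 : ℝ) / V) ^ m, (t'.1 : ℝ) / U) s ∩
          square L) ≠ 0) with hF
    have hinj : Set.InjOn (fun t : ℕ × ℕ × ℕ => t.2.2) (F : Set (ℕ × ℕ × ℕ)) := by
      intro x hx y hy hxy
      rw [hF, Finset.mem_coe, Finset.mem_filter] at hx hy
      have := hx.2.1.trans hy.2.1.symm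
      rw [Prod.mk.injEq] at this
      exact Prod.ext this.1 (Prod.ext this.2 hxy)
    rw [← Finset.card_image_of_injOn hinj]
    set l := |(t.1 : ℝ) * (q.2 : ℝ) ^ m - q.1 * (t.2.1 : ℝ) ^ m| with hl
    have hnear := card_pow_near_le (F.image fun t : ℕ × ℕ × ℕ => t.2.2) hW
      (Nat.one_le_iff_ne_zero.2 hn) (ξ := ((t.2.2 : ℝ) / W) ^ n * ((q.2 : ℝ) / V) ^ m /
        ((t.2.1 : ℝ) / V) ^ m) (η := L * (4 * L * (l / (U : ℝ) ^ 2 + 2 * s)))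
      (by positivity) (by
        intro w hw
        obtain ⟨t', ht', rfl⟩ := Finset.mem_image.1 hw
        rw [hF, Finset.mem_filter] at ht'
        obtain ⟨ht'T, rfl, hE⟩ := ht'
        refine ⟨(hT t' ht'T).2.2.1.2.2, ?_⟩
        obtain ⟨z, hz⟩ := exists_mem_of_measureReal_ne_zero hE
        have h1 := (abs_minor_le (hbdd t ht) (hbdd t' ht'T) hL hz).2
        refine abs_sub_div_mul_le (hbdd t ht).2.1.1 hL0 (h1.trans ?_)
        simp only
        rw [div_mul_div_pow_sub hVU, abs_div, abs_of_pos hU2])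
    refine hnear.trans ?_
    have hsW : L ^ 2 * W * s ≤ 1 / 32 := by
      rw [hs, mul_one_div, div_le_div_iff₀ (by positivity) (by norm_num), hNdef]
      have h1 : (1 : ℝ) ≤ U * V := one_le_mul_of_one_le_of_one_le hU' hV'
      calc L ^ 2 * W * 32 = 32 * (L ^ 2 * (1 * W)) := by ring
        _ ≤ 32 * (L ^ 2 * (U * V * W)) := by gcongr
        _ = _ := by ring
    have hx : 0 ≤ W * l / (U : ℝ) ^ 2 := by positivity
    calc 2 * 16 ^ n * W * (L * (4 * L * (l / (U : ℝ) ^ 2 + 2 * s))) + 1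
        = (8 * 16 ^ n * L ^ 2) * (W * l / (U : ℝ) ^ 2) + 16 * 16 ^ n * (L ^ 2 * W * s) + 1 := by
          ring
      _ ≤ K * (W * l / (U : ℝ) ^ 2) + 16 * 16 ^ n * (1 / 32) + 1 := by
          gcongr
          have : (0 : ℝ) < 16 ^ n := by positivity
          linarith
      _ ≤ _ := by
          have h16 : (0 : ℝ) < 16 ^ n := by positivity
          have : (0 : ℝ) ≤ 8 * 16 ^ n * L ^ 2 := by positivity
          linarith

end overlapSum

/-- Integer points of the box `[U / 16, U] × [V / 16, V] × [W / 16, W]` whose first two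
coordinates are coprime. -/
def coprimeBox (U V W : ℕ) : Finset (ℕ × ℕ × ℕ) :=
  ((Finset.Ioc 0 U ×ˢ Finset.Ioc 0 V ×ˢ Finset.Ioc 0 W).filter (fun t =>
    (Nat.Coprime t.1 t.2.1 ∧ U ≤ 16 * t.1 ∧ V ≤ 16 * t.2.1) ∧ W ≤ 16 * t.2.2))

lemma mem_coprimeBox {U V W : ℕ} {t : ℕ × ℕ × ℕ} (h : t ∈ coprimeBox U V W) :
    (1 ≤ t.1 ∧ t.1 ≤ U ∧ U ≤ 16 * t.1) ∧ (1 ≤ t.2.1 ∧ t.2.1 ≤ V ∧ V ≤ 16 * t.2.1) ∧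
      (1 ≤ t.2.2 ∧ t.2.2 ≤ W ∧ W ≤ 16 * t.2.2) ∧ Nat.Coprime t.1 t.2.1 := by
  simp only [coprimeBox, Finset.mem_filter, Finset.mem_product, Finset.mem_Ioc] at h
  exact ⟨⟨h.1.1.1, h.1.1.2, h.2.1.2.1⟩, ⟨h.1.2.1.1, h.1.2.1.2, h.2.1.2.2⟩,
    ⟨h.1.2.2.1, h.1.2.2.2, h.2.2⟩, h.2.1.1⟩

lemma le_card_coprimeBox (U V W : ℕ) :
    (U : ℝ) * V * W ≤ 16 * ((coprimeBox U V W).card : ℝ) := by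
  set P := (Finset.Ioc 0 U ×ˢ Finset.Ioc 0 V).filter
      (fun q => Nat.Coprime q.1 q.2 ∧ U ≤ 16 * q.1 ∧ V ≤ 16 * q.2) with hP
  set Q := (Finset.Ioc 0 W).filter (fun w => W ≤ 16 * w) with hQ
  have h1 : (coprimeBox U V W).card = P.card * Q.card := by
    rw [← Finset.card_product]
    refine Finset.card_bij (fun t _ => ((t.1, t.2.1), t.2.2)) ?_ ?_ ?_
    · intro t ht
      simp only [coprimeBox, hP, hQ, Finset.mem_filter, Finset.mem_product] at ht ⊢
      exact ⟨⟨⟨ht.1.1, ht.1.2.1⟩, ht.2.1⟩, ht.1.2.2, ht.2.2⟩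
    · intro t _ t' _ h
      simp only [Prod.mk.injEq] at h
      exact Prod.ext h.1.1 (Prod.ext h.1.2 h.2)
    · rintro ⟨⟨u, v⟩, w⟩ ht
      simp only [hP, hQ, Finset.mem_filter, Finset.mem_product] at ht
      refine ⟨(u, v, w), ?_, rfl⟩
      simp only [coprimeBox, Finset.mem_filter, Finset.mem_product]
      exact ⟨⟨ht.1.1.1, ht.1.1.2, ht.2.1⟩, ht.1.2, ht.2.2⟩
  have h2 : (W : ℝ) ≤ 2 * Q.card := by
    have hsub : Finset.Ioc (W / 2) W ⊆ Q := by
      intro w hw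
      rw [Finset.mem_Ioc] at hw
      rw [hQ, Finset.mem_filter, Finset.mem_Ioc]
      omega
    have := Finset.card_le_card hsub
    rw [Nat.card_Ioc] at this
    have : W ≤ 2 * Q.card := by omega
    exact_mod_cast this
  have h3 := mul_le_card_coprime U V
  rw [← hP] at h3
  rw [h1]
  push_cast
  calc (U : ℝ) * V * W ≤ 8 * P.card * (2 * Q.card) := by gcongr
    _ = _ := by ring

lemma le_volume_iUnion_strip {L s N K : ℝ} (T : Finset (ℕ × ℕ × ℕ)) (ℓ : ℕ × ℕ × ℕ → ℝ × ℝ × ℝ)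
    (hL : 1 ≤ L) (hN : 1 ≤ N) (hs : s = 1 / (32 * L ^ 2 * N)) (hT : N ≤ 16 * T.card)
    (hbdd : ∀ t ∈ T, Bdd L (ℓ t)) (hK : 0 < K)
    (hsum : ∑ t ∈ T, ∑ t' ∈ T, volume.real (strip (ℓ t) s ∩ strip (ℓ t') s ∩ square L) ≤ K) :
    (1 / (1024 * L ^ 3)) ^ 2 / K ≤
      volume.real {z | z ∈ square L ∧ ∃ t ∈ T, z ∈ strip (ℓ t) s} := by
  have hL0 : 0 < L := by linarith
  have hN0 : 0 < N := by linarith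
  have hs0 : 0 < s := by rw [hs]; positivity
  have hs1 : s ≤ 1 / (8 * L ^ 2) := by
    rw [hs]
    gcongr 1 / ?_
    nlinarith [pow_pos hL0 2]
  have : IsFiniteMeasure (volume.restrict (square L)) :=
    ⟨by rw [Measure.restrict_apply_univ]; exact (volume_square_ne_top L).lt_top⟩
  have h := sq_sum_measureReal_le (volume.restrict (square L)) T (fun t => strip (ℓ t) s)
    (fun t _ => measurableSet_strip' _ _)
  have hr : ∀ S, MeasurableSet S →
      (volume.restrict (square L)).real S = volume.real (S ∩ square L) := by
    intro S hS
    rw [measureReal_restrict_apply hS]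
  have hlow : 1 / (1024 * L ^ 3) ≤
      ∑ t ∈ T, (volume.restrict (square L)).real (strip (ℓ t) s) := by
    calc 1 / (1024 * L ^ 3) = N / 16 * (s / (2 * L)) := by rw [hs]; field_simp; norm_num
      _ ≤ T.card * (s / (2 * L)) := by gcongr; linarith
      _ = ∑ t ∈ T, s / (2 * L) := by simp
      _ ≤ _ := by
          refine Finset.sum_le_sum fun t ht => ?_
          rw [hr _ (measurableSet_strip' _ _)]
          exact le_volume_strip_inter_square hL hs0.le hs1 (hbdd t ht)
  have hup : ∑ t ∈ T, ∑ t' ∈ T,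
      (volume.restrict (square L)).real (strip (ℓ t) s ∩ strip (ℓ t') s) ≤ K := by
    refine le_trans (le_of_eq ?_) hsum
    refine Finset.sum_congr rfl fun t _ => Finset.sum_congr rfl fun t' _ => ?_
    rw [hr _ ((measurableSet_strip' _ _).inter (measurableSet_strip' _ _))]
  rw [hr _ (Finset.measurableSet_biUnion T fun t _ => measurableSet_strip' _ _)] at h
  have hset : (⋃ t ∈ T, strip (ℓ t) s) ∩ square L =
      {z | z ∈ square L ∧ ∃ t ∈ T, z ∈ strip (ℓ t) s} := by
    ext z
    simp only [Set.mem_inter_iff, Set.mem_iUnion, Set.mem_ofPred_eq, exists_prop]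
    exact and_comm
  rw [hset] at h
  rw [div_le_iff₀ hK]
  calc (1 / (1024 * L ^ 3)) ^ 2 ≤ _ := by gcongr
    _ ≤ _ := h
    _ ≤ _ := by gcongr

/-- The normalised lines `(a / X) ^ n x + (b / Y) ^ m y = (c / Z) ^ p` at scale `k`. -/
def lineSet (n m p k : ℕ) : Set (ℝ × ℝ × ℝ) :=
  {ℓ | ∃ a b c : ℕ, (1 ≤ a ∧ a ≤ 2 ^ (m * p * k) ∧ 2 ^ (m * p * k) ≤ 16 * a) ∧
    (1 ≤ b ∧ b ≤ 2 ^ (n * p * k) ∧ 2 ^ (n * p * k) ≤ 16 * b) ∧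
    (1 ≤ c ∧ c ≤ 2 ^ (n * m * k) ∧ 2 ^ (n * m * k) ≤ 16 * c) ∧
    ℓ = (((a : ℝ) / (2 ^ (m * p * k) : ℕ)) ^ n, ((b : ℝ) / (2 ^ (n * p * k) : ℕ)) ^ m,
      ((c : ℝ) / (2 ^ (n * m * k) : ℕ)) ^ p)}

/-- A bound for the coefficients of the lines in `lineSet`. -/
def coeffBound (n m p : ℕ) : ℝ := 16 ^ (n + m + p)

lemma one_le_coeffBound (n m p : ℕ) : 1 ≤ coeffBound n m p := one_le_pow₀ (by norm_num)

/-- The width of the strips at scale `k`. -/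
noncomputable def width (n m p k : ℕ) : ℝ :=
  1 / (32 * coeffBound n m p ^ 2 *
    (((2 ^ (m * p * k) : ℕ) : ℝ) * ((2 ^ (n * p * k) : ℕ) : ℝ) * ((2 ^ (n * m * k) : ℕ) : ℝ)))

lemma bdd_of_mem_lineSet {n m p k : ℕ} {ℓ : ℝ × ℝ × ℝ} (h : ℓ ∈ lineSet n m p k) :
    Bdd (coeffBound n m p) ℓ := by
  obtain ⟨a, b, c, ⟨-, ha1, ha2⟩, ⟨-, hb1, hb2⟩, ⟨-, hc1, hc2⟩, rfl⟩ := h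
  have key : ∀ {w W f : ℕ}, 1 ≤ W → w ≤ W → W ≤ 16 * w → f ≤ n + m + p →
      1 / coeffBound n m p ≤ ((w : ℝ) / W) ^ f ∧ ((w : ℝ) / W) ^ f ≤ 1 := by
    intro w W f hW h1 h2 hf
    refine ⟨le_trans ?_ (inv_pow_le_div_pow hW h2 f), div_pow_le_one h1 f⟩
    rw [one_div, coeffBound]
    gcongr
    norm_num
  exact ⟨key Nat.one_le_two_pow ha1 ha2 (by omega), key Nat.one_le_two_pow hb1 hb2 (by omega),
    key Nat.one_le_two_pow hc1 hc2 (by omega)⟩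

/-- At every scale the strips cover a fixed proportion of the square. -/
def Covers (n m p : ℕ) : Prop :=
  ∃ κ : ℝ, 0 < κ ∧ ∀ k, κ ≤ volume.real {z | z ∈ square (coeffBound n m p) ∧
    ∃ ℓ ∈ lineSet n m p k, z ∈ strip ℓ (width n m p k)}

lemma volume_lineSet_ge {n m p k : ℕ} {κ : ℝ} (T : Finset (ℕ × ℕ × ℕ))
    (ℓ : ℕ × ℕ × ℕ → ℝ × ℝ × ℝ) (hT : ∀ t ∈ T, ℓ t ∈ lineSet n m p k)
    (h : κ ≤ volume.real {z | z ∈ square (coeffBound n m p) ∧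
      ∃ t ∈ T, z ∈ strip (ℓ t) (width n m p k)}) :
    κ ≤ volume.real {z | z ∈ square (coeffBound n m p) ∧
      ∃ ℓ ∈ lineSet n m p k, z ∈ strip ℓ (width n m p k)} := by
  refine h.trans (measureReal_mono ?_
    (measure_ne_top_of_subset (fun z hz => hz.1) (volume_square_ne_top _)))
  rintro z ⟨hz, t, ht, hzt⟩
  exact ⟨hz, ℓ t, hT t ht, hzt⟩

lemma sum_inv_pow_two_le {U W i j k : ℕ} (hU : U = 2 ^ (i * k)) (hW : W = 2 ^ (j * k))
    (hj : 1 ≤ j) :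
    ∑ n ∈ Finset.range (U ^ 2 + 1), (n : ℝ)⁻¹ ≤ (2 * i + 1 : ℝ) * W := by
  have h1 := sum_range_inv_le (2 * i * k)
  have h2 : U ^ 2 = 2 ^ (2 * i * k) := by rw [hU, ← pow_mul]; ring_nf
  rw [h2]
  refine h1.trans ?_
  have h3 : k + 1 ≤ W := by
    rw [hW]
    exact (Nat.lt_two_pow_self (n := k)).trans_le
      (Nat.pow_le_pow_right (by norm_num) (Nat.le_mul_of_pos_left k hj))
  have h4 : (k : ℝ) + 1 ≤ W := by exact_mod_cast h3
  push_cast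
  have : (0 : ℝ) ≤ i := by positivity
  have : (0 : ℝ) ≤ k := by positivity
  nlinarith

lemma covers_of_dvd {n m p : ℕ} (hn : 1 ≤ n) (hm : 1 ≤ m) (hp : 1 ≤ p) (hnm : n ∣ m)
    (hdim : n * m * p ≤ m * p + n * p + n * m) : Covers n m p := by
  obtain ⟨e, rfl⟩ := hnm
  have he : e ≠ 0 := by rintro rfl; simp at hm
  set L := coeffBound n (n * e) p with hL
  have hL1 : 1 ≤ L := one_le_coeffBound _ _ _
  set K : ℝ := (2 * (n * e * p : ℕ) + 1) + 16 ^ ((e + 1) * n) +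
    (4 * 16 ^ p * L ^ 2 * n + 16 ^ p + 1) with hK
  have k1 : (0 : ℝ) ≤ 2 * (n * e * p : ℕ) := by positivity
  have k2 : (0 : ℝ) < 16 ^ ((e + 1) * n) := by positivity
  have k3 : (0 : ℝ) < 4 * 16 ^ p * L ^ 2 * n + 16 ^ p + 1 := by positivity
  have hK1 : 1 ≤ K := by linarith
  refine ⟨(1 / (1024 * L ^ 3)) ^ 2 / (K + K ^ 2 + 2 * (16 ^ e + 1) * K ^ 3), by positivity, ?_⟩
  intro k
  set U := 2 ^ (n * e * p * k) with hU
  set V := 2 ^ (n * p * k) with hV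
  set W := 2 ^ (n * (n * e) * k) with hW
  have hmem : ∀ t ∈ coprimeBox U V W, (((t.1 : ℝ) / U) ^ n, ((t.2.1 : ℝ) / V) ^ (e * n),
      ((t.2.2 : ℝ) / W) ^ p) ∈ lineSet n (n * e) p k := by
    intro t ht
    obtain ⟨h1, h2, h3, -⟩ := mem_coprimeBox ht
    refine ⟨t.1, t.2.1, t.2.2, h1, h2, h3, ?_⟩
    rw [mul_comm e n]
  refine volume_lineSet_ge (coprimeBox U V W) _ hmem ?_
  refine le_volume_iUnion_strip (N := (U : ℝ) * V * W) _ _ hL1 ?_ rfl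
    (le_card_coprimeBox U V W) (fun t ht => bdd_of_mem_lineSet (hmem t ht)) (by positivity) ?_
  · have h1 : 1 ≤ U * V * W := Nat.one_le_iff_ne_zero.2 (by positivity)
    exact_mod_cast h1
  · refine sum_volume_overlap_le_of_dvd _ Nat.one_le_two_pow Nat.one_le_two_pow ?_ he (by omega)
      (by omega) hL1 rfl (fun t ht => mem_coprimeBox ht)
      (fun t ht => bdd_of_mem_lineSet (hmem t ht)) ?_ ?_ hK1 (by linarith) (by linarith)
    · rw [hU, hV, ← pow_mul]; ring_nf
    · rw [hU, hV, hW, ← pow_add, ← pow_add, ← pow_mul]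
      refine Nat.pow_le_pow_right (by norm_num) ?_
      calc n * (n * e) * k * p = (n * (n * e) * p) * k := by ring
        _ ≤ (n * e * p + n * p + n * (n * e)) * k := by gcongr
        _ = _ := by ring
    · refine (sum_inv_pow_two_le (U := U) (W := W) (i := n * e * p) (j := n * (n * e)) rfl rfl
        (Nat.one_le_iff_ne_zero.2 (by positivity))).trans ?_
      gcongr
      linarith

lemma covers_of_linear {n m : ℕ} (hn : 1 ≤ n) (hm : 1 ≤ m) : Covers n m 1 := by
  set L := coeffBound n m 1 with hL
  have hL1 : 1 ≤ L := one_le_coeffBound _ _ _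
  set K : ℝ := (2 * (n * m : ℕ) + 1) + (8 * 16 ^ n * L ^ 2 + 16 ^ n + 1) with hK
  have k1 : (0 : ℝ) ≤ 2 * (n * m : ℕ) := by positivity
  have k3 : (0 : ℝ) < 8 * 16 ^ n * L ^ 2 + 16 ^ n + 1 := by positivity
  have hK1 : 1 ≤ K := by linarith
  refine ⟨(1 / (1024 * L ^ 3)) ^ 2 / (K + K ^ 2 + 2 * (16 ^ m + 1) * K ^ 3), by positivity, ?_⟩
  intro k
  set U := 2 ^ (n * m * k) with hU
  set V := 2 ^ (n * 1 * k) with hV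
  set W := 2 ^ (m * 1 * k) with hW
  have hmem : ∀ t ∈ coprimeBox U V W, (((t.2.2 : ℝ) / W) ^ n, ((t.2.1 : ℝ) / V) ^ m,
      (t.1 : ℝ) / U) ∈ lineSet n m 1 k := by
    intro t ht
    obtain ⟨h1, h2, h3, -⟩ := mem_coprimeBox ht
    refine ⟨t.2.2, t.2.1, t.1, h3, h2, h1, ?_⟩
    rw [pow_one]
  have hs : width n m 1 k = 1 / (32 * L ^ 2 * ((U : ℝ) * V * W)) := by
    rw [width, hL, hU, hV, hW]
    ring
  refine volume_lineSet_ge (coprimeBox U V W) _ hmem ?_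
  refine le_volume_iUnion_strip (N := (U : ℝ) * V * W) _ _ hL1 ?_ hs
    (le_card_coprimeBox U V W) (fun t ht => bdd_of_mem_lineSet (hmem t ht)) (by positivity) ?_
  · have h1 : 1 ≤ U * V * W := Nat.one_le_iff_ne_zero.2 (by positivity)
    exact_mod_cast h1
  · refine sum_volume_overlap_le_of_linear _ Nat.one_le_two_pow Nat.one_le_two_pow ?_ (by omega)
      (by omega) hL1 hs (fun t ht => mem_coprimeBox ht)
      (fun t ht => bdd_of_mem_lineSet (hmem t ht)) ?_ ?_ hK1 (by linarith)
    · rw [hU, hV, ← pow_mul]; ring_nf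
    · rw [hU, hW, ← pow_mul]; ring_nf
    · refine (sum_inv_pow_two_le (U := U) (W := W) (i := n * m) (j := m * 1) rfl rfl
        (by omega)).trans ?_
      gcongr
      linarith

lemma Covers.symm {n m p : ℕ} (h : Covers n m p) : Covers m n p := by
  obtain ⟨κ, hκ, h⟩ := h
  refine ⟨κ, hκ, fun k => (h k).trans (le_of_eq ?_)⟩
  have hc : coeffBound m n p = coeffBound n m p := by rw [coeffBound, coeffBound, add_comm m n]
  have hw : width m n p k = width n m p k := by
    rw [width, width, hc, mul_comm m n]
    ring
  have hmp : MeasurePreserving (Prod.swap : ℝ × ℝ → ℝ × ℝ) volume volume :=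
    Measure.measurePreserving_swap
  have hemb : MeasurableEmbedding (Prod.swap : ℝ × ℝ → ℝ × ℝ) :=
    (MeasurableEquiv.prodComm (α := ℝ) (β := ℝ)).measurableEmbedding
  rw [hc, hw, measureReal_def, measureReal_def, ← hmp.measure_preimage_emb hemb]
  congr 2
  ext z
  constructor
  · rintro ⟨⟨hx, hy⟩, ℓ, ⟨a, b, c, ha, hb, hcc, rfl⟩, hz⟩
    refine ⟨⟨hy, hx⟩, _, ⟨b, a, c, hb, ha, by rwa [mul_comm m n], rfl⟩, ?_⟩
    simp only [strip, Set.mem_ofPred_eq, Prod.fst_swap, Prod.snd_swap] at hz ⊢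
    rw [mul_comm m n, add_comm]
    exact hz
  · rintro ⟨⟨hx, hy⟩, ℓ, ⟨a, b, c, ha, hb, hcc, rfl⟩, hz⟩
    refine ⟨⟨hy, hx⟩, _, ⟨b, a, c, hb, ha, by rwa [mul_comm n m], rfl⟩, ?_⟩
    simp only [strip, Set.mem_ofPred_eq, Prod.fst_swap, Prod.snd_swap] at hz ⊢
    rw [mul_comm n m, add_comm]
    exact hz

lemma covers {n m p : ℕ} (hn : 1 ≤ n) (hm : 1 ≤ m) (hp : 1 ≤ p)
    (hcase : (n = 1 ∧ m = 1) ∨ 2 ≤ Nat.gcd n m)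
    (hdim : n * m * p ≤ m * p + n * p + n * m) : Covers n m p := by
  by_cases h1 : n ∣ m
  · exact covers_of_dvd hn hm hp h1 hdim
  by_cases h2 : m ∣ n
  · exact (covers_of_dvd hm hn hp h2 (by linarith [mul_comm n m])).symm
  rcases hp.eq_or_lt with rfl | hp2
  · exact covers_of_linear hn hm
  exfalso
  have hg : 2 ≤ Nat.gcd n m := by
    rcases hcase with ⟨rfl, rfl⟩ | h
    · simp at h1
    · exact h
  obtain ⟨i, hi⟩ := Nat.gcd_dvd_left n m
  obtain ⟨j, hj⟩ := Nat.gcd_dvd_right n m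
  set g := Nat.gcd n m
  have hi0 : i ≠ 0 := by rintro rfl; omega
  have hj0 : j ≠ 0 := by rintro rfl; omega
  have hi1 : i ≠ 1 := by rintro rfl; exact h1 ⟨j, by rw [hj, hi]; ring⟩
  have hj1 : j ≠ 1 := by rintro rfl; exact h2 ⟨i, by rw [hi, hj]; ring⟩
  have hij : i ≠ j := by rintro rfl; exact h1 ⟨1, by rw [mul_one, hi, hj]⟩
  have hprod : i + j < i * j := by
    obtain h | h : (2 ≤ i ∧ 3 ≤ j) ∨ (3 ≤ i ∧ 2 ≤ j) := by omega
    · nlinarith [h.1, h.2]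
    · nlinarith [h.1, h.2]
  have hnm : 2 * (n + m) < n * m := by
    rw [hi, hj]
    calc 2 * (g * i + g * j) = g * (2 * (i + j)) := by ring
      _ < g * (2 * (i * j)) := by gcongr
      _ ≤ g * (g * (i * j)) := by gcongr
      _ = _ := by ring
  have e1 : p * (2 * (n + m)) < p * (n * m) := by gcongr
  have e2 : (n * m) * 2 ≤ (n * m) * p := by gcongr; exact hp2
  nlinarith

/-- A neighbourhood of `square L` that stays in the open positive quadrant. -/
def bigSquare (L : ℝ) : Set (ℝ × ℝ) :=
  Set.Icc (1 / (8 * L)) (3 * L) ×ˢ Set.Icc (1 / (8 * L)) (3 * L)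

lemma measurableSet_bigSquare (L : ℝ) : MeasurableSet (bigSquare L) :=
  measurableSet_Icc.prod measurableSet_Icc

lemma volume_bigSquare_ne_top (L : ℝ) : volume (bigSquare L) ≠ ⊤ :=
  (isCompact_Icc.prod isCompact_Icc).measure_ne_top

/-- The part of the strip of width `t` around `ℓ` at distance less than `3 L s` from `z`. -/
def patch (L s t : ℝ) (ℓ : ℝ × ℝ × ℝ) (z : ℝ × ℝ) : Set (ℝ × ℝ) :=
  {w | |w.1 - z.1| < 3 * L * s ∧ |w.2 - z.2| < 3 * L * s} ∩ strip ℓ t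

lemma measurableSet_patch (L s t : ℝ) (ℓ : ℝ × ℝ × ℝ) (z : ℝ × ℝ) :
    MeasurableSet (patch L s t ℓ z) := by
  have h : IsOpen ({w : ℝ × ℝ | |w.1 - z.1| < 3 * L * s} ∩ {w | |w.2 - z.2| < 3 * L * s}) :=
    (isOpen_lt (by fun_prop) (by fun_prop)).inter (isOpen_lt (by fun_prop) (by fun_prop))
  exact h.measurableSet.inter (measurableSet_strip' _ _)

section patch

variable {L s θ : ℝ} {ℓ : ℝ × ℝ × ℝ} {z : ℝ × ℝ}

lemma patch_subset_bigSquare {t : ℝ} (hL : 1 ≤ L) (hs : s ≤ 1 / (32 * L ^ 2))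
    (hz : z ∈ square L) : patch L s t ℓ z ⊆ bigSquare L := by
  rintro w ⟨⟨h1, h2⟩, -⟩
  obtain ⟨⟨hx1, hx2⟩, hy1, hy2⟩ := hz
  have hL0 : 0 < L := by linarith
  have h3 : 3 * L * s ≤ 1 / (8 * L) := by
    calc 3 * L * s ≤ 3 * L * (1 / (32 * L ^ 2)) := by gcongr
      _ = 3 / 4 * (1 / (8 * L)) := by field_simp; norm_num
      _ ≤ _ := by have : 0 < 1 / (8 * L) := by positivity
                  linarith
  have h4 : 1 / (4 * L) = 1 / (8 * L) + 1 / (8 * L) := by field_simp; norm_num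
  have h5 : 1 / (8 * L) ≤ 1 := by
    rw [div_le_one (by positivity)]; linarith
  rw [abs_lt] at h1 h2
  refine ⟨⟨?_, ?_⟩, ?_, ?_⟩ <;> linarith

lemma volume_patch_le (hL : 1 ≤ L) (hs : 0 < s) (hθ : 0 ≤ θ) (h : Bdd L ℓ) :
    volume.real (patch L s (θ * s) ℓ z) ≤ 12 * L ^ 2 * θ * s ^ 2 := by
  obtain ⟨⟨h1, h1'⟩, -, -⟩ := h
  have hL0 : 0 < L := by linarith
  have hA : 0 < ℓ.1 := lt_of_lt_of_le (by positivity) h1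
  rcases hθ.eq_or_lt with rfl | hθ'
  · have : patch L s (0 * s) ℓ z = ∅ := by
      rw [Set.eq_empty_iff_forall_notMem]
      rintro w ⟨-, hw⟩
      simp only [strip, Set.mem_ofPred_eq, zero_mul] at hw
      exact absurd hw (abs_nonneg _).not_gt
    rw [this]; simp
  have hv := volume_real_strip_inter_strip (A := ℓ.1) (B := ℓ.2.1) (A' := 0) (B' := 1)
    (by simpa using hA.ne') ℓ.2.2 z.2 (δ := θ * s) (by positivity) (δ' := 3 * L * s)
    (by positivity)
  have e : ℓ.1 * 1 - 0 * ℓ.2.1 = ℓ.1 := by ring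
  rw [e, abs_of_pos hA] at hv
  have hsub : patch L s (θ * s) ℓ z ⊆ {w : ℝ × ℝ | |ℓ.1 * w.1 + ℓ.2.1 * w.2 - ℓ.2.2| < θ * s ∧
      |0 * w.1 + 1 * w.2 - z.2| < 3 * L * s} := by
    rintro w ⟨⟨-, hw⟩, hw'⟩
    exact ⟨hw', by simpa using hw⟩
  refine (measureReal_mono hsub ?_).trans ?_
  · intro htop
    rw [measureReal_def, htop, ENNReal.toReal_top] at hv
    have : 0 < 4 * (θ * s) * (3 * L * s) / ℓ.1 := by positivity
    linarith
  rw [hv, div_le_iff₀ hA]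
  have : 1 ≤ L * ℓ.1 := by rw [div_le_iff₀ hL0] at h1; linarith
  calc 4 * (θ * s) * (3 * L * s) = 12 * L * θ * s ^ 2 * 1 := by ring
    _ ≤ 12 * L * θ * s ^ 2 * (L * ℓ.1) := by gcongr
    _ = _ := by ring

lemma abs_fst_sub_le {t : ℝ} {w : ℝ × ℝ} (hL : 0 < L) (h : Bdd L ℓ) (hz : z ∈ strip ℓ s)
    (hw : w ∈ strip ℓ t) : |w.1 - z.1| ≤ L * (s + t + |w.2 - z.2|) := by
  obtain ⟨⟨h1, h1'⟩, ⟨h2, h2'⟩, -⟩ := h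
  simp only [strip, Set.mem_ofPred_eq] at hz hw
  have hA : 0 < ℓ.1 := lt_of_lt_of_le (by positivity) h1
  have hB : 0 < ℓ.2.1 := lt_of_lt_of_le (by positivity) h2
  have h3 : ℓ.1 * (w.1 - z.1) = (ℓ.1 * w.1 + ℓ.2.1 * w.2 - ℓ.2.2) -
      (ℓ.1 * z.1 + ℓ.2.1 * z.2 - ℓ.2.2) - ℓ.2.1 * (w.2 - z.2) := by ring
  have h4 : ℓ.1 * |w.1 - z.1| ≤ s + t + |w.2 - z.2| := by
    rw [← abs_of_pos hA, ← abs_mul, h3]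
    refine (abs_sub _ _).trans ?_
    have h5 := abs_sub (ℓ.1 * w.1 + ℓ.2.1 * w.2 - ℓ.2.2) (ℓ.1 * z.1 + ℓ.2.1 * z.2 - ℓ.2.2)
    have h6 : |ℓ.2.1 * (w.2 - z.2)| ≤ |w.2 - z.2| := by
      rw [abs_mul, abs_of_pos hB]
      exact mul_le_of_le_one_left (abs_nonneg _) h2'
    linarith
  have : 1 ≤ L * ℓ.1 := by rw [div_le_iff₀ hL] at h1; linarith
  calc |w.1 - z.1| = 1 * |w.1 - z.1| := (one_mul _).symm
    _ ≤ L * ℓ.1 * |w.1 - z.1| := by gcongr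
    _ = L * (ℓ.1 * |w.1 - z.1|) := by ring
    _ ≤ _ := by gcongr

lemma le_volume_patch (hL : 1 ≤ L) (hs : 0 < s) (hs' : s ≤ 1 / (32 * L ^ 2)) (hθ : 0 ≤ θ)
    (hθ1 : θ ≤ 1) (h : Bdd L ℓ) (hz : z ∈ square L) (hzs : z ∈ strip ℓ s) :
    4 * θ * s ^ 2 ≤ volume.real (patch L s (θ * s) ℓ z) := by
  have hL0 : 0 < L := by linarith
  have h1 := h.1.1
  have hA : 0 < ℓ.1 := lt_of_lt_of_le (by positivity) h1
  have hv := volume_real_strip_inter_strip (A := ℓ.1) (B := ℓ.2.1) (A' := 0) (B' := 1)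
    (by simpa using hA.ne') ℓ.2.2 z.2 (δ := θ * s) (by positivity) hs.le
  have e : ℓ.1 * 1 - 0 * ℓ.2.1 = ℓ.1 := by ring
  rw [e, abs_of_pos hA] at hv
  have hsub : {w : ℝ × ℝ | |ℓ.1 * w.1 + ℓ.2.1 * w.2 - ℓ.2.2| < θ * s ∧
      |0 * w.1 + 1 * w.2 - z.2| < s} ⊆ patch L s (θ * s) ℓ z := by
    rintro w ⟨hw, hw2⟩
    have hw2' : |w.2 - z.2| < s := by simpa using hw2
    refine ⟨⟨?_, ?_⟩, hw⟩
    · have := abs_fst_sub_le hL0 h hzs (show w ∈ strip ℓ (θ * s) from hw)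
      have h5 : θ * s ≤ s := mul_le_of_le_one_left hs.le hθ1
      calc |w.1 - z.1| ≤ L * (s + θ * s + |w.2 - z.2|) := this
        _ < L * (s + s + s) := mul_lt_mul_of_pos_left (by linarith) hL0
        _ = _ := by ring
    · nlinarith
  refine le_trans ?_ (measureReal_mono hsub (measure_ne_top_of_subset
    (patch_subset_bigSquare hL hs' hz) (volume_bigSquare_ne_top L)))
  rw [hv, le_div_iff₀ hA]
  calc 4 * θ * s ^ 2 * ℓ.1 ≤ 4 * θ * s ^ 2 * 1 := by gcongr; exact h.1.2
    _ = _ := by ring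

end patch

/-- A choice of one point of `square L` covered by strips of width `s` around lines of `S` in each
cell indexed by `G` of the grid of mesh `s`. -/
structure IsNet (L s : ℝ) (S : Set (ℝ × ℝ × ℝ)) (G : Finset (ℤ × ℤ))
    (z : ℤ × ℤ → ℝ × ℝ) (ℓ : ℤ × ℤ → ℝ × ℝ × ℝ) : Prop where
  mem_square : ∀ q ∈ G, z q ∈ square L
  mem_strip : ∀ q ∈ G, z q ∈ strip (ℓ q) s
  mem : ∀ q ∈ G, ℓ q ∈ S
  fst_eq : ∀ q ∈ G, ⌊(z q).1 / s⌋ = q.1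
  snd_eq : ∀ q ∈ G, ⌊(z q).2 / s⌋ = q.2

lemma exists_isNet {L s κ : ℝ} {S : Set (ℝ × ℝ × ℝ)} (hL : 1 ≤ L) (hs : 0 < s) (hs1 : s ≤ 1)
    (hκ : κ ≤ volume.real {z | z ∈ square L ∧ ∃ ℓ ∈ S, z ∈ strip ℓ s}) :
    ∃ G z ℓ, IsNet L s S G z ℓ ∧ κ ≤ G.card * s ^ 2 ∧ G.card * s ^ 2 ≤ 9 * L ^ 2 := by
  classical
  have hL0 : 0 < L := by linarith
  set A := {z | z ∈ square L ∧ ∃ ℓ ∈ S, z ∈ strip ℓ s} with hA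
  set R := ⌊2 * L / s⌋ with hR
  have hR0 : 0 ≤ R := Int.floor_nonneg.2 (by positivity)
  set G := (Finset.Icc 0 R ×ˢ Finset.Icc 0 R).filter
    (fun q : ℤ × ℤ => ∃ z ∈ A, ⌊z.1 / s⌋ = q.1 ∧ ⌊z.2 / s⌋ = q.2) with hG
  have hch : ∀ q : ℤ × ℤ, ∃ zl : (ℝ × ℝ) × (ℝ × ℝ × ℝ), q ∈ G → zl.1 ∈ square L ∧ zl.2 ∈ S ∧
      zl.1 ∈ strip zl.2 s ∧ ⌊zl.1.1 / s⌋ = q.1 ∧ ⌊zl.1.2 / s⌋ = q.2 := by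
    intro q
    by_cases hq : q ∈ G
    · obtain ⟨-, z, ⟨hz, ℓ, hℓ, hzℓ⟩, h1, h2⟩ := Finset.mem_filter.1 hq
      exact ⟨(z, ℓ), fun _ => ⟨hz, hℓ, hzℓ, h1, h2⟩⟩
    · exact ⟨((0, 0), (0, 0, 0)), fun h => absurd h hq⟩
  choose f hf using hch
  refine ⟨G, fun q => (f q).1, fun q => (f q).2, ⟨fun q hq => (hf q hq).1,
    fun q hq => (hf q hq).2.2.1, fun q hq => (hf q hq).2.1, fun q hq => (hf q hq).2.2.2.1,
    fun q hq => (hf q hq).2.2.2.2⟩, ?_, ?_⟩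
  · set cell : ℤ × ℤ → Set (ℝ × ℝ) := fun q =>
      Set.Ico (q.1 * s) (q.1 * s + s) ×ˢ Set.Ico (q.2 * s) (q.2 * s + s) with hcell
    have hvol : ∀ q, volume (cell q) = ENNReal.ofReal (s ^ 2) := by
      intro q
      rw [hcell, Measure.volume_eq_prod, Measure.prod_prod, Real.volume_Ico, Real.volume_Ico,
        add_sub_cancel_left, add_sub_cancel_left, ← ENNReal.ofReal_mul hs.le, sq]
    have hsub : A ⊆ ⋃ q ∈ G, cell q := by
      intro z hz
      obtain ⟨⟨hx1, hx2⟩, hy1, hy2⟩ := hz.1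
      have h0 : 0 < 1 / (4 * L) := by positivity
      have hfl : ∀ x : ℝ, x ∈ Set.Ico ((⌊x / s⌋ : ℝ) * s) ((⌊x / s⌋ : ℝ) * s + s) := by
        intro x
        have h1 := Int.floor_le (x / s)
        have h2 := Int.lt_floor_add_one (x / s)
        rw [le_div_iff₀ hs] at h1
        rw [div_lt_iff₀ hs] at h2
        exact ⟨h1, by linarith⟩
      have hrange : ∀ x : ℝ, 1 / (4 * L) ≤ x → x ≤ 2 * L → ⌊x / s⌋ ∈ Finset.Icc 0 R := by
        intro x h1 h2
        rw [Finset.mem_Icc]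
        have : 0 ≤ x := by linarith
        exact ⟨Int.floor_nonneg.2 (by positivity), Int.floor_le_floor (by gcongr)⟩
      rw [Set.mem_iUnion₂]
      refine ⟨(⌊z.1 / s⌋, ⌊z.2 / s⌋), ?_, hfl _, hfl _⟩
      rw [hG, Finset.mem_filter, Finset.mem_product]
      exact ⟨⟨hrange _ hx1 hx2, hrange _ hy1 hy2⟩, z, hz, rfl, rfl⟩
    have h1 : volume A ≤ ENNReal.ofReal (G.card * s ^ 2) := by
      calc volume A ≤ volume (⋃ q ∈ G, cell q) := measure_mono hsub
        _ ≤ ∑ q ∈ G, volume (cell q) := measure_biUnion_finset_le _ _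
        _ = ∑ q ∈ G, ENNReal.ofReal (s ^ 2) := Finset.sum_congr rfl fun q _ => hvol q
        _ = _ := by
          rw [Finset.sum_const, nsmul_eq_mul, ENNReal.ofReal_mul (by positivity),
            ENNReal.ofReal_natCast]
    exact hκ.trans (ENNReal.toReal_le_of_le_ofReal (by positivity) h1)
  · have h1 : G.card ≤ (R + 1).toNat * (R + 1).toNat := by
      refine (Finset.card_filter_le _ _).trans ?_
      rw [Finset.card_product, Int.card_Icc]
      simp
    have h2 : ((R + 1).toNat : ℝ) ≤ 3 * L / s := by
      have h3 : ((R + 1).toNat : ℝ) = (R : ℝ) + 1 := by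
        have : ((R + 1).toNat : ℤ) = R + 1 := Int.toNat_of_nonneg (by omega)
        exact_mod_cast congrArg (Int.cast : ℤ → ℝ) this
      have h4 : (R : ℝ) ≤ 2 * L / s := Int.floor_le _
      rw [h3]
      have h5 : 1 ≤ L / s := by rw [le_div_iff₀ hs]; linarith
      calc (R : ℝ) + 1 ≤ 2 * L / s + L / s := by gcongr
        _ = _ := by ring
    have h3 : (G.card : ℝ) ≤ 3 * L / s * (3 * L / s) := by
      calc (G.card : ℝ) ≤ ((R + 1).toNat : ℝ) * ((R + 1).toNat : ℝ) := by exact_mod_cast h1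
        _ ≤ _ := by gcongr
    calc (G.card : ℝ) * s ^ 2 ≤ 3 * L / s * (3 * L / s) * s ^ 2 := by gcongr
      _ = _ := by field_simp; norm_num

lemma abs_sub_le_of_floor_eq {s x y : ℝ} {i j : ℤ} (hs : 0 < s) (hi : ⌊x / s⌋ = i)
    (hj : ⌊y / s⌋ = j) : |(i : ℝ) - j| ≤ |x - y| / s + 1 := by
  have h1 := Int.floor_le (x / s)
  have h2 := Int.lt_floor_add_one (x / s)
  have h3 := Int.floor_le (y / s)
  have h4 := Int.lt_floor_add_one (y / s)
  rw [hi] at h1 h2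
  rw [hj] at h3 h4
  have h5 : |x - y| / s = |x / s - y / s| := by
    rw [← sub_div, abs_div, abs_of_pos hs]
  rw [h5]
  rcases abs_cases (x / s - y / s) with h | h <;> rcases abs_cases ((i : ℝ) - j) with h' | h' <;>
    linarith

lemma abs_sub_le_of_floor_eq_floor {s x y : ℝ} (hs : 0 < s) (h : ⌊x / s⌋ = ⌊y / s⌋) :
    |x - y| ≤ s := by
  have h1 := Int.abs_sub_lt_one_of_floor_eq_floor h
  rw [← sub_div, abs_div, abs_of_pos hs, div_lt_one hs] at h1
  exact h1.le

section scales

variable {L s s' θ θ' : ℝ} {S' : Set (ℝ × ℝ × ℝ)} {G' : Finset (ℤ × ℤ)}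
  {z' : ℤ × ℤ → ℝ × ℝ} {ℓ' : ℤ × ℤ → ℝ × ℝ × ℝ}

lemma sum_volume_patch_inter_le {ℓ : ℝ × ℝ × ℝ} {z : ℝ × ℝ} (hL : 1 ≤ L) (hs' : 0 < s')
    (hss : s' ≤ s) (hθ : 0 ≤ θ) (hθ' : 0 ≤ θ') (h : Bdd L ℓ)
    (hnet : IsNet L s' S' G' z' ℓ') (hS' : ∀ ℓ ∈ S', Bdd L ℓ) :
    ∑ q ∈ G', volume.real (patch L s (θ * s) ℓ z ∩ patch L s' (θ' * s') (ℓ' q) (z' q)) ≤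
      2520 * L ^ 5 * θ' * (θ * s ^ 2 + s * s') := by
  classical
  have hL0 : 0 < L := by linarith
  have hs : 0 < s := hs'.trans_le hss
  set F := G'.filter (fun q => volume.real
    (patch L s (θ * s) ℓ z ∩ patch L s' (θ' * s') (ℓ' q) (z' q)) ≠ 0) with hF
  have hpt : ∀ q ∈ F, ∃ w, w ∈ patch L s (θ * s) ℓ z ∩ patch L s' (θ' * s') (ℓ' q) (z' q) :=
    fun q hq => exists_mem_of_measureReal_ne_zero (Finset.mem_filter.1 hq).2
  have hFG : ∀ q ∈ F, q ∈ G' := fun q hq => (Finset.mem_filter.1 hq).1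
  set r := s / s' with hr
  have hr1 : 1 ≤ r := by rw [hr, le_div_iff₀ hs']; linarith
  have hcard : (F.card : ℝ) ≤ (12 * L * r + 1 + 1) *
      (2 * L * θ * r + L * (6 * L + 1) + 6 * L + 1 + 1) := by
    refine card_le_of_fiber_abs_sub_le F (by positivity) (by positivity) ?_ ?_
    · intro i hi j hj
      obtain ⟨w, ⟨⟨-, hw1⟩, -⟩, ⟨-, hw2⟩, -⟩ := hpt i hi
      obtain ⟨w', ⟨⟨-, hw1'⟩, -⟩, ⟨-, hw2'⟩, -⟩ := hpt j hj
      refine (abs_sub_le_of_floor_eq hs' (hnet.snd_eq i (hFG i hi))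
        (hnet.snd_eq j (hFG j hj))).trans ?_
      have h1 : |(z' i).2 - (z' j).2| ≤ 12 * L * s := by
        have : 3 * L * s' ≤ 3 * L * s := by gcongr
        rw [abs_lt] at hw1 hw2 hw1' hw2'
        rw [abs_le]
        constructor <;> linarith
      have : 12 * L * s / s' = 12 * L * r := by rw [hr]; ring
      rw [← this]
      gcongr
    · intro i hi j hj hij
      obtain ⟨w, ⟨⟨-, hw1⟩, hw3⟩, ⟨hw4, hw2⟩, -⟩ := hpt i hi
      obtain ⟨w', ⟨⟨-, hw1'⟩, hw3'⟩, ⟨hw4', hw2'⟩, -⟩ := hpt j hj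
      refine (abs_sub_le_of_floor_eq hs' (hnet.fst_eq i (hFG i hi))
        (hnet.fst_eq j (hFG j hj))).trans ?_
      have h1 : |(z' i).2 - (z' j).2| ≤ s' :=
        abs_sub_le_of_floor_eq_floor hs' (by
          rw [hnet.snd_eq i (hFG i hi), hnet.snd_eq j (hFG j hj), hij])
      have h2 : |w.2 - w'.2| ≤ 6 * L * s' + s' := by
        rw [abs_lt] at hw2 hw2'
        rw [abs_le] at h1 ⊢
        constructor <;> linarith
      have h3 := abs_fst_sub_le hL0 h hw3' hw3
      have h4 : |w.1 - w'.1| ≤ L * (θ * s + θ * s + (6 * L * s' + s')) :=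
        h3.trans (by gcongr)
      have h5 : |(z' i).1 - (z' j).1| ≤ L * (θ * s + θ * s + (6 * L * s' + s')) + 6 * L * s' := by
        rw [abs_lt] at hw4 hw4'
        rw [abs_le] at h4 ⊢
        constructor <;> linarith
      have : (L * (θ * s + θ * s + (6 * L * s' + s')) + 6 * L * s') / s' + 1 =
          2 * L * θ * r + L * (6 * L + 1) + 6 * L + 1 := by
        rw [hr]; field_simp; ring
      rw [← this]
      gcongr
  have hcard2 : (F.card : ℝ) ≤ 210 * L ^ 3 * r * (θ * r + 1) := by
    refine hcard.trans ?_
    have hLL : L ≤ L ^ 2 := by nlinarith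
    have h1 : 12 * L * r + 1 + 1 ≤ 14 * L * r := by nlinarith
    have h2 : 2 * L * θ * r + L * (6 * L + 1) + 6 * L + 1 + 1 ≤ 15 * L ^ 2 * (θ * r + 1) := by
      have : L * (θ * r) ≤ L ^ 2 * (θ * r) := by gcongr
      have : 0 ≤ L ^ 2 * (θ * r) := by positivity
      nlinarith
    calc _ ≤ 14 * L * r * (15 * L ^ 2 * (θ * r + 1)) := by gcongr
      _ = _ := by ring
  calc _ = ∑ q ∈ F, volume.real
        (patch L s (θ * s) ℓ z ∩ patch L s' (θ' * s') (ℓ' q) (z' q)) :=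
        (Finset.sum_filter_ne_zero G').symm
    _ ≤ ∑ q ∈ F, 12 * L ^ 2 * θ' * s' ^ 2 := by
        refine Finset.sum_le_sum fun q hq => ?_
        have hb := hS' _ (hnet.mem q (hFG q hq))
        refine le_trans (measureReal_mono Set.inter_subset_right ?_)
          (volume_patch_le hL hs' hθ' hb)
        refine measure_ne_top_of_subset (s := Set.Icc ((z' q).1 - 3 * L * s')
          ((z' q).1 + 3 * L * s') ×ˢ Set.Icc ((z' q).2 - 3 * L * s') ((z' q).2 + 3 * L * s')) ?_
          (isCompact_Icc.prod isCompact_Icc).measure_ne_top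
        rintro w ⟨⟨h1, h2⟩, -⟩
        rw [abs_lt] at h1 h2
        exact ⟨⟨by linarith, by linarith⟩, by linarith, by linarith⟩
    _ = F.card * (12 * L ^ 2 * θ' * s' ^ 2) := by simp
    _ ≤ 210 * L ^ 3 * r * (θ * r + 1) * (12 * L ^ 2 * θ' * s' ^ 2) := by gcongr
    _ = _ := by rw [hr]; field_simp; ring

lemma sum_sum_volume_patch_inter_le {S : Set (ℝ × ℝ × ℝ)} {G : Finset (ℤ × ℤ)}
    {z : ℤ × ℤ → ℝ × ℝ} {ℓ : ℤ × ℤ → ℝ × ℝ × ℝ} {ρ : ℝ} (hL : 1 ≤ L) (hs' : 0 < s')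
    (hs : 0 < s) (hss : s' ≤ ρ * s) (hρ : ρ ≤ 1) (hθ : 0 ≤ θ) (hθ' : 0 ≤ θ')
    (hnet : IsNet L s S G z ℓ) (hS : ∀ ℓ ∈ S, Bdd L ℓ)
    (hG : G.card * s ^ 2 ≤ 9 * L ^ 2)
    (hnet' : IsNet L s' S' G' z' ℓ') (hS' : ∀ ℓ ∈ S', Bdd L ℓ) :
    ∑ q ∈ G, ∑ q' ∈ G',
      volume.real (patch L s (θ * s) (ℓ q) (z q) ∩ patch L s' (θ' * s') (ℓ' q') (z' q')) ≤
      22680 * L ^ 7 * (θ * θ' + θ' * ρ) := by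
  have hss' : s' ≤ s := hss.trans (mul_le_of_le_one_left hs.le hρ)
  have hL0 : 0 < L := by linarith
  calc _ ≤ ∑ q ∈ G, 2520 * L ^ 5 * θ' * (θ * s ^ 2 + s * s') :=
        Finset.sum_le_sum fun q hq => sum_volume_patch_inter_le hL hs' hss' hθ hθ'
          (hS _ (hnet.mem q hq)) hnet' hS'
    _ = G.card * (2520 * L ^ 5 * θ' * (θ * s ^ 2 + s * s')) := by simp
    _ ≤ G.card * (2520 * L ^ 5 * θ' * (θ * s ^ 2 + s * (ρ * s))) := by gcongr
    _ = G.card * s ^ 2 * (2520 * L ^ 5 * θ' * (θ + ρ)) := by ring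
    _ ≤ 9 * L ^ 2 * (2520 * L ^ 5 * θ' * (θ + ρ)) := by
        have : 0 ≤ ρ := by
          by_contra hcon
          nlinarith
        gcongr
    _ = _ := by ring

end scales

lemma le_volume_limsup {L κ : ℝ} {S : ℕ → Set (ℝ × ℝ × ℝ)} {s θ : ℕ → ℝ} (hL : 1 ≤ L)
    (hκ : 0 < κ) (hS : ∀ k, ∀ ℓ ∈ S k, Bdd L ℓ) (hs : ∀ k, 0 < s k)
    (hs1 : ∀ k, s k ≤ 1 / (32 * L ^ 2)) (hss : ∀ k k', k ≤ k' → s k' ≤ (1 / 2) ^ (k' - k) * s k)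
    (hcov : ∀ k, κ ≤ volume.real {z | z ∈ square L ∧ ∃ ℓ ∈ S k, z ∈ strip ℓ (s k)})
    (hθ0 : ∀ k, 0 ≤ θ k) (hθ1 : ∀ k, θ k ≤ 1) (hθ : ¬ Summable θ) (k₀ : ℕ) :
    8 * κ ^ 2 / (22680 * L ^ 7) ≤ volume.real {z | z ∈ bigSquare L ∧
      ∃ k, k₀ ≤ k ∧ ∃ ℓ ∈ S k, z ∈ strip ℓ (θ k * s k)} := by
  classical
  have hL0 : 0 < L := by linarith
  have hs1' : ∀ k, s k ≤ 1 := by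
    intro k
    refine (hs1 k).trans ?_
    rw [div_le_one (by positivity)]
    nlinarith
  choose G z ℓ hnet hGκ hGL using fun k => exists_isNet hL (hs k) (hs1' k) (hcov k)
  obtain ⟨n, hn⟩ : ∃ n, 4 ≤ ∑ k ∈ Finset.Ico k₀ n, θ k := by
    have hθ' : ¬ Summable fun k => θ (k + k₀) := by rwa [summable_nat_add_iff]
    obtain ⟨n, hn⟩ := ((not_summable_iff_tendsto_nat_atTop_of_nonneg
      (fun k => hθ0 (k + k₀))).1 hθ').eventually_ge_atTop 4 |>.exists
    refine ⟨n + k₀, ?_⟩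
    rw [Finset.sum_Ico_eq_sum_range, Nat.add_sub_cancel]
    simpa only [add_comm] using hn
  set I := Finset.Ico k₀ n with hI
  set Θ := ∑ k ∈ I, θ k with hΘ
  set P : (Σ _ : ℕ, ℤ × ℤ) → Set (ℝ × ℝ) := fun i =>
    patch L (s i.1) (θ i.1 * s i.1) (ℓ i.1 i.2) (z i.1 i.2) with hP
  set J : Finset (Σ _ : ℕ, ℤ × ℤ) := I.sigma (fun k => G k) with hJ
  have hPm : ∀ i, MeasurableSet (P i) := fun i => measurableSet_patch _ _ _ _ _
  have hPsub : ∀ i ∈ J, P i ⊆ bigSquare L := fun i hi => patch_subset_bigSquare hL (hs1 _)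
    ((hnet i.1).mem_square _ (Finset.mem_sigma.1 hi).2)
  have : IsFiniteMeasure (volume.restrict (bigSquare L)) :=
    ⟨by rw [Measure.restrict_apply_univ]; exact (volume_bigSquare_ne_top L).lt_top⟩
  have hμ : ∀ A ⊆ bigSquare L, MeasurableSet A →
      (volume.restrict (bigSquare L)).real A = volume.real A := by
    intro A hA hAm
    rw [measureReal_restrict_apply hAm, Set.inter_eq_left.2 hA]
  have hCE := sq_sum_measureReal_le (volume.restrict (bigSquare L)) J P (fun i _ => hPm i)
  rw [hμ _ (Set.iUnion₂_subset hPsub) (Finset.measurableSet_biUnion J fun i _ => hPm i)] at hCE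
  have hlow : 4 * κ * Θ ≤ ∑ i ∈ J, (volume.restrict (bigSquare L)).real (P i) := by
    rw [hJ, Finset.sum_sigma, hΘ, Finset.mul_sum]
    refine Finset.sum_le_sum fun k hk => ?_
    calc 4 * κ * θ k ≤ 4 * (G k).card * s k ^ 2 * θ k := by
          have := hGκ k
          have := hθ0 k
          nlinarith
      _ = ∑ q ∈ G k, 4 * θ k * s k ^ 2 := by
          rw [Finset.sum_const, nsmul_eq_mul]; ring
      _ ≤ _ := by
          refine Finset.sum_le_sum fun q hq => ?_
          rw [hμ _ (hPsub ⟨k, q⟩ (Finset.mem_sigma.2 ⟨hk, hq⟩)) (hPm _)]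
          exact le_volume_patch hL (hs k) (hs1 k) (hθ0 k) (hθ1 k) (hS k _ ((hnet k).mem q hq))
            ((hnet k).mem_square q hq) ((hnet k).mem_strip q hq)
  set O : ℕ → ℕ → ℝ := fun k k' => ∑ q ∈ G k, ∑ q' ∈ G k', volume.real
    (patch L (s k) (θ k * s k) (ℓ k q) (z k q) ∩
      patch L (s k') (θ k' * s k') (ℓ k' q') (z k' q')) with hO
  have hsymm : ∀ k k', O k k' = O k' k := by
    intro k k'
    simp only [hO]
    rw [Finset.sum_comm]
    simp only [Set.inter_comm]
  have hOle : ∀ k k', k ≤ k' → O k k' ≤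
      22680 * L ^ 7 * (θ k * θ k' + θ k' * (1 / 2) ^ (k' - k)) := fun k k' hkk =>
    sum_sum_volume_patch_inter_le hL (hs k') (hs k) (hss k k' hkk)
      (pow_le_one₀ (by norm_num) (by norm_num)) (hθ0 k) (hθ0 k') (hnet k) (hS k) (hGL k)
      (hnet k') (hS k')
  have hOle' : ∀ k k', O k k' ≤ 22680 * L ^ 7 * (θ k * θ k' +
      (θ k' * (if k ≤ k' then (1 / 2 : ℝ) ^ (k' - k) else 0) +
        θ k * (if k' ≤ k then (1 / 2 : ℝ) ^ (k - k') else 0))) := by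
    intro k k'
    rcases le_total k k' with h | h
    · refine (hOle k k' h).trans ?_
      rw [if_pos h]
      gcongr
      refine le_add_of_nonneg_right (mul_nonneg (hθ0 k) ?_)
      split_ifs <;> positivity
    · rw [hsymm]
      refine (hOle k' k h).trans ?_
      rw [if_pos h, mul_comm (θ k')]
      gcongr
      refine le_add_of_nonneg_left (mul_nonneg (hθ0 k') ?_)
      split_ifs <;> positivity
  have hup : ∑ i ∈ J, ∑ j ∈ J, (volume.restrict (bigSquare L)).real (P i ∩ P j) ≤
      22680 * L ^ 7 * (2 * Θ ^ 2) := by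
    have h1 : ∑ i ∈ J, ∑ j ∈ J, (volume.restrict (bigSquare L)).real (P i ∩ P j) =
        ∑ k ∈ I, ∑ k' ∈ I, O k k' := by
      have h2 : ∀ i ∈ J, ∀ j ∈ J, (volume.restrict (bigSquare L)).real (P i ∩ P j) =
          volume.real (P i ∩ P j) := fun i hi j _ =>
        hμ _ (Set.inter_subset_left.trans (hPsub i hi)) ((hPm i).inter (hPm j))
      rw [Finset.sum_congr rfl fun i hi => Finset.sum_congr rfl fun j hj => h2 i hi j hj]
      simp only [hJ, Finset.sum_sigma, hO]
      exact Finset.sum_congr rfl fun k _ => Finset.sum_comm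
    rw [h1]
    have h3 : ∑ k ∈ I, ∑ k' ∈ I, θ k' * (if k ≤ k' then (1 / 2 : ℝ) ^ (k' - k) else 0) ≤
        2 * Θ := by
      rw [Finset.sum_comm, hΘ, Finset.mul_sum]
      refine Finset.sum_le_sum fun k' _ => ?_
      rw [← Finset.mul_sum, mul_comm 2]
      refine mul_le_mul_of_nonneg_left ?_ (hθ0 k')
      rw [← Finset.sum_filter]
      have hinj : Set.InjOn (fun k => k' - k) (I.filter (fun k => k ≤ k') : Set ℕ) := by
        intro i hi j hj h
        simp only [Finset.coe_filter, Set.mem_ofPred_eq] at hi hj h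
        omega
      rw [← Finset.sum_image (f := fun i => (1 / 2 : ℝ) ^ i) hinj]
      exact (summable_geometric_two.sum_le_tsum _ (fun i _ => by positivity)).trans
        tsum_geometric_two.le
    have h5 : ∑ k ∈ I, ∑ k' ∈ I, θ k * (if k' ≤ k then (1 / 2 : ℝ) ^ (k - k') else 0) ≤
        2 * Θ := by
      rw [Finset.sum_comm]
      exact h3
    have h6 : ∑ k ∈ I, ∑ k' ∈ I, θ k * θ k' = Θ ^ 2 := by
      rw [sq, hΘ, Finset.sum_mul_sum]
    calc ∑ k ∈ I, ∑ k' ∈ I, O k k' ≤ ∑ k ∈ I, ∑ k' ∈ I, 22680 * L ^ 7 * (θ k * θ k' +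
      (θ k' * (if k ≤ k' then (1 / 2 : ℝ) ^ (k' - k) else 0) +
        θ k * (if k' ≤ k then (1 / 2 : ℝ) ^ (k - k') else 0))) :=
          Finset.sum_le_sum fun k _ => Finset.sum_le_sum fun k' _ => hOle' k k'
      _ = 22680 * L ^ 7 * (Θ ^ 2 +
        (∑ k ∈ I, ∑ k' ∈ I, θ k' * (if k ≤ k' then (1 / 2 : ℝ) ^ (k' - k) else 0) +
          ∑ k ∈ I, ∑ k' ∈ I, θ k * (if k' ≤ k then (1 / 2 : ℝ) ^ (k - k') else 0))) := by
          rw [← h6]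
          simp only [← Finset.mul_sum, Finset.sum_add_distrib]
      _ ≤ 22680 * L ^ 7 * (Θ ^ 2 + (2 * Θ + 2 * Θ)) := by gcongr
      _ ≤ _ := by
          gcongr
          nlinarith
  have hΘ0 : 0 < Θ := by linarith
  have hfin : 8 * κ ^ 2 / (22680 * L ^ 7) ≤ volume.real (⋃ i ∈ J, P i) := by
    rw [div_le_iff₀ (by positivity)]
    have h1 : (4 * κ * Θ) ^ 2 ≤
        volume.real (⋃ i ∈ J, P i) * (22680 * L ^ 7 * (2 * Θ ^ 2)) := by
      calc (4 * κ * Θ) ^ 2 ≤ _ := by gcongr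
        _ ≤ _ := hCE
        _ ≤ _ := by gcongr
    have h2 : 0 < 2 * Θ ^ 2 := by positivity
    refine le_of_mul_le_mul_right ?_ h2
    calc 8 * κ ^ 2 * (2 * Θ ^ 2) = (4 * κ * Θ) ^ 2 := by ring
      _ ≤ _ := h1
      _ = _ := by ring
  refine hfin.trans (measureReal_mono ?_
    (measure_ne_top_of_subset (fun z hz => hz.1) (volume_bigSquare_ne_top L)))
  intro w hw
  obtain ⟨i, hi, hwi⟩ := Set.mem_iUnion₂.1 hw
  obtain ⟨hi1, hi2⟩ := Finset.mem_sigma.1 hi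
  exact ⟨hPsub i hi hwi, i.1, (Finset.mem_Ico.1 hi1).1, ℓ i.1 i.2, (hnet i.1).mem _ hi2, hwi.2⟩

lemma term_le_of_two_pow_le {n m p k h : ℕ} (hp : 1 ≤ p) {ψ : ℕ → ℝ} (hψpos : ∀ q, 0 < ψ q)
    (hψanti : Antitone ψ) (hk : 2 ^ (n * m * p * k) ≤ h) :
    ψ h / (h : ℝ) ^ (1 - 1 / (p : ℝ)) ≤
      ψ (2 ^ (n * m * p * k)) * (2 : ℝ) ^ (n * m * k) / (2 : ℝ) ^ (n * m * p * k) := by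
  have hp' : (1 : ℝ) ≤ p := by exact_mod_cast hp
  have hp0 : (0 : ℝ) < p := by linarith
  have hexp : 0 ≤ 1 - 1 / (p : ℝ) := by
    rw [sub_nonneg, div_le_one hp0]; exact hp'
  have hH : (0 : ℝ) < (2 : ℝ) ^ (n * m * p * k) := by positivity
  have hkr : (2 : ℝ) ^ (n * m * p * k) ≤ h := by exact_mod_cast hk
  have e : ((2 : ℝ) ^ (n * m * p * k)) ^ (1 - 1 / (p : ℝ)) =
      (2 : ℝ) ^ (n * m * p * k) / (2 : ℝ) ^ (n * m * k) := by
    rw [Real.rpow_sub hH, Real.rpow_one]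
    congr 1
    have : (2 : ℝ) ^ (n * m * p * k) = ((2 : ℝ) ^ (n * m * k)) ^ p := by
      rw [← pow_mul]; congr 1; ring
    rw [this, one_div, Real.pow_rpow_inv_natCast (by positivity) (by omega)]
  calc ψ h / (h : ℝ) ^ (1 - 1 / (p : ℝ))
      ≤ ψ (2 ^ (n * m * p * k)) / ((2 : ℝ) ^ (n * m * p * k)) ^ (1 - 1 / (p : ℝ)) := by
        have := (hψpos (2 ^ (n * m * p * k))).le
        gcongr
        exact hψanti hk
    _ = _ := by rw [e, div_div_eq_mul_div]

lemma not_summable_dyadic {n m p : ℕ} (hn : 1 ≤ n) (hm : 1 ≤ m) (hp : 1 ≤ p)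
    {ψ : ℕ → ℝ} (hψpos : ∀ q, 0 < ψ q) (hψanti : Antitone ψ)
    (hdiv : ¬ Summable (fun ab : ℕ × ℕ =>
      ψ (max ((ab.1 + 1) ^ n) ((ab.2 + 1) ^ m)) /
        ((max ((ab.1 + 1) ^ n) ((ab.2 + 1) ^ m) : ℕ) : ℝ) ^ (1 - 1 / (p : ℝ)))) :
    ¬ Summable (fun k : ℕ => ψ (2 ^ (n * m * p * k)) *
      (2 : ℝ) ^ (m * p * k + n * p * k + n * m * k) / (2 : ℝ) ^ (n * m * p * k)) := by
  intro hg
  apply hdiv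
  set g : ℕ → ℝ := fun k => ψ (2 ^ (n * m * p * k)) *
      (2 : ℝ) ^ (m * p * k + n * p * k + n * m * k) / (2 : ℝ) ^ (n * m * p * k) with hgdef
  have hg0 : ∀ k, 0 ≤ g k := fun k => by
    have := hψpos (2 ^ (n * m * p * k))
    simp only [hgdef]; positivity
  set h : ℕ × ℕ → ℕ := fun ab => max ((ab.1 + 1) ^ n) ((ab.2 + 1) ^ m) with hh
  have hh1 : ∀ q, h q ≠ 0 := fun q => by
    have : 0 < (q.1 + 1) ^ n := by positivity
    simp only [hh]; omega
  have hM : n * m * p ≠ 0 := by positivity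
  have hB : 1 < 2 ^ (n * m * p) := Nat.one_lt_two_pow hM
  set κ : ℕ × ℕ → ℕ := fun q => Nat.log (2 ^ (n * m * p)) (h q) with hκ
  have hlow : ∀ q, 2 ^ (n * m * p * κ q) ≤ h q := fun q => by
    rw [pow_mul]; exact Nat.pow_log_le_self _ (hh1 q)
  have hupp : ∀ q, h q < 2 ^ (n * m * p * (κ q + 1)) := fun q => by
    rw [pow_mul]; exact Nat.lt_pow_succ_log_self hB _
  refine summable_of_sum_le (c := (2 : ℝ) ^ (m * p + n * p) * ∑' k, g k) ?_ ?_
  · intro q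
    exact div_nonneg (hψpos _).le (by positivity)
  intro u
  rw [← Finset.sum_fiberwise_of_maps_to (t := u.image κ) (g := κ)
    (fun q hq => Finset.mem_image_of_mem _ hq)]
  calc _ ≤ ∑ k ∈ u.image κ, (2 : ℝ) ^ (m * p + n * p) * g k := by
        refine Finset.sum_le_sum fun k _ => ?_
        have hcard : ((u.filter (fun q => κ q = k)).card : ℝ) ≤
            (2 : ℝ) ^ (m * p * (k + 1)) * 2 ^ (n * p * (k + 1)) := by
          have hsub : u.filter (fun q => κ q = k) ⊆
              Finset.range (2 ^ (m * p * (k + 1))) ×ˢ Finset.range (2 ^ (n * p * (k + 1))) := by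
            intro q hq
            rw [Finset.mem_filter] at hq
            have h1 := hupp q
            rw [hq.2] at h1
            rw [Finset.mem_product, Finset.mem_range, Finset.mem_range]
            constructor
            · have : (q.1 + 1) ^ n < (2 ^ (m * p * (k + 1))) ^ n := by
                rw [← pow_mul, show m * p * (k + 1) * n = n * m * p * (k + 1) by ring]
                exact (le_max_left _ _).trans_lt h1
              have := lt_of_pow_lt_pow_left₀ n (by positivity) this
              omega
            · have : (q.2 + 1) ^ m < (2 ^ (n * p * (k + 1))) ^ m := by
                rw [← pow_mul, show n * p * (k + 1) * m = n * m * p * (k + 1) by ring]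
                exact (le_max_right _ _).trans_lt h1
              have := lt_of_pow_lt_pow_left₀ m (by positivity) this
              omega
          have := Finset.card_le_card hsub
          rw [Finset.card_product, Finset.card_range, Finset.card_range] at this
          exact_mod_cast this
        have hψk := hψpos (2 ^ (n * m * p * k))
        calc _ ≤ ∑ q ∈ u.filter (fun q => κ q = k),
              ψ (2 ^ (n * m * p * k)) * (2 : ℝ) ^ (n * m * k) / (2 : ℝ) ^ (n * m * p * k) := by
              refine Finset.sum_le_sum fun q hq => ?_
              have h1 := hlow q
              rw [(Finset.mem_filter.mp hq).2] at h1
              exact term_le_of_two_pow_le hp hψpos hψanti h1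
          _ ≤ (2 : ℝ) ^ (m * p * (k + 1)) * 2 ^ (n * p * (k + 1)) *
              (ψ (2 ^ (n * m * p * k)) * (2 : ℝ) ^ (n * m * k) / (2 : ℝ) ^ (n * m * p * k)) := by
              rw [Finset.sum_const, nsmul_eq_mul]
              gcongr
          _ = _ := by
              simp only [hgdef, mul_add, pow_add, mul_one]
              ring
    _ ≤ _ := by
        rw [← Finset.mul_sum]
        gcongr
        exact hg.sum_le_tsum _ (fun k _ => hg0 k)

lemma dim_le_of_not_summable {n m p : ℕ} {ψ : ℕ → ℝ} (hψpos : ∀ q, 0 < ψ q)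
    (hψanti : Antitone ψ)
    (hg : ¬ Summable (fun k : ℕ => ψ (2 ^ (n * m * p * k)) *
      (2 : ℝ) ^ (m * p * k + n * p * k + n * m * k) / (2 : ℝ) ^ (n * m * p * k))) :
    n * m * p ≤ m * p + n * p + n * m := by
  by_contra hcon
  apply hg
  refine Summable.of_nonneg_of_le (f := fun k => ψ 0 * (1 / 2 : ℝ) ^ k) (fun k => ?_)
    (fun k => ?_) (Summable.mul_left _ summable_geometric_two)
  · have := hψpos (2 ^ (n * m * p * k))
    positivity
  · rw [mul_div_assoc]
    have h0 := (hψpos 0).le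
    have h1 := hψanti (Nat.zero_le (2 ^ (n * m * p * k)))
    gcongr
    rw [one_div, inv_pow, ← one_div, div_le_div_iff₀ (by positivity) (by positivity), one_mul,
      ← pow_add]
    refine pow_le_pow_right₀ one_le_two ?_
    nlinarith

lemma not_summable_min_one {g : ℕ → ℝ} (hg : ¬ Summable g) :
    ¬ Summable (fun k => min 1 (g k)) := by
  intro h
  apply hg
  have h1 := h.tendsto_atTop_zero.eventually (gt_mem_nhds zero_lt_one)
  refine (summable_congr_atTop ?_).mp h
  filter_upwards [h1] with k hk
  rcases min_lt_iff.mp hk with h | h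
  · exact absurd h (lt_irrefl _)
  · exact min_eq_right h.le

lemma not_summable_dilate {M r : ℕ} (hM : 1 ≤ M) {ψ : ℕ → ℝ} (hψpos : ∀ q, 0 < ψ q)
    (hψanti : Antitone ψ)
    (hg : ¬ Summable (fun k : ℕ => ψ (2 ^ (M * k)) * (2 : ℝ) ^ (r * k) / (2 : ℝ) ^ (M * k)))
    (C : ℕ) :
    ¬ Summable (fun k : ℕ => ψ (C * 2 ^ (M * k)) * (2 : ℝ) ^ (r * k) / (2 : ℝ) ^ (M * k)) := by
  intro h
  apply hg
  rw [← summable_nat_add_iff C]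
  refine Summable.of_nonneg_of_le (fun k => ?_) (fun k => ?_)
    (h.mul_left ((2 : ℝ) ^ (r * C) / 2 ^ (M * C)))
  · have := hψpos (2 ^ (M * (k + C)))
    positivity
  · have h1 : C * 2 ^ (M * k) ≤ 2 ^ (M * (k + C)) := by
      rw [mul_add, pow_add, mul_comm]
      gcongr
      exact Nat.lt_two_pow_self.le.trans
        (Nat.pow_le_pow_right two_pos (Nat.le_mul_of_pos_left C hM))
    calc _ ≤ ψ (C * 2 ^ (M * k)) * (2 : ℝ) ^ (r * (k + C)) / (2 : ℝ) ^ (M * (k + C)) := by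
          gcongr
          exact hψanti h1
      _ = _ := by
          rw [mul_add, mul_add, pow_add, pow_add]
          field_simp

/-- Points with positive coordinates having infinitely many approximations of quality
`ψ (C * max (a ^ n) (b ^ m)) / C`. -/
def approxSet (n m p : ℕ) (ψ : ℕ → ℝ) (C : ℕ) : Set (ℝ × ℝ) :=
  {z | 0 < z.1 ∧ 0 < z.2 ∧ {t : ℕ × ℕ × ℕ | 1 ≤ t.1 ∧ 1 ≤ t.2.1 ∧
    |(t.1 : ℝ) ^ n * z.1 + (t.2.1 : ℝ) ^ m * z.2 - (t.2.2 : ℝ) ^ p| <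
      ψ (C * max (t.1 ^ n) (t.2.1 ^ m)) / C}.Infinite}

lemma measurableSet_infinite_mem {α ι : Type*} [MeasurableSpace α] [Countable ι]
    {S : ι → Set α} (hS : ∀ i, MeasurableSet (S i)) :
    MeasurableSet {z | {i | z ∈ S i}.Infinite} := by
  have : {z | {i | z ∈ S i}.Infinite} = ⋂ F : Finset ι, ⋃ i : {i // i ∉ F}, S i := by
    ext z
    simp only [Set.mem_ofPred_eq, Set.mem_iInter, Set.mem_iUnion]
    constructor
    · intro h F
      obtain ⟨i, hi, hF⟩ := h.exists_notMem_finset F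
      exact ⟨⟨i, hF⟩, hi⟩
    · intro h hfin
      obtain ⟨⟨i, hi⟩, hz⟩ := h hfin.toFinset
      exact hi (by simpa using hz)
  rw [this]
  exact MeasurableSet.iInter fun F => MeasurableSet.iUnion fun i => hS i

lemma measurableSet_approxSet (n m p : ℕ) (ψ : ℕ → ℝ) (C : ℕ) :
    MeasurableSet (approxSet n m p ψ C) := by
  refine (measurableSet_lt measurable_const measurable_fst).inter
    ((measurableSet_lt measurable_const measurable_snd).inter
      (measurableSet_infinite_mem fun t => ?_))
  exact (MeasurableSet.const (1 ≤ t.1)).inter ((MeasurableSet.const (1 ≤ t.2.1)).inter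
    (measurableSet_lt (f := fun z : ℝ × ℝ =>
      |(t.1 : ℝ) ^ n * z.1 + (t.2.1 : ℝ) ^ m * z.2 - (t.2.2 : ℝ) ^ p|)
      (by fun_prop) measurable_const))

lemma width_eq (n m p k : ℕ) : width n m p k =
    1 / (32 * coeffBound n m p ^ 2) / (2 : ℝ) ^ ((m * p + n * p + n * m) * k) := by
  rw [width, div_div]
  push_cast
  rw [add_mul, add_mul, pow_add, pow_add]

/-- Relative width of the strips at level `k` for the approximation quality `ψ (C * ·) / C`. -/
noncomputable def relWidth (n m p : ℕ) (ψ : ℕ → ℝ) (C k : ℕ) : ℝ :=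
  min 1 (32 * coeffBound n m p ^ 2 / C * (ψ (C * 2 ^ (n * m * p * k)) *
    (2 : ℝ) ^ ((m * p + n * p + n * m) * k) / (2 : ℝ) ^ (n * m * p * k)))

/-- Points of the big square lying in a strip of level at least `k₀`. -/
def tailSet (n m p : ℕ) (ψ : ℕ → ℝ) (C k₀ : ℕ) : Set (ℝ × ℝ) :=
  {z | z ∈ bigSquare (coeffBound n m p) ∧ ∃ k, k₀ ≤ k ∧ ∃ ℓ ∈ lineSet n m p k,
    z ∈ strip ℓ (relWidth n m p ψ C k * width n m p k)}

lemma isOpen_strip (ℓ : ℝ × ℝ × ℝ) (s : ℝ) : IsOpen (strip ℓ s) :=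
  isOpen_lt (by fun_prop) continuous_const

lemma measurableSet_tailSet (n m p : ℕ) (ψ : ℕ → ℝ) (C k₀ : ℕ) :
    MeasurableSet (tailSet n m p ψ C k₀) := by
  have : tailSet n m p ψ C k₀ = bigSquare (coeffBound n m p) ∩
      ⋃ k, ⋃ (_ : k₀ ≤ k), ⋃ ℓ ∈ lineSet n m p k,
        strip ℓ (relWidth n m p ψ C k * width n m p k) := by
    ext z; simp [tailSet]
  rw [this]
  refine (measurableSet_bigSquare _).inter (IsOpen.measurableSet ?_)
  exact isOpen_iUnion fun k => isOpen_iUnion fun _ => isOpen_biUnion fun ℓ _ => isOpen_strip _ _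

lemma relWidth_nonneg {n m p : ℕ} {ψ : ℕ → ℝ} (hψpos : ∀ q, 0 < ψ q) (C k : ℕ) :
    0 ≤ relWidth n m p ψ C k := by
  have := hψpos (C * 2 ^ (n * m * p * k))
  refine le_min zero_le_one ?_
  positivity

lemma relWidth_anti {n m p : ℕ} {ψ : ℕ → ℝ} (hψpos : ∀ q, 0 < ψ q) (hψanti : Antitone ψ)
    {C C' : ℕ} (hC : 1 ≤ C) (h : C ≤ C') (k : ℕ) :
    relWidth n m p ψ C' k ≤ relWidth n m p ψ C k := by
  have hC0 : (0 : ℝ) < C := by exact_mod_cast hC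
  have := (hψpos (C' * 2 ^ (n * m * p * k))).le
  unfold relWidth
  gcongr
  exact hψanti (by gcongr)

lemma width_pos (n m p k : ℕ) : 0 < width n m p k := by
  have := one_le_coeffBound n m p
  rw [width_eq]
  positivity

lemma tailSet_subset {n m p : ℕ} {ψ : ℕ → ℝ} (hψpos : ∀ q, 0 < ψ q) (hψanti : Antitone ψ)
    {C C' k k' : ℕ} (hC : 1 ≤ C) (h : C ≤ C') (hk : k ≤ k') :
    tailSet n m p ψ C' k' ⊆ tailSet n m p ψ C k := by
  rintro z ⟨hz, i, hi, ℓ, hℓ, hs⟩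
  refine ⟨hz, i, hk.trans hi, ℓ, hℓ, ?_⟩
  rw [strip, Set.mem_ofPred_eq] at hs ⊢
  refine hs.trans_le ?_
  have := (width_pos n m p i).le
  gcongr
  exact relWidth_anti hψpos hψanti hC h i

lemma exists_approx_of_mem_strip {n m p : ℕ} {ψ : ℕ → ℝ}
    (hψanti : Antitone ψ) {C k : ℕ} (hC : 1 ≤ C) {ℓ : ℝ × ℝ × ℝ} (hℓ : ℓ ∈ lineSet n m p k)
    {z : ℝ × ℝ} (hz : z ∈ strip ℓ (relWidth n m p ψ C k * width n m p k)) :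
    ∃ a b c : ℕ, 1 ≤ a ∧ 1 ≤ b ∧ 2 ^ (m * p * k) ≤ 16 * a ∧
      |(a : ℝ) ^ n * z.1 + (b : ℝ) ^ m * z.2 - (c : ℝ) ^ p| < ψ (C * max (a ^ n) (b ^ m)) / C := by
  obtain ⟨a, b, c, ⟨ha1, ha2, ha3⟩, ⟨hb1, hb2, -⟩, -, rfl⟩ := hℓ
  refine ⟨a, b, c, ha1, hb1, ha3, ?_⟩
  have hC0 : (0 : ℝ) < C := by exact_mod_cast hC
  have hL := one_le_coeffBound n m p
  set H : ℝ := (2 : ℝ) ^ (n * m * p * k) with hH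
  have hH0 : 0 < H := by positivity
  have eX : (((2 ^ (m * p * k) : ℕ) : ℝ)) ^ n = H := by
    push_cast; rw [← pow_mul, hH]; congr 1; ring
  have eY : (((2 ^ (n * p * k) : ℕ) : ℝ)) ^ m = H := by
    push_cast; rw [← pow_mul, hH]; congr 1; ring
  have eZ : (((2 ^ (n * m * k) : ℕ) : ℝ)) ^ p = H := by
    push_cast; rw [← pow_mul, hH]; congr 1; ring
  simp only [strip, Set.mem_ofPred_eq, div_pow, eX, eY, eZ] at hz
  have e : (a : ℝ) ^ n / H * z.1 + (b : ℝ) ^ m / H * z.2 - (c : ℝ) ^ p / H =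
      ((a : ℝ) ^ n * z.1 + (b : ℝ) ^ m * z.2 - (c : ℝ) ^ p) / H := by ring
  rw [e, abs_div, abs_of_pos hH0, div_lt_iff₀ hH0] at hz
  refine hz.trans_le ?_
  have hle : max (a ^ n) (b ^ m) ≤ 2 ^ (n * m * p * k) := by
    refine max_le ?_ ?_
    · calc a ^ n ≤ (2 ^ (m * p * k)) ^ n := by gcongr
        _ = _ := by rw [← pow_mul]; congr 1; ring
    · calc b ^ m ≤ (2 ^ (n * p * k)) ^ m := by gcongr
        _ = _ := by rw [← pow_mul]; congr 1; ring
  calc relWidth n m p ψ C k * width n m p k * H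
      ≤ (32 * coeffBound n m p ^ 2 / C * (ψ (C * 2 ^ (n * m * p * k)) *
          (2 : ℝ) ^ ((m * p + n * p + n * m) * k) / H)) * width n m p k * H := by
        have := (width_pos n m p k).le
        gcongr
        exact min_le_right _ _
    _ = ψ (C * 2 ^ (n * m * p * k)) / C := by
        rw [width_eq]
        field_simp
    _ ≤ _ := by
        gcongr
        exact hψanti (by gcongr)

lemma iInter_tailSet_subset {n m p : ℕ} (hm : 1 ≤ m) (hp : 1 ≤ p) {ψ : ℕ → ℝ}
    (hψpos : ∀ q, 0 < ψ q) (hψanti : Antitone ψ) :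
    ⋂ j, tailSet n m p ψ (j + 1) j ⊆ ⋂ C, approxSet n m p ψ (C + 1) := by
  intro z hz
  rw [Set.mem_iInter] at hz ⊢
  have hL := one_le_coeffBound n m p
  intro C
  have hsq := (hz 0).1
  have hpos : 0 < 1 / (8 * coeffBound n m p) := by positivity
  refine ⟨hpos.trans_le hsq.1.1, hpos.trans_le hsq.2.1, fun hfin => ?_⟩
  obtain ⟨B, hB⟩ := (hfin.image Prod.fst).bddAbove
  obtain ⟨-, k, hk, ℓ, hℓ, hs⟩ := tailSet_subset hψpos hψanti (Nat.le_add_left 1 C)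
    (show C + 1 ≤ (C + 16 * B) + 1 by omega) (show 16 * B ≤ C + 16 * B by omega)
    (hz (C + 16 * B))
  obtain ⟨a, b, c, ha, hb, hak, hlt⟩ :=
    exists_approx_of_mem_strip hψanti (Nat.le_add_left 1 C) hℓ hs
  have haB : a ≤ B := hB ⟨(a, b, c), ⟨ha, hb, hlt⟩, rfl⟩
  have h1 : k < 2 ^ k := Nat.lt_two_pow_self
  have h2 : 2 ^ k ≤ 2 ^ (m * p * k) :=
    Nat.pow_le_pow_right two_pos (Nat.le_mul_of_pos_left k (Nat.mul_pos hm hp))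
  omega

lemma exists_le_volume_tailSet {n m p : ℕ} (hn : 1 ≤ n) (hm : 1 ≤ m) (hp : 1 ≤ p)
    (hcase : (n = 1 ∧ m = 1) ∨ 2 ≤ Nat.gcd n m) {ψ : ℕ → ℝ} (hψpos : ∀ q, 0 < ψ q)
    (hψanti : Antitone ψ)
    (hdiv : ¬ Summable (fun ab : ℕ × ℕ =>
      ψ (max ((ab.1 + 1) ^ n) ((ab.2 + 1) ^ m)) /
        ((max ((ab.1 + 1) ^ n) ((ab.2 + 1) ^ m) : ℕ) : ℝ) ^ (1 - 1 / (p : ℝ)))) :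
    ∃ κ > 0, ∀ C k₀, 1 ≤ C → κ ≤ volume.real (tailSet n m p ψ C k₀) := by
  have hg := not_summable_dyadic hn hm hp hψpos hψanti hdiv
  have hdim := dim_le_of_not_summable hψpos hψanti hg
  obtain ⟨κ, hκ, hcov⟩ := covers hn hm hp hcase hdim
  have hL := one_le_coeffBound n m p
  have hr : 1 ≤ m * p + n * p + n * m := by nlinarith
  have hg' : ¬ Summable (fun k : ℕ => ψ (2 ^ (n * m * p * k)) *
      (2 : ℝ) ^ ((m * p + n * p + n * m) * k) / (2 : ℝ) ^ (n * m * p * k)) := by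
    simpa only [add_mul] using hg
  refine ⟨8 * κ ^ 2 / (22680 * coeffBound n m p ^ 7), by positivity, fun C k₀ hC => ?_⟩
  have hC0 : (0 : ℝ) < C := by exact_mod_cast hC
  refine le_volume_limsup hL hκ (fun k ℓ hℓ => bdd_of_mem_lineSet hℓ) (width_pos n m p) ?_ ?_
    hcov (relWidth_nonneg hψpos C) (fun k => min_le_left _ _) ?_ k₀
  · intro k
    rw [width_eq]
    exact div_le_self (by positivity) (one_le_pow₀ one_le_two)
  · intro k k' hk
    obtain ⟨d, rfl⟩ := Nat.exists_eq_add_of_le hk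
    rw [width_eq, width_eq, mul_add, pow_add, Nat.add_sub_cancel_left, one_div_pow]
    have h1 : (2 : ℝ) ^ d ≤ 2 ^ ((m * p + n * p + n * m) * d) :=
      pow_le_pow_right₀ one_le_two (Nat.le_mul_of_pos_left d hr)
    calc _ ≤ 1 / (32 * coeffBound n m p ^ 2) /
          ((2 : ℝ) ^ ((m * p + n * p + n * m) * k) * 2 ^ d) := by gcongr
      _ = _ := by field_simp
  · refine not_summable_min_one fun h => ?_
    refine not_summable_dilate (Nat.mul_pos (Nat.mul_pos hn hm) hp) hψpos hψanti hg' C ?_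
    exact (summable_mul_left_iff (ne_of_gt (by positivity))).mp h

lemma volume_iInter_approxSet_ne_zero {n m p : ℕ} (hn : 1 ≤ n) (hm : 1 ≤ m) (hp : 1 ≤ p)
    (hcase : (n = 1 ∧ m = 1) ∨ 2 ≤ Nat.gcd n m) {ψ : ℕ → ℝ} (hψpos : ∀ q, 0 < ψ q)
    (hψanti : Antitone ψ)
    (hdiv : ¬ Summable (fun ab : ℕ × ℕ =>
      ψ (max ((ab.1 + 1) ^ n) ((ab.2 + 1) ^ m)) /
        ((max ((ab.1 + 1) ^ n) ((ab.2 + 1) ^ m) : ℕ) : ℝ) ^ (1 - 1 / (p : ℝ)))) :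
    volume (⋂ C, approxSet n m p ψ (C + 1)) ≠ 0 := by
  obtain ⟨κ, hκ, h⟩ := exists_le_volume_tailSet hn hm hp hcase hψpos hψanti hdiv
  have hfin : ∀ j, volume (tailSet n m p ψ (j + 1) j) ≠ ⊤ := fun j =>
    measure_ne_top_of_subset (fun z hz => hz.1) (volume_bigSquare_ne_top _)
  have hlim := tendsto_measure_iInter_atTop (μ := volume)
    (s := fun j => tailSet n m p ψ (j + 1) j)
    (fun j => (measurableSet_tailSet n m p ψ (j + 1) j).nullMeasurableSet)
    (fun i j hij => tailSet_subset hψpos hψanti (by omega) (by omega) hij) ⟨0, hfin 0⟩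
  have hge : ENNReal.ofReal κ ≤ volume (⋂ j, tailSet n m p ψ (j + 1) j) := by
    refine ge_of_tendsto' hlim fun j => ?_
    exact (ENNReal.ofReal_le_iff_le_toReal (hfin j)).mpr (h (j + 1) j (by omega))
  have := (hge.trans (measure_mono (iInter_tailSet_subset hm hp hψpos hψanti)))
  exact (lt_of_lt_of_le (ENNReal.ofReal_pos.mpr hκ) this).ne'

lemma preimage_add_ae_le_of_dense {E : Set (ℝ × ℝ)} (hE : MeasurableSet E)
    (hd : Dense {g : ℝ × ℝ | (g + ·) ⁻¹' E = E}) (g : ℝ × ℝ) :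
    volume ((g + ·) ⁻¹' E \ E) = 0 := by
  have hcover : (g + ·) ⁻¹' E \ E ⊆
      ⋃ R : ℕ, (g + ·) ⁻¹' (E ∩ Metric.ball 0 R) \ E := by
    rintro w ⟨h1, h2⟩
    obtain ⟨R, hR⟩ := exists_nat_gt ‖g + w‖
    exact Set.mem_iUnion.mpr ⟨R, ⟨h1, by simpa using hR⟩, h2⟩
  refine measure_mono_null hcover (measure_iUnion_null fun R => ?_)
  set F := E ∩ Metric.ball 0 (R : ℝ) with hF
  have hFm : MeasurableSet F := hE.inter measurableSet_ball
  have hFfin : volume F ≠ ⊤ := measure_ne_top_of_subset Set.inter_subset_right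
    measure_ball_lt_top.ne
  let f : C((ℝ × ℝ) × (ℝ × ℝ), ℝ × ℝ) := ⟨fun q => q.1 + q.2, by fun_prop⟩
  have htend : Filter.Tendsto f.curry (nhdsWithin g {g : ℝ × ℝ | (g + ·) ⁻¹' E = E})
      (nhds (f.curry g)) := (f.curry.continuous.tendsto g).mono_left nhdsWithin_le_nhds
  have hlim := tendsto_measure_symmDiff_preimage_nhds_zero (μ := volume) (ν := volume) htend
    (Filter.Eventually.of_forall fun h => measurePreserving_add_left volume h)
    (measurePreserving_add_left volume g) hFm.nullMeasurableSet hFfin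
  have : (nhdsWithin g {g : ℝ × ℝ | (g + ·) ⁻¹' E = E}).NeBot :=
    mem_closure_iff_nhdsWithin_neBot.mp (hd g)
  refine le_antisymm (ge_of_tendsto hlim ?_) zero_le
  filter_upwards [self_mem_nhdsWithin] with h hh
  refine measure_mono ?_
  rintro w ⟨h1, h2⟩
  refine Or.inr ⟨h1, fun h3 => h2 ?_⟩
  rw [← show (h + ·) ⁻¹' E = E from hh]
  exact h3.1

lemma volume_eq_zero_or_compl_of_dense {E : Set (ℝ × ℝ)} (hE : MeasurableSet E)
    (hd : Dense {g : ℝ × ℝ | (g + ·) ⁻¹' E = E}) : volume E = 0 ∨ volume Eᶜ = 0 := by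
  have hae : ∀ g : ℝ × ℝ, (g +ᵥ ·) ⁻¹' E =ᵐ[volume] E := fun g => by
    refine Filter.EventuallyLE.antisymm
      (ae_le_set.mpr (preimage_add_ae_le_of_dense hE hd g)) (ae_le_set.mpr ?_)
    have h := preimage_add_ae_le_of_dense hE hd (-g)
    rw [← measure_preimage_add volume g] at h
    refine measure_mono_null ?_ h
    rintro w ⟨h1, h2⟩
    exact ⟨by simpa using h1, h2⟩
  have hconst := aeconst_of_forall_preimage_vadd_ae_eq (ℝ × ℝ) hE.nullMeasurableSet hae
  rcases Filter.eventuallyConst_set.mp hconst with h | h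
  · exact Or.inr (mem_ae_iff.mp h)
  · exact Or.inl (measure_eq_zero_iff_ae_notMem.mpr h)

lemma dense_mul_log_rat {M : ℕ} (hM : 1 ≤ M) :
    Dense {x : ℝ | ∃ s t : ℕ, 1 ≤ s ∧ 1 ≤ t ∧ x = M * Real.log ((s : ℝ) / t)} := by
  have hM0 : (0 : ℝ) < M := by exact_mod_cast hM
  refine dense_of_exists_between fun a b hab => ?_
  obtain ⟨q, hq1, hq2⟩ := exists_rat_btwn (Real.exp_lt_exp.mpr (div_lt_div_of_pos_right hab hM0))
  have hq0 : (0 : ℝ) < q := (Real.exp_pos _).trans hq1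
  have hq0' : 0 < q := by exact_mod_cast hq0
  have hnum : 0 < q.num := Rat.num_pos.mpr hq0'
  have hcast : (q : ℝ) = (q.num.toNat : ℝ) / q.den := by
    have : ((q.num.toNat : ℕ) : ℝ) = (q.num : ℝ) := by
      exact_mod_cast congrArg (Int.cast (R := ℝ)) (Int.toNat_of_nonneg hnum.le)
    rw [this, Rat.cast_def]
  refine ⟨M * Real.log q, ⟨q.num.toNat, q.den, by omega, q.den_pos, by rw [← hcast]⟩, ?_, ?_⟩
  · rw [← div_lt_iff₀' hM0]
    exact (Real.lt_log_iff_exp_lt hq0).mpr hq1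
  · rw [← lt_div_iff₀' hM0]
    exact (Real.log_lt_iff_lt_exp hq0).mpr hq2

lemma mem_iInter_approxSet_of_scale {n m p : ℕ} {ψ : ℕ → ℝ} (hψpos : ∀ q, 0 < ψ q)
    (hψanti : Antitone ψ) {α β γ : ℕ} (hα : 1 ≤ α) (hβ : 1 ≤ β) (hγ : 1 ≤ γ) {z z' : ℝ × ℝ}
    (h1 : (α : ℝ) ^ n * z'.1 = (γ : ℝ) ^ p * z.1) (h2 : (β : ℝ) ^ m * z'.2 = (γ : ℝ) ^ p * z.2)
    (hz : z ∈ ⋂ C, approxSet n m p ψ (C + 1)) : z' ∈ ⋂ C, approxSet n m p ψ (C + 1) := by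
  rw [Set.mem_iInter] at hz ⊢
  intro C'
  set C := C' + 1 with hCdef
  have hγ0 : (0 : ℝ) < γ := by exact_mod_cast hγ
  have hα0 : (0 : ℝ) < α := by exact_mod_cast hα
  have hβ0 : (0 : ℝ) < β := by exact_mod_cast hβ
  set K := α ^ n * β ^ m * γ ^ p with hK
  have hK1 : 1 ≤ K := Nat.mul_pos (Nat.mul_pos (by positivity) (by positivity)) (by positivity)
  have hKC : 1 ≤ K * C := Nat.mul_pos hK1 (by omega)
  have hKn : K ≥ γ ^ p := Nat.le_mul_of_pos_left _ (by positivity)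
  obtain ⟨hx, hy, hinf⟩ := hz (K * C - 1)
  rw [Nat.sub_add_cancel hKC] at hinf
  have hx' : 0 < z'.1 := by
    have : 0 < (α : ℝ) ^ n * z'.1 := by rw [h1]; positivity
    exact pos_of_mul_pos_right this (by positivity)
  have hy' : 0 < z'.2 := by
    have : 0 < (β : ℝ) ^ m * z'.2 := by rw [h2]; positivity
    exact pos_of_mul_pos_right this (by positivity)
  refine ⟨hx', hy', ?_⟩
  have hinj : Function.Injective (fun t : ℕ × ℕ × ℕ => (α * t.1, β * t.2.1, γ * t.2.2)) := by
    rintro ⟨a, b, c⟩ ⟨a', b', c'⟩ h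
    simp only [Prod.mk.injEq] at h
    rw [Nat.eq_of_mul_eq_mul_left hα h.1, Nat.eq_of_mul_eq_mul_left hβ h.2.1,
      Nat.eq_of_mul_eq_mul_left hγ h.2.2]
  refine (hinf.image hinj.injOn).mono ?_
  rintro _ ⟨⟨a, b, c⟩, ⟨ha, hb, hlt⟩, rfl⟩
  refine ⟨Nat.mul_pos hα ha, Nat.mul_pos hβ hb, ?_⟩
  simp only at hlt ⊢
  have e : ((α * a : ℕ) : ℝ) ^ n * z'.1 + ((β * b : ℕ) : ℝ) ^ m * z'.2 - ((γ * c : ℕ) : ℝ) ^ p =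
      (γ : ℝ) ^ p * ((a : ℝ) ^ n * z.1 + (b : ℝ) ^ m * z.2 - (c : ℝ) ^ p) := by
    push_cast
    rw [mul_pow, mul_pow, mul_pow]
    linear_combination (a : ℝ) ^ n * h1 + (b : ℝ) ^ m * h2
  rw [e, abs_mul, abs_of_pos (pow_pos hγ0 p)]
  have hC0 : (0 : ℝ) < C := by rw [hCdef]; positivity
  have hmax : max ((α * a) ^ n) ((β * b) ^ m) ≤ K * max (a ^ n) (b ^ m) := by
    refine max_le ?_ ?_
    · rw [mul_pow]
      refine Nat.mul_le_mul ?_ (le_max_left _ _)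
      rw [hK, mul_assoc]
      exact Nat.le_mul_of_pos_right _ (by positivity)
    · rw [mul_pow]
      refine Nat.mul_le_mul ?_ (le_max_right _ _)
      rw [hK, mul_comm (α ^ n), mul_assoc]
      exact Nat.le_mul_of_pos_right _ (by positivity)
  have hKr : (γ : ℝ) ^ p ≤ K := by exact_mod_cast hKn
  have hK0 : (0 : ℝ) < K := by exact_mod_cast hK1
  calc (γ : ℝ) ^ p * |(a : ℝ) ^ n * z.1 + (b : ℝ) ^ m * z.2 - (c : ℝ) ^ p|
      < (γ : ℝ) ^ p * (ψ (K * C * max (a ^ n) (b ^ m)) / ((K * C : ℕ) : ℝ)) := by gcongr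
    _ ≤ K * (ψ (K * C * max (a ^ n) (b ^ m)) / ((K * C : ℕ) : ℝ)) := by
        have := (hψpos (K * C * max (a ^ n) (b ^ m))).le
        gcongr
    _ = ψ (K * C * max (a ^ n) (b ^ m)) / C := by
        push_cast
        field_simp
    _ ≤ _ := by
        gcongr
        refine hψanti ?_
        rw [mul_comm K C, mul_assoc]
        gcongr

lemma mem_iInter_approxSet_of_rat {n m p : ℕ} {ψ : ℕ → ℝ} (hψpos : ∀ q, 0 < ψ q)
    (hψanti : Antitone ψ) {s t s' t' : ℕ} (hs : 1 ≤ s) (ht : 1 ≤ t) (hs' : 1 ≤ s') (ht' : 1 ≤ t')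
    {z : ℝ × ℝ} (hz : z ∈ ⋂ C, approxSet n m p ψ (C + 1)) :
    (((s : ℝ) / t) ^ (n * m * p) * z.1, ((s' : ℝ) / t') ^ (n * m * p) * z.2) ∈
      ⋂ C, approxSet n m p ψ (C + 1) := by
  have ht0 : (t : ℝ) ≠ 0 := by positivity
  have ht0' : (t' : ℝ) ≠ 0 := by positivity
  refine mem_iInter_approxSet_of_scale hψpos hψanti (α := (s' * t) ^ (m * p))
    (β := (s * t') ^ (n * p)) (γ := (s * s') ^ (n * m)) (Nat.pow_pos (Nat.mul_pos hs' ht))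
    (Nat.pow_pos (Nat.mul_pos hs ht')) (Nat.pow_pos (Nat.mul_pos hs hs')) ?_ ?_ hz
  · push_cast
    rw [← pow_mul, ← pow_mul, show m * p * n = n * m * p by ring, ← mul_assoc, ← mul_pow]
    congr 2
    field_simp
  · push_cast
    rw [← pow_mul, ← pow_mul, show n * p * m = n * m * p by ring, ← mul_assoc, ← mul_pow]
    congr 2
    field_simp

lemma volume_compl_iInter_approxSet {n m p : ℕ} (hn : 1 ≤ n) (hm : 1 ≤ m) (hp : 1 ≤ p)
    {ψ : ℕ → ℝ} (hψpos : ∀ q, 0 < ψ q) (hψanti : Antitone ψ)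
    (h0 : volume (⋂ C, approxSet n m p ψ (C + 1)) ≠ 0) :
    volume {z : ℝ × ℝ | 0 < z.1 ∧ 0 < z.2 ∧ z ∉ ⋂ C, approxSet n m p ψ (C + 1)} = 0 := by
  set U := ⋂ C, approxSet n m p ψ (C + 1) with hU
  set e : ℝ × ℝ → ℝ × ℝ := fun w => (Real.exp w.1, Real.exp w.2) with he
  have hed : Differentiable ℝ e := by fun_prop
  have hUm : MeasurableSet U := MeasurableSet.iInter fun C => measurableSet_approxSet _ _ _ _ _
  have hEm : MeasurableSet (e ⁻¹' U) := hUm.preimage hed.continuous.measurable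
  have hM : 1 ≤ n * m * p := Nat.mul_pos (Nat.mul_pos hn hm) hp
  have hmem : ∀ s t s' t' : ℕ, 1 ≤ s → 1 ≤ t → 1 ≤ s' → 1 ≤ t' → ∀ w,
      e w ∈ U → e ((((n * m * p : ℕ) : ℝ) * Real.log ((s : ℝ) / t),
        ((n * m * p : ℕ) : ℝ) * Real.log ((s' : ℝ) / t')) + w) ∈ U := by
    intro s t s' t' hs ht hs' ht' w hw
    have h := mem_iInter_approxSet_of_rat hψpos hψanti hs ht hs' ht' hw
    have e1 : ∀ (a b : ℕ) (x : ℝ), 1 ≤ a → 1 ≤ b →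
        Real.exp (((n * m * p : ℕ) : ℝ) * Real.log ((a : ℝ) / b) + x) =
          ((a : ℝ) / b) ^ (n * m * p) * Real.exp x := by
      intro a b x ha hb
      rw [Real.exp_add, Real.exp_nat_mul, Real.exp_log (by positivity)]
    simpa only [he, Prod.fst_add, Prod.snd_add, e1 _ _ _ hs ht, e1 _ _ _ hs' ht'] using h
  have hdense : Dense {g : ℝ × ℝ | (g + ·) ⁻¹' (e ⁻¹' U) = e ⁻¹' U} := by
    refine ((dense_mul_log_rat hM).prod (dense_mul_log_rat hM)).mono ?_
    rintro ⟨g, g'⟩ ⟨⟨s, t, hs, ht, hg⟩, ⟨s', t', hs', ht', hg'⟩⟩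
    simp only at hg hg'
    ext w
    refine ⟨fun h => ?_, fun h => ?_⟩
    · have := hmem t s t' s' ht hs ht' hs' _ h
      rw [← inv_div (s : ℝ), ← inv_div (s' : ℝ), Real.log_inv, Real.log_inv, mul_neg, mul_neg,
        ← hg, ← hg', ← Prod.neg_mk, neg_add_cancel_left] at this
      exact this
    · have := hmem s t s' t' hs ht hs' ht' _ h
      rw [← hg, ← hg'] at this
      exact this
  rcases volume_eq_zero_or_compl_of_dense hEm hdense with h | h
  · refine absurd (measure_mono_null ?_
      (addHaar_image_eq_zero_of_differentiableOn_of_addHaar_eq_zero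
        volume hed.differentiableOn h)) h0
    intro z hz
    have hz' := Set.mem_iInter.mp hz 0
    have : e (Real.log z.1, Real.log z.2) = z := by
      simp only [he, Real.exp_log hz'.1, Real.exp_log hz'.2.1]
    exact ⟨_, by rw [Set.mem_preimage, this]; exact hz, this⟩
  · refine measure_mono_null ?_ (addHaar_image_eq_zero_of_differentiableOn_of_addHaar_eq_zero
      volume hed.differentiableOn h)
    rintro z ⟨hx, hy, hz⟩
    have : e (Real.log z.1, Real.log z.2) = z := by
      simp only [he, Real.exp_log hx, Real.exp_log hy]
    exact ⟨_, by rw [Set.mem_compl_iff, Set.mem_preimage, this]; exact hz, this⟩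

theorem stmt6 (n m p : ℕ) (hn : 1 ≤ n) (hm : 1 ≤ m) (hp : 1 ≤ p)
    (hcase : (n = 1 ∧ m = 1) ∨ 2 ≤ Nat.gcd n m)
    (ψ : ℕ → ℝ) (hψpos : ∀ q, 0 < ψ q) (hψanti : Antitone ψ)
    (hdiv : ¬ Summable (fun ab : ℕ × ℕ =>
      ψ (max ((ab.1 + 1) ^ n) ((ab.2 + 1) ^ m)) /
        ((max ((ab.1 + 1) ^ n) ((ab.2 + 1) ^ m) : ℕ) : ℝ) ^ (1 - 1 / (p : ℝ)))) :
    volume {xy : ℝ × ℝ | xy.1 ∈ Set.Ico (0 : ℝ) 1 ∧ xy.2 ∈ Set.Ico (0 : ℝ) 1 ∧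
      {abc : ℕ × ℕ × ℕ | 1 ≤ abc.1 ∧ 1 ≤ abc.2.1 ∧
        |(abc.1 : ℝ) ^ n * xy.1 + (abc.2.1 : ℝ) ^ m * xy.2 - (abc.2.2 : ℝ) ^ p| <
          ψ (max (abc.1 ^ n) (abc.2.1 ^ m))}.Infinite} = 1 := by
  have hnull := volume_compl_iInter_approxSet hn hm hp hψpos hψanti
    (volume_iInter_approxSet_ne_zero hn hm hp hcase hψpos hψanti hdiv)
  refine le_antisymm ?_ ?_
  · calc _ ≤ volume (Set.Ico (0 : ℝ) 1 ×ˢ Set.Ico (0 : ℝ) 1) :=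
          measure_mono fun z hz => ⟨hz.1, hz.2.1⟩
      _ = 1 := by simp [Measure.volume_eq_prod, Measure.prod_prod]
  · rw [← add_zero (volume _), ← hnull]
    refine le_trans ?_ (measure_union_le _ _)
    calc (1 : ENNReal) = volume (Set.Ioo (0 : ℝ) 1 ×ˢ Set.Ioo (0 : ℝ) 1) := by
          simp [Measure.volume_eq_prod, Measure.prod_prod]
      _ ≤ _ := by
          refine measure_mono fun z hz => ?_
          by_cases h : z ∈ ⋂ C, approxSet n m p ψ (C + 1)
          · refine Or.inl ⟨Set.Ioo_subset_Ico_self hz.1, Set.Ioo_subset_Ico_self hz.2, ?_⟩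
            simpa using (Set.mem_iInter.mp h 0).2.2
          · exact Or.inr ⟨hz.1.1, hz.2.1, h⟩
end

section
/- Fix natural numbers n, m, p and a decreasing positive function ψ. Let 𝒩 = {(a,b) ∈ ℕ² : gcd(a,b)=1 and 1/2 < aⁿ/bᵐ < 2}. Then ∑_{(a,b)∈ℕ²} ψ(h_{a,b})/h_{a,b}^{1−1/p} = ∞ if and only if ∑_{(a,b)∈𝒩} ψ(h_{a,b})/h_{a,b}^{1−1/p} = ∞, where h_{a,b} = max(aⁿ, bᵐ). -/
open Finset in
theorem card_filter_dvd_Ioc_le (x A : ℕ) {d : ℕ} (hd : 0 < d) :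
    (#{y ∈ Ioc x (x + A) | d ∣ y} : ℝ) ≤ A / d + 1 := by
  have h := Nat.Ioc_filter_modEq_card x (x + A) hd 0
  simp only [Nat.modEq_zero_iff_dvd] at h
  have hfloor : (#{y ∈ Ioc x (x + A) | d ∣ y} : ℚ) ≤ A / d + 1 := by
    rw [← Int.cast_natCast (R := ℚ) #_, h]
    push_cast
    refine max_le ?_ (by positivity)
    have h1 := Int.floor_le (((x : ℚ) + A - 0) / d)
    have h2 := Int.lt_floor_add_one (((x : ℚ) - 0) / d)
    have h3 : ((x : ℚ) + A - 0) / d = (x - 0) / d + A / d := by ring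
    linarith
  have hcast := (Rat.cast_le (K := ℝ)).2 hfloor
  push_cast at hcast
  exact hcast

theorem sum_inv_sq_Icc_two_le (D : ℕ) :
    ∑ d ∈ Finset.Icc 2 D, (1 : ℝ) / (d : ℝ) ^ 2 ≤ 2 / 3 := by
  suffices h : ∀ D : ℕ, ∑ d ∈ Finset.Icc 2 (D + 1), (1 : ℝ) / (d : ℝ) ^ 2 ≤
      2 / 3 - 1 / (D + 3 / 2) by
    rcases D with _ | D
    · norm_num
    · exact (h D).trans (sub_le_self _ (by positivity))
  intro D
  induction D with
  | zero => norm_num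
  | succ k ih =>
    rw [Finset.sum_Icc_succ_top (by omega)]
    have : (1 : ℝ) / ((k + 1 + 1 : ℕ) : ℝ) ^ 2 ≤ 1 / (k + 3 / 2) - 1 / ((k + 1 : ℕ) + 3 / 2) := by
      push_cast
      rw [div_sub_div _ _ (by positivity) (by positivity),
        div_le_div_iff₀ (by positivity) (by positivity)]
      nlinarith
    linarith

theorem sum_inv_Icc_two_le (D : ℕ) :
    ∑ d ∈ Finset.Icc 2 D, (1 : ℝ) / (d : ℝ) ≤ 1 + Real.log D := by
  refine le_trans ?_ (harmonic_le_one_add_log D)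
  rw [harmonic_eq_sum_Icc]
  push_cast
  simp only [one_div]
  exact Finset.sum_le_sum_of_subset_of_nonneg (Finset.Icc_subset_Icc_left (by norm_num))
    fun _ _ _ => by positivity

open Finset in
theorem le_card_coprime_Ioc_product_Ioc (x y A B D : ℕ) (hD : y + B ≤ D) :
    (A * B : ℝ) / 3 - (A + B) * (1 + Real.log D) - D ≤
      #{ab ∈ Ioc x (x + A) ×ˢ Ioc y (y + B) | Nat.Coprime ab.1 ab.2} := by
  have hcover : Ioc x (x + A) ×ˢ Ioc y (y + B) ⊆
      {ab ∈ Ioc x (x + A) ×ˢ Ioc y (y + B) | Nat.Coprime ab.1 ab.2} ∪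
        (Icc 2 D).biUnion fun d =>
          {a ∈ Ioc x (x + A) | d ∣ a} ×ˢ {b ∈ Ioc y (y + B) | d ∣ b} := by
    rintro ⟨a, b⟩ hab
    by_cases hc : Nat.Coprime a b
    · exact mem_union_left _ (mem_filter.2 ⟨hab, hc⟩)
    · refine mem_union_right _ (mem_biUnion.2 ⟨a.gcd b, ?_, ?_⟩)
      · have hb := (mem_Ioc.1 (mem_product.1 hab).2)
        dsimp only at hb
        have h1 : a.gcd b ≤ b := Nat.gcd_le_right _ (by omega)
        have h2 : 0 < a.gcd b := Nat.gcd_pos_of_pos_right _ (by omega)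
        have h3 : a.gcd b ≠ 1 := hc
        exact mem_Icc.2 ⟨by omega, by omega⟩
      · simp only [mem_product] at hab
        simp only [mem_product, mem_filter]
        exact ⟨⟨hab.1, Nat.gcd_dvd_left _ _⟩, hab.2, Nat.gcd_dvd_right _ _⟩
  have hcard := (card_le_card hcover).trans
    ((card_union_le _ _).trans (Nat.add_le_add_left card_biUnion_le _))
  simp only [card_product, Nat.card_Ioc, Nat.add_sub_cancel_left] at hcard
  have hcard' : (A * B : ℝ) ≤ #{ab ∈ Ioc x (x + A) ×ˢ Ioc y (y + B) | Nat.Coprime ab.1 ab.2} +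
      ∑ d ∈ Icc 2 D, (#{a ∈ Ioc x (x + A) | d ∣ a} : ℝ) * #{b ∈ Ioc y (y + B) | d ∣ b} := by
    exact_mod_cast hcard
  have hsum : ∑ d ∈ Icc 2 D, (#{a ∈ Ioc x (x + A) | d ∣ a} : ℝ) * #{b ∈ Ioc y (y + B) | d ∣ b} ≤
      ∑ d ∈ Icc 2 D, ((A * B : ℝ) * (1 / (d : ℝ) ^ 2) + (A + B) * (1 / (d : ℝ)) + 1) := by
    refine sum_le_sum fun d hd => ?_
    have hd0 : 0 < d := by have := (mem_Icc.1 hd).1; omega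
    refine (mul_le_mul (card_filter_dvd_Ioc_le x A hd0) (card_filter_dvd_Ioc_le y B hd0)
      (by positivity) (by positivity)).trans (le_of_eq ?_)
    field_simp
    ring
  rw [sum_add_distrib, sum_add_distrib, ← mul_sum, ← mul_sum] at hsum
  have h1 := mul_le_mul_of_nonneg_left (sum_inv_sq_Icc_two_le D) (by positivity : (0 : ℝ) ≤ A * B)
  have h2 := mul_le_mul_of_nonneg_left (sum_inv_Icc_two_le D) (by positivity : (0 : ℝ) ≤ A + B)
  have h3 : ∑ d ∈ Icc 2 D, (1 : ℝ) ≤ D := by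
    simp only [sum_const, Nat.card_Icc, nsmul_eq_mul, mul_one]
    exact_mod_cast (by omega : D + 1 - 2 ≤ D)
  linarith

theorem pow_lt_two_mul_pow_of_sub_le {n : ℕ} (hn : 1 ≤ n) {P A a : ℝ} (hP : 0 < P)
    (hA : 4 * n * A ≤ P) (ha : P - A ≤ a) : P ^ n < 2 * a ^ n := by
  have hn' : (1 : ℝ) ≤ n := by exact_mod_cast hn
  set t : ℝ := -(1 / (4 * n)) with ht
  have hnt : n * t = -(1 / 4) := by rw [ht]; field_simp
  have ht1 : -(1 / 4) ≤ t := by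
    rw [ht, neg_le_neg_iff]
    exact one_div_le_one_div_of_le (by norm_num) (by linarith)
  have h1 : P * (1 + t) ≤ a := by
    refine le_trans ?_ ha
    have : A ≤ P * (1 / (4 * n)) := by
      rw [mul_one_div, le_div_iff₀ (by positivity)]
      linarith
    rw [ht]
    linarith
  have h2 := pow_le_pow_left₀ (mul_nonneg hP.le (by linarith)) h1 n
  have h3 := one_add_mul_le_pow (by linarith : -2 ≤ t) n
  rw [mul_pow] at h2
  have h4 := mul_le_mul_of_nonneg_left h3 (pow_pos hP n).le
  have h5 := pow_pos hP n
  rw [hnt] at h4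
  linarith

open Filter Topology in
theorem eventually_coprime_error_le {n m M : ℕ} (hn : 1 ≤ n) (hm : 1 ≤ m) (hM : 2 ≤ M) :
    ∀ᶠ k : ℕ in atTop,
      ((M : ℝ) ^ (m * k - 1) + (M : ℝ) ^ (n * k - 1)) * (1 + Real.log ((M : ℝ) ^ (n * k))) +
        (M : ℝ) ^ (n * k) ≤ (M : ℝ) ^ (m * k - 1) * (M : ℝ) ^ (n * k - 1) / 6 := by
  have hM1 : (1 : ℝ) < M := by exact_mod_cast hM
  have hlog : 0 < Real.log M := Real.log_pos hM1
  have h0 := (tendsto_pow_const_div_const_pow_of_one_lt 0 hM1).const_mul (1 + (M : ℝ))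
  have h1 := (tendsto_pow_const_div_const_pow_of_one_lt 1 hM1).const_mul (n * Real.log M)
  have h := h0.add h1
  simp only [mul_zero, add_zero] at h
  filter_upwards [h.eventually_le_const (by positivity : (0 : ℝ) < 1 / (24 * M)),
    eventually_ge_atTop 1] with k hk hk1
  have hMk : (0 : ℝ) < (M : ℝ) ^ (k - 1) := by positivity
  have hMk' : (M : ℝ) ^ k = (M : ℝ) ^ (k - 1) * M := by
    rw [← pow_succ, Nat.sub_add_cancel hk1]
  have hT : (1 + (M : ℝ)) + n * Real.log M * k ≤ (M : ℝ) ^ (k - 1) / 24 := by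
    rw [← mul_div_assoc, ← mul_div_assoc, ← add_div, div_le_div_iff₀ (by positivity) (by positivity),
      hMk', pow_zero, pow_one] at hk
    have : ((1 + (M : ℝ)) + n * Real.log M * k) * 24 * M ≤ (M : ℝ) ^ (k - 1) * M := by linarith
    have := le_of_mul_le_mul_right this (by positivity)
    linarith
  have hexp : ∀ j, 1 ≤ j → (M : ℝ) ^ (k - 1) ≤ (M : ℝ) ^ (j * k - 1) := fun j hj =>
    pow_le_pow_right₀ hM1.le (Nat.sub_le_sub_right (Nat.le_mul_of_pos_left k hj) 1)
  have hA := hexp m hm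
  have hB := hexp n hn
  have hQ : (M : ℝ) ^ (n * k) = M * (M : ℝ) ^ (n * k - 1) := by
    rw [← pow_succ', Nat.sub_add_cancel (Nat.mul_pos hn hk1)]
  have hL : Real.log ((M : ℝ) ^ (n * k)) = n * Real.log M * k := by
    rw [Real.log_pow]; push_cast; ring
  rw [hL, hQ]
  have hLnonneg : 0 ≤ n * Real.log M * k := by positivity
  generalize n * Real.log M * k = L at *
  generalize (M : ℝ) ^ (m * k - 1) = A at *
  generalize (M : ℝ) ^ (n * k - 1) = B at *
  generalize (M : ℝ) ^ (k - 1) = T at *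
  have hA0 : 0 < A := hMk.trans_le hA
  have hB0 : 0 < B := hMk.trans_le hB
  have e1 : A * (1 + L) ≤ A * (B / 24) := mul_le_mul_of_nonneg_left (by linarith) hA0.le
  have e2 : B * (1 + L) ≤ B * (A / 24) := mul_le_mul_of_nonneg_left (by linarith) hB0.le
  have e3 : B * M ≤ B * (A / 24) := mul_le_mul_of_nonneg_left (by linarith) hB0.le
  have e4 := mul_pos hA0 hB0
  linarith

/-- The coprime pairs of comparable heights. -/
def comparablePairs (n m : ℕ) : Set (ℕ × ℕ) :=
  {ab | 1 ≤ ab.1 ∧ 1 ≤ ab.2 ∧ Nat.Coprime ab.1 ab.2 ∧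
    (1 : ℝ) / 2 < (ab.1 : ℝ) ^ n / (ab.2 : ℝ) ^ m ∧ (ab.1 : ℝ) ^ n / (ab.2 : ℝ) ^ m < 2}

open Finset Filter in
theorem exists_comparable_coprime_blocks {n m : ℕ} (hn : 1 ≤ n) (hm : 1 ≤ m) :
    ∃ M : ℕ, 4 ≤ M ∧ ∃ c : ℝ, 0 < c ∧ ∀ᶠ k : ℕ in atTop, ∃ F : Finset (ℕ × ℕ),
      c * ((M ^ (m + n) : ℕ) : ℝ) ^ k ≤ #F ∧ ∀ ab ∈ F, ab ∈ comparablePairs n m ∧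
        (M ^ (n * m)) ^ k < 2 * max (ab.1 ^ n) (ab.2 ^ m) ∧
        max (ab.1 ^ n) (ab.2 ^ m) ≤ (M ^ (n * m)) ^ k := by
  have hnm : 1 ≤ n * m := Nat.mul_pos hn hm
  obtain ⟨M, hM⟩ : ∃ M, M = 4 * (n * m) := ⟨_, rfl⟩
  have hM4 : 4 ≤ M := by omega
  have hM0 : (0 : ℝ) < M := by exact_mod_cast (by omega : 0 < M)
  refine ⟨M, hM4, 1 / (6 * M ^ 2), by positivity, ?_⟩
  filter_upwards [eventually_coprime_error_le hn hm (by omega : 2 ≤ M),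
    eventually_ge_atTop 1] with k hk hk1
  have hsucc : ∀ j, 1 ≤ j → M ^ (j * k) = M * M ^ (j * k - 1) := fun j hj => by
    rw [← pow_succ', Nat.sub_add_cancel (Nat.mul_pos hj hk1)]
  have hP := hsucc m hm
  have hQ := hsucc n hn
  have hX1 : (M ^ (m * k)) ^ n = (M ^ (n * m)) ^ k := by
    rw [← pow_mul, ← pow_mul]; congr 1; ring
  have hX2 : (M ^ (n * k)) ^ m = (M ^ (n * m)) ^ k := by
    rw [← pow_mul, ← pow_mul]; congr 1; ring
  have hW : ((M ^ (m + n) : ℕ) : ℝ) ^ k = ((M ^ (m * k) : ℕ) : ℝ) * ((M ^ (n * k) : ℕ) : ℝ) := by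
    push_cast
    rw [← pow_mul, ← pow_add]; congr 1; ring
  have hA0 : 0 < M ^ (m * k - 1) := by positivity
  have hB0 : 0 < M ^ (n * k - 1) := by positivity
  have hk' : ((M ^ (m * k - 1) : ℕ) + (M ^ (n * k - 1) : ℕ) : ℝ) *
      (1 + Real.log (M ^ (n * k) : ℕ)) + (M ^ (n * k) : ℕ) ≤
      ((M ^ (m * k - 1) : ℕ) : ℝ) * (M ^ (n * k - 1) : ℕ) / 6 := by
    push_cast; exact hk
  clear hk
  generalize (M ^ (n * m)) ^ k = X at *
  generalize M ^ (m * k - 1) = A at *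
  generalize M ^ (n * k - 1) = B at *
  generalize M ^ (m * k) = P at *
  generalize M ^ (n * k) = Q at *
  have hAP : A ≤ P := by rw [hP]; exact Nat.le_mul_of_pos_left _ (by omega)
  have hBQ : B ≤ Q := by rw [hQ]; exact Nat.le_mul_of_pos_left _ (by omega)
  refine ⟨{ab ∈ Ioc (P - A) (P - A + A) ×ˢ Ioc (Q - B) (Q - B + B) | Nat.Coprime ab.1 ab.2},
    ?_, ?_⟩
  · refine le_trans ?_ (le_card_coprime_Ioc_product_Ioc (P - A) (Q - B) A B Q (by omega))
    have : 1 / (6 * (M : ℝ) ^ 2) * ((P : ℝ) * Q) = A * B / 6 := by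
      rw [hP, hQ]; push_cast; field_simp
    rw [hW, this]
    linarith
  · rintro ⟨a, b⟩ hab
    obtain ⟨hab, hcop⟩ := mem_filter.1 hab
    obtain ⟨ha, hb⟩ := mem_product.1 hab
    rw [Nat.sub_add_cancel hAP, mem_Ioc] at ha
    rw [Nat.sub_add_cancel hBQ, mem_Ioc] at hb
    dsimp only at ha hb hcop ⊢
    have hP0 : 0 < P := by omega
    have hQ0 : 0 < Q := by omega
    have h4A : 4 * n * A ≤ P := by
      rw [hP, hM]
      exact Nat.mul_le_mul_right A (by nlinarith)
    have h4B : 4 * m * B ≤ Q := by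
      rw [hQ, hM]
      exact Nat.mul_le_mul_right B (by nlinarith)
    have ha1 : (P : ℝ) - A ≤ a := by
      have : P ≤ a + A := by omega
      have : (P : ℝ) ≤ a + A := by exact_mod_cast this
      linarith
    have hb1 : (Q : ℝ) - B ≤ b := by
      have : Q ≤ b + B := by omega
      have : (Q : ℝ) ≤ b + B := by exact_mod_cast this
      linarith
    have ha2 := pow_lt_two_mul_pow_of_sub_le hn (by exact_mod_cast hP0) (by exact_mod_cast h4A) ha1
    have hb2 := pow_lt_two_mul_pow_of_sub_le hm (by exact_mod_cast hQ0) (by exact_mod_cast h4B) hb1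
    have ha3 : X < 2 * a ^ n := by rw [← hX1]; exact_mod_cast ha2
    have hb3 : X < 2 * b ^ m := by rw [← hX2]; exact_mod_cast hb2
    have ha4 : a ^ n ≤ X := by rw [← hX1]; exact Nat.pow_le_pow_left ha.2 n
    have hb4 : b ^ m ≤ X := by rw [← hX2]; exact Nat.pow_le_pow_left hb.2 m
    have hbpos : (0 : ℝ) < (b : ℝ) ^ m := by
      have : 0 < b := by omega
      positivity
    refine ⟨⟨by dsimp only; omega, by dsimp only; omega, hcop, ?_, ?_⟩, ?_, max_le ha4 hb4⟩
    · rw [lt_div_iff₀ hbpos]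
      have : (b : ℝ) ^ m < 2 * (a : ℝ) ^ n := by exact_mod_cast hb4.trans_lt ha3
      linarith
    · rw [div_lt_iff₀ hbpos]
      exact_mod_cast ha4.trans_lt hb3
    · exact ha3.trans_le (Nat.mul_le_mul_left 2 (le_max_left _ _))

open Finset in
/-- Condensation: summability of `f ∘ h` over a set containing at least `c * W ^ k` points of height
in `(Y ^ k / 2, Y ^ k]` for all large `k` gives summability of `W ^ k * f (Y ^ k)`. -/
theorem summable_pow_mul_of_le_card_blocks {ι : Type*} {S : Set ι} {h : ι → ℕ} {f : ℕ → ℝ}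
    (hf : ∀ q, 0 ≤ f q) (hanti : AntitoneOn f (Set.Ici 1)) (hh : ∀ x ∈ S, 1 ≤ h x)
    {Y : ℕ} (hY : 2 ≤ Y) {W c : ℝ} (hW : 0 ≤ W) (hc : 0 < c)
    (hF : ∀ᶠ k : ℕ in Filter.atTop, ∃ F : Finset ι, c * W ^ k ≤ #F ∧
      ∀ x ∈ F, x ∈ S ∧ Y ^ k < 2 * h x ∧ h x ≤ Y ^ k)
    (hS : Summable fun x : S => f (h x)) :
    Summable fun k : ℕ => W ^ k * f (Y ^ k) := by
  classical
  obtain ⟨k₀, hk₀⟩ := Filter.eventually_atTop.1 hF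
  choose! F hcard hmem using hk₀
  rw [← summable_nat_add_iff k₀]
  have hS' : Summable (S.indicator fun x => f (h x)) := summable_subtype_iff_indicator.1 hS
  have hdisj : ∀ i j, i < j → k₀ ≤ i → Disjoint (F i) (F j) := fun i j hij hi => by
    refine disjoint_left.2 fun x hxi hxj => ?_
    have h1 := (hmem i hi x hxi).2.2
    have h2 := (hmem j (hi.trans hij.le) x hxj).2.1
    have h3 : Y ^ (i + 1) ≤ Y ^ j := Nat.pow_le_pow_right (by omega) hij
    have h4 : 2 * Y ^ i ≤ Y ^ (i + 1) := by
      rw [pow_succ']; exact Nat.mul_le_mul_right _ hY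
    omega
  refine summable_of_sum_range_le (c := (∑' x, S.indicator (fun x => f (h x)) x) / c)
    (fun k => mul_nonneg (pow_nonneg hW _) (hf _)) fun N => ?_
  rw [le_div_iff₀ hc, sum_mul]
  calc ∑ k ∈ range N, W ^ (k + k₀) * f (Y ^ (k + k₀)) * c
      ≤ ∑ k ∈ range N, ∑ x ∈ F (k + k₀), S.indicator (fun x => f (h x)) x := by
        refine sum_le_sum fun k _ => ?_
        have hk : k₀ ≤ k + k₀ := Nat.le_add_left _ _
        calc W ^ (k + k₀) * f (Y ^ (k + k₀)) * c = (c * W ^ (k + k₀)) * f (Y ^ (k + k₀)) := by ring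
          _ ≤ #(F (k + k₀)) * f (Y ^ (k + k₀)) :=
            mul_le_mul_of_nonneg_right (hcard _ hk) (hf _)
          _ = ∑ x ∈ F (k + k₀), f (Y ^ (k + k₀)) := by rw [sum_const, nsmul_eq_mul]
          _ ≤ _ := by
            refine sum_le_sum fun x hx => ?_
            obtain ⟨hxS, -, hle⟩ := hmem _ hk x hx
            rw [Set.indicator_of_mem hxS]
            exact hanti (hh x hxS) ((hh x hxS).trans hle) hle
    _ = ∑ x ∈ (range N).biUnion fun k => F (k + k₀), S.indicator (fun x => f (h x)) x := by
        refine (sum_biUnion fun i _ j _ hij => ?_).symm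
        rcases Nat.lt_or_gt_of_ne hij with hlt | hlt
        · exact hdisj _ _ (by omega) (by omega)
        · exact (hdisj _ _ (by omega) (by omega)).symm
    _ ≤ _ := hS'.sum_le_tsum _ fun x _ => Set.indicator_nonneg (fun x _ => hf _) x

open Finset in
/-- Condensation: if at most `C * W ^ k` points have height in `[Y ^ k, Y ^ (k + 1))`, then
summability of `W ^ k * f (Y ^ k)` gives summability of `f ∘ h`. -/
theorem summable_of_summable_pow_mul {ι : Type*} {h : ι → ℕ} {f : ℕ → ℝ}
    (hf : ∀ q, 0 ≤ f q) (hanti : AntitoneOn f (Set.Ici 1)) (hh : ∀ x, 1 ≤ h x)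
    {Y : ℕ} (hY : 2 ≤ Y) {W C : ℝ} (hW : 0 ≤ W) (hC : 0 ≤ C)
    (hcard : ∀ k (s : Finset ι), (∀ x ∈ s, h x < Y ^ (k + 1)) → (#s : ℝ) ≤ C * W ^ k)
    (hS : Summable fun k : ℕ => W ^ k * f (Y ^ k)) :
    Summable fun x => f (h x) := by
  classical
  refine summable_of_sum_le (c := ∑' k : ℕ, C * (W ^ k * f (Y ^ k))) (fun x => hf _) fun s => ?_
  calc ∑ x ∈ s, f (h x)
      = ∑ k ∈ s.image fun x => Nat.log Y (h x), ∑ x ∈ s with Nat.log Y (h x) = k, f (h x) :=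
        (sum_fiberwise_of_maps_to (fun x hx => mem_image_of_mem _ hx) _).symm
    _ ≤ ∑ k ∈ s.image fun x => Nat.log Y (h x), C * (W ^ k * f (Y ^ k)) := by
        refine sum_le_sum fun k _ => ?_
        calc ∑ x ∈ s with Nat.log Y (h x) = k, f (h x)
            ≤ ∑ x ∈ s with Nat.log Y (h x) = k, f (Y ^ k) := by
              refine sum_le_sum fun x hx => ?_
              have hle : Y ^ k ≤ h x := by
                rw [← (mem_filter.1 hx).2]
                exact Nat.pow_log_le_self Y (Nat.one_le_iff_ne_zero.1 (hh x))
              exact hanti (Nat.one_le_pow _ _ (by omega)) (hh x) hle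
          _ = #{x ∈ s | Nat.log Y (h x) = k} * f (Y ^ k) := by rw [sum_const, nsmul_eq_mul]
          _ ≤ C * W ^ k * f (Y ^ k) := by
              refine mul_le_mul_of_nonneg_right (hcard k _ fun x hx => ?_) (hf _)
              rw [← (mem_filter.1 hx).2]
              exact Nat.lt_pow_succ_log_self (by omega) _
          _ = _ := mul_assoc _ _ _
    _ ≤ _ := (hS.mul_left C).sum_le_tsum _ fun k _ =>
        mul_nonneg hC (mul_nonneg (pow_nonneg hW _) (hf _))

theorem antitoneOn_div_rpow {ψ : ℕ → ℝ} (hψ : ∀ q, 0 ≤ ψ q) (hanti : Antitone ψ) {e : ℝ}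
    (he : 0 ≤ e) : AntitoneOn (fun q : ℕ => ψ q / (q : ℝ) ^ e) (Set.Ici 1) := by
  intro x hx y _ hxy
  have hx0 : (0 : ℝ) < x := by exact_mod_cast (Set.mem_Ici.1 hx)
  exact div_le_div₀ (hψ x) (hanti hxy) (Real.rpow_pos_of_pos hx0 e)
    (Real.rpow_le_rpow hx0.le (by exact_mod_cast hxy) he)

open Finset in
theorem card_le_of_max_pow_lt {n m M k : ℕ}
    (s : Finset {ab : ℕ × ℕ // 1 ≤ ab.1 ∧ 1 ≤ ab.2})
    (hs : ∀ ab ∈ s, max (ab.1.1 ^ n) (ab.1.2 ^ m) < (M ^ (n * m)) ^ (k + 1)) :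
    (#s : ℝ) ≤ ((M ^ (m + n) : ℕ) : ℝ) * ((M ^ (m + n) : ℕ) : ℝ) ^ k := by
  have hX1 : (M ^ (n * m)) ^ (k + 1) = (M ^ (m * (k + 1))) ^ n := by
    rw [← pow_mul, ← pow_mul]; congr 1; ring
  have hX2 : (M ^ (n * m)) ^ (k + 1) = (M ^ (n * (k + 1))) ^ m := by
    rw [← pow_mul, ← pow_mul]; congr 1; ring
  have hmap : ∀ ab ∈ s, ab.1 ∈ range (M ^ (m * (k + 1))) ×ˢ range (M ^ (n * (k + 1))) :=
    fun ab hab => by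
      obtain ⟨h1, h2⟩ := max_lt_iff.1 (hs ab hab)
      rw [hX1] at h1
      rw [hX2] at h2
      exact mem_product.2 ⟨mem_range.2 (lt_of_pow_lt_pow_left₀ n (Nat.zero_le _) h1),
        mem_range.2 (lt_of_pow_lt_pow_left₀ m (Nat.zero_le _) h2)⟩
  have h := card_le_card_of_injOn _ hmap Subtype.val_injective.injOn
  rw [card_product, card_range, card_range] at h
  have he : M ^ (m * (k + 1)) * M ^ (n * (k + 1)) = M ^ (m + n) * (M ^ (m + n)) ^ k := by
    rw [← pow_mul, ← pow_add, ← pow_add]; congr 1; ring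
  rw [he] at h
  exact_mod_cast h


theorem summable_iff_summable_comparablePairs {n m : ℕ} (hn : 1 ≤ n) (hm : 1 ≤ m) {f : ℕ → ℝ}
    (hf : ∀ q, 0 ≤ f q) (hanti : AntitoneOn f (Set.Ici 1)) :
    (Summable fun ab : {ab : ℕ × ℕ // 1 ≤ ab.1 ∧ 1 ≤ ab.2} => f (max (ab.1.1 ^ n) (ab.1.2 ^ m))) ↔
      Summable fun ab : comparablePairs n m => f (max (ab.1.1 ^ n) (ab.1.2 ^ m)) := by
  refine ⟨fun h => ?_, fun h => ?_⟩
  · have hsub : ∀ ab : ℕ × ℕ, ab ∈ comparablePairs n m → 1 ≤ ab.1 ∧ 1 ≤ ab.2 :=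
      fun _ hab => ⟨hab.1, hab.2.1⟩
    have hcomp := h.comp_injective (i := fun ab : comparablePairs n m => ⟨ab.1, hsub ab.1 ab.2⟩)
      fun x y hxy => Subtype.ext (by simpa only [Subtype.mk.injEq] using hxy)
    simpa only [Function.comp_def] using hcomp
  · obtain ⟨M, hM, c, hc, hF⟩ := exists_comparable_coprime_blocks hn hm
    have hY : 2 ≤ M ^ (n * m) :=
      (by omega : 2 ≤ M).trans (Nat.le_self_pow (Nat.mul_pos hn hm).ne' M)
    have hblocks := summable_pow_mul_of_le_card_blocks
      (h := fun ab : ℕ × ℕ => max (ab.1 ^ n) (ab.2 ^ m)) hf hanti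
      (fun ab hab => le_max_of_le_left (Nat.one_le_pow n ab.1 hab.1)) hY (Nat.cast_nonneg _) hc hF h
    exact summable_of_summable_pow_mul hf hanti
      (fun ab => le_max_of_le_left (Nat.one_le_pow n ab.1.1 ab.2.1)) hY
      (Nat.cast_nonneg _) (Nat.cast_nonneg _) (fun k s hs => card_le_of_max_pow_lt s hs) hblocks


theorem stmt7 (n m p : ℕ) (hn : 1 ≤ n) (hm : 1 ≤ m) (hp : 1 ≤ p)
    (ψ : ℕ → ℝ) (hψpos : ∀ q, 0 < ψ q) (hψanti : Antitone ψ) :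
    (¬ Summable (fun ab : {ab : ℕ × ℕ // 1 ≤ ab.1 ∧ 1 ≤ ab.2} =>
        ψ (max (ab.1.1 ^ n) (ab.1.2 ^ m)) /
          ((max (ab.1.1 ^ n) (ab.1.2 ^ m) : ℕ) : ℝ) ^ (1 - 1 / (p : ℝ)))) ↔
    (¬ Summable (fun ab : {ab : ℕ × ℕ // 1 ≤ ab.1 ∧ 1 ≤ ab.2 ∧ Nat.Coprime ab.1 ab.2 ∧
          (1 : ℝ) / 2 < (ab.1 : ℝ) ^ n / (ab.2 : ℝ) ^ m ∧
          (ab.1 : ℝ) ^ n / (ab.2 : ℝ) ^ m < 2} =>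
        ψ (max (ab.1.1 ^ n) (ab.1.2 ^ m)) /
          ((max (ab.1.1 ^ n) (ab.1.2 ^ m) : ℕ) : ℝ) ^ (1 - 1 / (p : ℝ)))) := by
  have hp' : (1 : ℝ) ≤ p := by exact_mod_cast hp
  have he : 0 ≤ 1 - 1 / (p : ℝ) := sub_nonneg.2 ((div_le_one (by linarith)).2 hp')
  have hψ0 : ∀ q, 0 ≤ ψ q := fun q => (hψpos q).le
  exact not_congr (summable_iff_summable_comparablePairs hn hm
    (f := fun q : ℕ => ψ q / (q : ℝ) ^ (1 - 1 / (p : ℝ)))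
    (fun q => div_nonneg (hψ0 q) (Real.rpow_nonneg (Nat.cast_nonneg q) _))
    (antitoneOn_div_rpow hψ0 hψanti he))
end
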